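/- Let (X_i)_{i≥0} be a stationary ergodic Markov chain with invariant measure μ and transition kernel K. Assume f ∈ C(M,p,μ) for some M > 0 and p ∈ (2,∞], and that Σ_{k>0} (α_1(k))^{(p−2)/p} < ∞. Then n^{−1/2} Σ_{i=1}^n (f(X_i) − μ(f)) converges in distribution to the centered Gaussian law with variance σ^2(μ,K,f). -/

import Mathlib

open MeasureTheory ProbabilityTheory Filter Set
open scoped ENNReal NNReal Topology

noncomputable section

/-- The intermittent (Liverani–Saussol–Vaienti) map `T_γ` on `[0,1]`. -/
def Tmap (γ : ℝ) (x : ℝ) : ℝ :=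
  if x < 1/2 then x * (1 + 2 ^ γ * x ^ γ) else 2 * x - 1

/-- `K` is the Perron–Frobenius operator of `T_γ` with respect to `ν`:
`ν(f · g∘T_γ) = ν(K f · g)` for all bounded measurable `f, g`. -/
def IsPFOp (γ : ℝ) (ν : Measure ℝ) (K : (ℝ → ℝ) → ℝ → ℝ) : Prop :=
  ∀ f g : ℝ → ℝ, Measurable f → Measurable g → (∃ C, ∀ x, |f x| ≤ C) →
    (∃ C, ∀ x, |g x| ≤ C) →
    ∫ x, f x * g (Tmap γ x) ∂ν = ∫ x, (K f) x * g x ∂ν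

/-- Birkhoff sums `S_n(f) = ∑_{i=1}^n f ∘ T_γ^i`. -/
def Sn (γ : ℝ) (f : ℝ → ℝ) (n : ℕ) (x : ℝ) : ℝ :=
  ∑ i ∈ Finset.range n, f ((Tmap γ)^[i + 1] x)

/-- The class `H_{α,1}` of `α`-Hölder functions (with constant 1) on `[0,1]`. -/
def Hclass (α : ℝ) : Set (ℝ → ℝ) :=
  {f | ∀ x ∈ Set.Icc (0:ℝ) 1, ∀ y ∈ Set.Icc (0:ℝ) 1, |f x - f y| ≤ |x - y| ^ α}

/-- `f_t = 1_{(-∞, t]}`. -/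
def indic (t : ℝ) : ℝ → ℝ := Set.indicator (Set.Iic t) (fun _ => 1)

/-- Nested operator `K^{(n_1,…,n_k)}(f_1,…,f_k)
= K^{n_1}(f_1 · K^{n_2}(f_2 ⋯ K^{n_k}(f_k)⋯))`, encoded by a list of pairs. -/
def nestedK (K : (ℝ → ℝ) → ℝ → ℝ) : List (ℕ × (ℝ → ℝ)) → ℝ → ℝ
  | [] => fun _ => 1
  | (n, f) :: r => K^[n] (fun x => f x * nestedK K r x)

/-- The list `[(n, f_{t_1}), (n_2, f_{t_2}), …, (n_l, f_{t_l})]`. -/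
def tList (n : ℕ) {l : ℕ} (ns : Fin l → ℕ) (ts : Fin (l + 1) → ℝ) :
    List (ℕ × (ℝ → ℝ)) :=
  (n, indic (ts 0)) :: List.ofFn (fun i : Fin l => (ns i, indic (ts i.succ)))

/-- The coefficient `α_1(n)` for an operator `K` with invariant measure `ν`. -/
def alpha1 (K : (ℝ → ℝ) → ℝ → ℝ) (ν : Measure ℝ) (n : ℕ) : ℝ :=
  ⨆ t : ℝ, ∫ x, |K^[n] (indic t) x - ∫ y, indic t y ∂ν| ∂ν

/-- The dependence coefficient `α_k(n)`. -/
def alphaCoef (K : (ℝ → ℝ) → ℝ → ℝ) (ν : Measure ℝ) (k n : ℕ) : ℝ :=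
  max (alpha1 K ν n)
    (⨆ j : Fin (k - 1), ⨆ ns : {m : Fin (j.1 + 1) → ℕ // ∀ i, 1 ≤ m i},
      ⨆ ts : Fin (j.1 + 2) → ℝ,
        ∫ x, |nestedK K (tList n ns.1 ts) x - ∫ y, nestedK K (tList n ns.1 ts) y ∂ν| ∂ν)

/-- The dependence coefficient `β_1(n)`. -/
def beta1 (K : (ℝ → ℝ) → ℝ → ℝ) (ν : Measure ℝ) (n : ℕ) : ℝ :=
  ∫ x, (⨆ t : ℝ, |K^[n] (indic t) x - ∫ y, indic t y ∂ν|) ∂ν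

/-- The dependence coefficient `β_k(n)`. -/
def betaCoef (K : (ℝ → ℝ) → ℝ → ℝ) (ν : Measure ℝ) (k n : ℕ) : ℝ :=
  max (beta1 K ν n)
    (⨆ j : Fin (k - 1), ⨆ ns : {m : Fin (j.1 + 1) → ℕ // ∀ i, 1 ≤ m i},
      ∫ x, (⨆ ts : Fin (j.1 + 2) → ℝ,
        |nestedK K (tList n ns.1 ts) x - ∫ y, nestedK K (tList n ns.1 ts) y ∂ν|) ∂ν)

/-- The operator associated with a Markov transition kernel: `(Kg)(x) = ∫ g(y) K(x,dy)`. -/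
def Kop (K : Kernel ℝ ℝ) (g : ℝ → ℝ) : ℝ → ℝ := fun x => ∫ y, g y ∂(K x)

/-- The class `Mon(M,p,μ)` of monotonic functions on an open interval, vanishing
elsewhere, with tail condition `μ(|g|>t) ≤ M^p t^{-p}` (for `p < ∞`),
resp. `μ(|g|>M) = 0` (for `p = ∞`). -/
def Mon (M : ℝ) (p : ℝ≥0∞) (μ : Measure ℝ) (g : ℝ → ℝ) : Prop :=
  (∃ I : Set ℝ, IsOpen I ∧ I.OrdConnected ∧ (MonotoneOn g I ∨ AntitoneOn g I) ∧
      ∀ x ∉ I, g x = 0) ∧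
  (if p = ∞ then μ {x | M < |g x|} = 0
   else ∀ t : ℝ, 0 < t →
      μ {x | t < |g x|} ≤ ENNReal.ofReal (M ^ p.toReal * t ^ (-p.toReal)))

/-- The class `C(M,p,μ)`: the closure in `L¹(μ)` of convex-type combinations
`∑ a_i g_i`, `∑ |a_i| ≤ 1`, `g_i ∈ Mon(M,p,μ)`. -/
def ClassC (M : ℝ) (p : ℝ≥0∞) (μ : Measure ℝ) (f : ℝ → ℝ) : Prop :=
  Integrable f μ ∧ ∀ ε : ℝ, 0 < ε → ∃ (n : ℕ) (a : Fin n → ℝ) (g : Fin n → ℝ → ℝ),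
    (∑ i, |a i|) ≤ 1 ∧ (∀ i, Mon M p μ (g i)) ∧
    ∫ x, |f x - ∑ i, a i * g i x| ∂μ < ε

/-- The class `Lip_c` of functions `g` with `|g(x) − g(y)| ≤ c(|x−y|)`. -/
def LipC (c : ℝ → ℝ) : Set (ℝ → ℝ) := {g | ∀ x y : ℝ, |g x - g y| ≤ c |x - y|}

/-- The distance `d_c(P,Q) = sup_{g ∈ Lip_c} |P(g) − Q(g)|`. -/
def dC (c : ℝ → ℝ) (P Q : Measure ℝ) : ℝ :=
  ⨆ g : LipC c, |(∫ x, (g : ℝ → ℝ) x ∂P) - ∫ x, (g : ℝ → ℝ) x ∂Q|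

set_option linter.unusedSectionVars false

/-- `u` is measurable and bounded by `C`. -/
structure BddMeas (u : ℝ → ℝ) (C : ℝ) : Prop where
  meas : Measurable u
  bound : ∀ x, |u x| ≤ C

namespace BddMeas

variable {u v : ℝ → ℝ} {C D : ℝ}

lemma nonneg (hu : BddMeas u C) : 0 ≤ C := (abs_nonneg _).trans (hu.bound 0)

lemma integrable (hu : BddMeas u C) (ν : Measure ℝ) [IsFiniteMeasure ν] : Integrable u ν :=
  Integrable.of_bound hu.meas.aestronglyMeasurable C (ae_of_all _ hu.bound)

lemma abs_integral_le (hu : BddMeas u C) (ν : Measure ℝ) [IsProbabilityMeasure ν] :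
    |∫ x, u x ∂ν| ≤ C := by
  have := norm_integral_le_of_norm_le_const (μ := ν) (f := u) (ae_of_all _ hu.bound)
  simpa using this

lemma add (hu : BddMeas u C) (hv : BddMeas v D) : BddMeas (fun x => u x + v x) (C + D) :=
  ⟨hu.meas.add hv.meas, fun x => (abs_add_le _ _).trans (add_le_add (hu.bound x) (hv.bound x))⟩

lemma sub (hu : BddMeas u C) (hv : BddMeas v D) : BddMeas (fun x => u x - v x) (C + D) :=
  ⟨hu.meas.sub hv.meas, fun x => (abs_sub _ _).trans (add_le_add (hu.bound x) (hv.bound x))⟩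

lemma mul (hu : BddMeas u C) (hv : BddMeas v D) : BddMeas (fun x => u x * v x) (C * D) :=
  ⟨hu.meas.mul hv.meas, fun x => by
    rw [abs_mul]; exact mul_le_mul (hu.bound x) (hv.bound x) (abs_nonneg _) hu.nonneg⟩

lemma const (c : ℝ) : BddMeas (fun _ => c) |c| := ⟨measurable_const, fun _ => le_rfl⟩

lemma const_mul (hu : BddMeas u C) (c : ℝ) : BddMeas (fun x => c * u x) (|c| * C) :=
  (const c).mul hu

lemma sum {ι : Type*} (s : Finset ι) {u : ι → ℝ → ℝ} {C : ι → ℝ}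
    (hu : ∀ i ∈ s, BddMeas (u i) (C i)) : BddMeas (fun x => ∑ i ∈ s, u i x) (∑ i ∈ s, C i) :=
  ⟨Finset.measurable_sum s fun i hi => (hu i hi).meas, fun x =>
    (Finset.abs_sum_le_sum_abs _ _).trans (Finset.sum_le_sum fun i hi => (hu i hi).bound x)⟩

lemma kop (hu : BddMeas u C) (K : Kernel ℝ ℝ) [IsMarkovKernel K] : BddMeas (Kop K u) C :=
  ⟨(hu.meas.stronglyMeasurable.integral_kernel (κ := K)).measurable,
    fun x => hu.abs_integral_le (K x)⟩

lemma kop_iterate (hu : BddMeas u C) (K : Kernel ℝ ℝ) [IsMarkovKernel K] (n : ℕ) :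
    BddMeas ((Kop K)^[n] u) C := by
  induction n with
  | zero => exact hu
  | succ n ih => rw [Function.iterate_succ_apply']; exact ih.kop K

end BddMeas

section linear

variable {u v : ℝ → ℝ} {C D : ℝ} (K : Kernel ℝ ℝ) [IsMarkovKernel K]

lemma kop_iterate_const (c : ℝ) (n : ℕ) : (Kop K)^[n] (fun _ => c) = fun _ => c := by
  induction n with
  | zero => rfl
  | succ n ih => rw [Function.iterate_succ_apply', ih]; funext x; simp [Kop]

lemma kop_iterate_add (hu : BddMeas u C) (hv : BddMeas v D) (n : ℕ) :
    (Kop K)^[n] (fun x => u x + v x) = fun x => (Kop K)^[n] u x + (Kop K)^[n] v x := by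
  induction n with
  | zero => rfl
  | succ n ih =>
    simp only [Function.iterate_succ_apply', ih]
    funext x
    exact integral_add ((hu.kop_iterate K n).integrable _) ((hv.kop_iterate K n).integrable _)

lemma kop_iterate_sub (hu : BddMeas u C) (hv : BddMeas v D) (n : ℕ) :
    (Kop K)^[n] (fun x => u x - v x) = fun x => (Kop K)^[n] u x - (Kop K)^[n] v x := by
  induction n with
  | zero => rfl
  | succ n ih =>
    simp only [Function.iterate_succ_apply', ih]
    funext x
    exact integral_sub ((hu.kop_iterate K n).integrable _) ((hv.kop_iterate K n).integrable _)

lemma kop_iterate_const_mul (u : ℝ → ℝ) (c : ℝ) (n : ℕ) :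
    (Kop K)^[n] (fun x => c * u x) = fun x => c * (Kop K)^[n] u x := by
  induction n with
  | zero => rfl
  | succ n ih =>
    simp only [Function.iterate_succ_apply', ih]
    funext x
    exact integral_const_mul _ _

lemma kop_iterate_sum {ι : Type*} (s : Finset ι) {u : ι → ℝ → ℝ} {C : ι → ℝ}
    (hu : ∀ i ∈ s, BddMeas (u i) (C i)) (n : ℕ) :
    (Kop K)^[n] (fun x => ∑ i ∈ s, u i x) = fun x => ∑ i ∈ s, (Kop K)^[n] (u i) x := by
  induction n with
  | zero => rfl
  | succ n ih =>
    simp only [Function.iterate_succ_apply', ih]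
    funext x
    exact integral_finsetSum _ fun i hi => ((hu i hi).kop_iterate K n).integrable _

end linear

section invariant

variable {u v : ℝ → ℝ} {C D : ℝ} {μ : Measure ℝ} [IsProbabilityMeasure μ]
  {K : Kernel ℝ ℝ} [IsMarkovKernel K]

lemma integrable_comp_const (hinv : μ.bind (fun x => K x) = μ) (hu : Integrable u μ) :
    Integrable u ((K ∘ₖ Kernel.const Unit μ) ()) := by
  rwa [← Measure.comp_eq_comp_const_apply, show μ.bind K = μ from hinv]

lemma integrable_kop (hinv : μ.bind (fun x => K x) = μ) (hu : Integrable u μ) :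
    Integrable (Kop K u) μ := by
  have h := (integrable_comp_const hinv hu).integral_comp
  rwa [Kernel.const_apply] at h

lemma integral_kop (hinv : μ.bind (fun x => K x) = μ) (hu : Integrable u μ) :
    ∫ x, Kop K u x ∂μ = ∫ x, u x ∂μ := by
  have h := Kernel.integral_comp (integrable_comp_const hinv hu)
  rw [← Measure.comp_eq_comp_const_apply, show μ.bind K = μ from hinv, Kernel.const_apply] at h
  exact h.symm

lemma ae_integrable_kernel (hinv : μ.bind (fun x => K x) = μ) (hu : Integrable u μ) :
    ∀ᵐ x ∂μ, Integrable u (K x) := by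
  have h : Integrable u (μ.bind K) := by rwa [show μ.bind K = μ from hinv]
  exact Measure.ae_integrable_of_integrable_comp h

lemma integral_abs_kop_le (hinv : μ.bind (fun x => K x) = μ) (hu : Integrable u μ) :
    ∫ x, |Kop K u x| ∂μ ≤ ∫ x, |u x| ∂μ := by
  rw [← integral_kop hinv hu.abs]
  exact integral_mono (integrable_kop hinv hu).abs (integrable_kop hinv hu.abs)
    fun x => abs_integral_le_integral_abs

lemma integrable_kop_iterate (hinv : μ.bind (fun x => K x) = μ) (hu : Integrable u μ) (n : ℕ) :
    Integrable ((Kop K)^[n] u) μ := by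
  induction n with
  | zero => exact hu
  | succ n ih => rw [Function.iterate_succ_apply']; exact integrable_kop hinv ih

lemma integral_kop_iterate (hinv : μ.bind (fun x => K x) = μ) (hu : Integrable u μ) (n : ℕ) :
    ∫ x, (Kop K)^[n] u x ∂μ = ∫ x, u x ∂μ := by
  induction n with
  | zero => rfl
  | succ n ih =>
    rw [Function.iterate_succ_apply', integral_kop hinv (integrable_kop_iterate hinv hu n), ih]

lemma integral_abs_kop_iterate_le (hinv : μ.bind (fun x => K x) = μ) (hu : Integrable u μ)
    (n : ℕ) : ∫ x, |(Kop K)^[n] u x| ∂μ ≤ ∫ x, |u x| ∂μ := by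
  induction n with
  | zero => exact le_rfl
  | succ n ih =>
    rw [Function.iterate_succ_apply']
    exact (integral_abs_kop_le hinv (integrable_kop_iterate hinv hu n)).trans ih

/-- `‖K^n u - μ(u)‖` in `L¹(μ)`. -/
def mixc (K : Kernel ℝ ℝ) (μ : Measure ℝ) (u : ℝ → ℝ) (n : ℕ) : ℝ :=
  ∫ x, |(Kop K)^[n] u x - ∫ y, u y ∂μ| ∂μ

lemma mixc_nonneg (u : ℝ → ℝ) (n : ℕ) : 0 ≤ mixc K μ u n :=
  integral_nonneg fun _ => abs_nonneg _

lemma mixc_le_two_mul (hinv : μ.bind (fun x => K x) = μ) (hu : Integrable u μ) (n : ℕ) :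
    mixc K μ u n ≤ 2 * ∫ x, |u x| ∂μ := by
  have hi := integrable_kop_iterate (K := K) hinv hu n
  calc mixc K μ u n ≤ ∫ x, (|(Kop K)^[n] u x| + |∫ y, u y ∂μ|) ∂μ :=
        integral_mono (hi.sub (integrable_const _)).abs (hi.abs.add (integrable_const _))
          fun x => abs_sub _ _
    _ = ∫ x, |(Kop K)^[n] u x| ∂μ + |∫ y, u y ∂μ| := by
        rw [integral_add hi.abs (integrable_const _)]; simp
    _ ≤ _ := by
        have h1 := integral_abs_kop_iterate_le (K := K) hinv hu n
        have h2 : |∫ y, u y ∂μ| ≤ ∫ x, |u x| ∂μ := abs_integral_le_integral_abs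
        linarith

lemma mixc_add_le (hu : BddMeas u C) (hv : BddMeas v D) (n : ℕ) :
    mixc K μ (fun x => u x + v x) n ≤ mixc K μ u n + mixc K μ v n := by
  have hi : Integrable (fun x => |(Kop K)^[n] u x - ∫ y, u y ∂μ|) μ :=
    (((hu.kop_iterate K n).integrable μ).sub (integrable_const _)).abs
  have hj : Integrable (fun x => |(Kop K)^[n] v x - ∫ y, v y ∂μ|) μ :=
    (((hv.kop_iterate K n).integrable μ).sub (integrable_const _)).abs
  unfold mixc
  rw [kop_iterate_add K hu hv, integral_add (hu.integrable μ) (hv.integrable μ),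
    ← integral_add hi hj]
  refine integral_mono_of_nonneg (ae_of_all _ fun _ => abs_nonneg _) (hi.add hj)
    (ae_of_all _ fun x => ?_)
  dsimp only
  rw [add_sub_add_comm]
  exact abs_add_le _ _

lemma mixc_const_mul (u : ℝ → ℝ) (c : ℝ) (n : ℕ) :
    mixc K μ (fun x => c * u x) n = |c| * mixc K μ u n := by
  unfold mixc
  rw [kop_iterate_const_mul, ← integral_const_mul]
  simp only [integral_const_mul c u, ← mul_sub, abs_mul]

lemma mixc_const (c : ℝ) (n : ℕ) : mixc K μ (fun _ => c) n = 0 := by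
  simp [mixc, kop_iterate_const]

lemma mixc_sub_le (hu : BddMeas u C) (hv : BddMeas v D) (n : ℕ) :
    mixc K μ (fun x => u x - v x) n ≤ mixc K μ u n + mixc K μ v n := by
  have h := mixc_add_le (K := K) (μ := μ) hu (hv.const_mul (-1)) n
  rw [mixc_const_mul] at h
  simpa [sub_eq_add_neg] using h

lemma mixc_sum_le {ι : Type*} (s : Finset ι) {u : ι → ℝ → ℝ} {C : ι → ℝ}
    (hu : ∀ i ∈ s, BddMeas (u i) (C i)) (n : ℕ) :
    mixc K μ (fun x => ∑ i ∈ s, u i x) n ≤ ∑ i ∈ s, mixc K μ (u i) n := by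
  classical
  induction s using Finset.induction_on with
  | empty => simp [mixc_const]
  | insert a s ha ih =>
    simp only [Finset.sum_insert ha]
    have hs : ∀ i ∈ s, BddMeas (u i) (C i) := fun i hi => hu i (Finset.mem_insert_of_mem hi)
    exact (mixc_add_le (hu a (Finset.mem_insert_self _ _)) (BddMeas.sum s hs) n).trans
      (by gcongr; exact ih hs)

/-- Up to an `L¹` error, mixing coefficients of nearby functions are close. -/
lemma mixc_le_add_two_mul (hinv : μ.bind (fun x => K x) = μ) (hu : BddMeas u C)
    (hv : BddMeas v D) (n : ℕ) :
    mixc K μ u n ≤ mixc K μ v n + 2 * ∫ x, |u x - v x| ∂μ := by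
  have h := mixc_add_le (K := K) (μ := μ) hv (hu.sub hv) n
  simp only [add_sub_cancel] at h
  exact h.trans (by gcongr; exact mixc_le_two_mul hinv ((hu.sub hv).integrable μ) n)

/-- The covariance of `u` and `v` at lag `n`. -/
def lagCov (K : Kernel ℝ ℝ) (μ : Measure ℝ) (u v : ℝ → ℝ) (n : ℕ) : ℝ :=
  ∫ x, (u x - ∫ y, u y ∂μ) * (Kop K)^[n] v x ∂μ

lemma lagCov_eq (hinv : μ.bind (fun x => K x) = μ) (hu : BddMeas u C) (hv : BddMeas v D) (n : ℕ) :
    lagCov K μ u v n = ∫ x, u x * ((Kop K)^[n] v x - ∫ y, v y ∂μ) ∂μ := by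
  have hk := hv.kop_iterate K n
  have h1 := integral_kop_iterate (K := K) hinv (hv.integrable μ) n
  unfold lagCov
  simp only [sub_mul, mul_sub]
  rw [integral_sub ((hu.mul hk).integrable μ) ((hk.const_mul _).integrable μ),
    integral_sub ((hu.mul hk).integrable μ) ((hu.integrable μ).mul_const _),
    integral_const_mul, integral_mul_const, h1]

lemma abs_lagCov_le (hinv : μ.bind (fun x => K x) = μ) (hu : BddMeas u C) (hv : BddMeas v D)
    (n : ℕ) : |lagCov K μ u v n| ≤ C * mixc K μ v n := by
  have hi := ((hv.kop_iterate K n).integrable μ).sub (integrable_const (∫ y, v y ∂μ))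
  rw [lagCov_eq hinv hu hv, mixc, ← integral_const_mul]
  refine abs_integral_le_integral_abs.trans (integral_mono_of_nonneg
    (ae_of_all _ fun _ => abs_nonneg _) (hi.abs.const_mul C) (ae_of_all _ fun x => ?_))
  simp only [abs_mul]
  exact mul_le_mul_of_nonneg_right (hu.bound x) (abs_nonneg _)

end invariant

section chain

variable {Ω : Type*} [mΩ : MeasurableSpace Ω]

/-- The `σ`-algebra generated by `X_0, …, X_n`. -/
abbrev past (X : ℕ → Ω → ℝ) (n : ℕ) : MeasurableSpace Ω :=
  MeasurableSpace.comap (fun ω => fun i : Fin (n + 1) => X i.1 ω) inferInstance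

lemma measurable_past (X : ℕ → Ω → ℝ) {i n : ℕ} (h : i ≤ n) : Measurable[past X n] (X i) := by
  have h1 : Measurable[past X n] (fun ω => fun i : Fin (n + 1) => X i.1 ω) :=
    comap_measurable _
  exact (measurable_pi_apply (⟨i, Nat.lt_succ_of_le h⟩ : Fin (n + 1))).comp h1

lemma past_mono (X : ℕ → Ω → ℝ) {m n : ℕ} (h : m ≤ n) : past X m ≤ past X n := by
  refine Measurable.comap_le (m₁ := past X n) ?_
  exact @measurable_pi_lambda _ _ _ (past X n) _ _ fun i => measurable_past X (by omega)

/-- `X` is a Markov chain with transition kernel `K` whose one-dimensional marginals are all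
equal to `μ`. -/
structure StatMarkov (P : Measure Ω) (X : ℕ → Ω → ℝ) (μ : Measure ℝ) (K : Kernel ℝ ℝ) : Prop where
  meas : ∀ i, Measurable (X i)
  law : ∀ i, Measure.map (X i) P = μ
  inv : μ.bind (fun x => K x) = μ
  markov : ∀ n : ℕ, ∀ g : ℝ → ℝ, Measurable g → (∃ C, ∀ x, |g x| ≤ C) →
      P[fun ω => g (X (n + 1) ω) | past X n] =ᵐ[P] fun ω => Kop K g (X n ω)

variable {P : Measure Ω} [IsProbabilityMeasure P] {X : ℕ → Ω → ℝ}
  {μ : Measure ℝ} [IsProbabilityMeasure μ] {K : Kernel ℝ ℝ} [IsMarkovKernel K]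
  {u v h : ℝ → ℝ} {C D : ℝ}

lemma integrable_of_bdd {F : Ω → ℝ} (hF : Measurable F) (hb : ∀ ω, |F ω| ≤ C) : Integrable F P :=
  Integrable.of_bound hF.aestronglyMeasurable C (ae_of_all _ hb)

lemma abs_mul_le_of_le {a b c d : ℝ} (h1 : |a| ≤ c) (h2 : |b| ≤ d) : |a * b| ≤ c * d := by
  rw [abs_mul]; exact mul_le_mul h1 h2 (abs_nonneg _) ((abs_nonneg _).trans h1)

namespace StatMarkov

lemma past_le (hX : StatMarkov P X μ K) (n : ℕ) : past X n ≤ mΩ :=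
  Measurable.comap_le (measurable_pi_lambda _ fun i => hX.meas i)

lemma integral_comp_eq (hX : StatMarkov P X μ K) (hu : AEStronglyMeasurable u μ) (i : ℕ) :
    ∫ ω, u (X i ω) ∂P = ∫ x, u x ∂μ := by
  have h := hX.law i
  rw [← h, integral_map (hX.meas i).aemeasurable (by rwa [h])]

lemma integrable_comp (hX : StatMarkov P X μ K) (hu : Integrable u μ) (i : ℕ) :
    Integrable (fun ω => u (X i ω)) P := by
  have h := hX.law i
  rw [← h] at hu
  exact hu.comp_measurable (hX.meas i)

lemma integral_mul_next (hX : StatMarkov P X μ K) {n : ℕ} {F : Ω → ℝ} (hF : Measurable[past X n] F)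
    (hb : ∀ ω, |F ω| ≤ C) (hu : BddMeas u D) :
    ∫ ω, F ω * u (X (n + 1) ω) ∂P = ∫ ω, F ω * Kop K u (X n ω) ∂P := by
  have hF' : Measurable F := hF.mono (hX.past_le n) le_rfl
  have hu' : Measurable fun ω => u (X (n + 1) ω) := hu.meas.comp (hX.meas _)
  have h1 := condExp_mul_of_stronglyMeasurable_left (μ := P) (m := past X n) (f := F)
    (g := fun ω => u (X (n + 1) ω)) hF.stronglyMeasurable
    (integrable_of_bdd (hF'.mul hu') fun ω => abs_mul_le_of_le (hb ω) (hu.bound _))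
    (integrable_of_bdd hu' fun ω => hu.bound _)
  have h2 := hX.markov n u hu.meas ⟨D, hu.bound⟩
  calc ∫ ω, F ω * u (X (n + 1) ω) ∂P
      = ∫ ω, (P[F * (fun ω => u (X (n + 1) ω)) | past X n]) ω ∂P :=
        (integral_condExp (hX.past_le n)).symm
    _ = _ := by
        refine integral_congr_ae ?_
        filter_upwards [h1, h2] with ω e1 e2
        rw [e1, Pi.mul_apply, e2]

lemma integral_mul_iterate (hX : StatMarkov P X μ K) {n : ℕ} {F : Ω → ℝ}
    (hF : Measurable[past X n] F) (hb : ∀ ω, |F ω| ≤ C) (hu : BddMeas u D) (k : ℕ) :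
    ∫ ω, F ω * u (X (n + k) ω) ∂P = ∫ ω, F ω * (Kop K)^[k] u (X n ω) ∂P := by
  induction k generalizing u with
  | zero => rfl
  | succ k ih =>
    rw [← add_assoc, hX.integral_mul_next (hF.mono (past_mono X (by omega)) le_rfl) hb hu,
      ih (hu.kop K), Function.iterate_succ_apply]

/-- Increments `h(X_{n+1}) - K h (X_n)` are orthogonal to bounded complex functions of the past. -/
lemma integral_mul_increment (hX : StatMarkov P X μ K) {n : ℕ} {F : Ω → ℂ}
    (hF : Measurable[past X n] F) (hb : ∀ ω, ‖F ω‖ ≤ C) (hh : BddMeas h D) :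
    ∫ ω, F ω * ((h (X (n + 1) ω) - Kop K h (X n ω) : ℝ) : ℂ) ∂P = 0 := by
  have hF' : Measurable F := hF.mono (hX.past_le n) le_rfl
  have hm : Measurable fun ω => h (X (n + 1) ω) - Kop K h (X n ω) :=
    (hh.meas.comp (hX.meas _)).sub ((hh.kop K).meas.comp (hX.meas _))
  have hI : Integrable (fun ω => F ω * ((h (X (n + 1) ω) - Kop K h (X n ω) : ℝ) : ℂ)) P := by
    refine Integrable.of_bound (hF'.mul (Complex.measurable_ofReal.comp hm)).aestronglyMeasurable
      (C * (D + D)) (ae_of_all _ fun ω => ?_)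
    rw [norm_mul, Complex.norm_real]
    refine mul_le_mul (hb ω) ?_ (norm_nonneg _) ((norm_nonneg _).trans (hb ω))
    exact (abs_sub _ _).trans (add_le_add (hh.bound _) ((hh.kop K).bound _))
  have key : ∀ G : Ω → ℝ, Measurable[past X n] G → (∀ ω, |G ω| ≤ C) →
      ∫ ω, G ω * (h (X (n + 1) ω) - Kop K h (X n ω)) ∂P = 0 := by
    intro G hG hGb
    have hG' : Measurable G := hG.mono (hX.past_le n) le_rfl
    simp only [mul_sub]
    rw [integral_sub, hX.integral_mul_next hG hGb hh, sub_self]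
    · exact integrable_of_bdd (hG'.mul (hh.meas.comp (hX.meas _)))
        fun ω => abs_mul_le_of_le (hGb ω) (hh.bound _)
    · exact integrable_of_bdd (hG'.mul ((hh.kop K).meas.comp (hX.meas _)))
        fun ω => abs_mul_le_of_le (hGb ω) ((hh.kop K).bound _)
  apply Complex.ext
  · have := integral_re hI
    simp only [RCLike.re_eq_complex_re, Complex.re_mul_ofReal] at this
    rw [Complex.zero_re, ← this]
    exact key _ (Complex.measurable_re.comp hF) fun ω => (Complex.abs_re_le_norm _).trans (hb ω)
  · have := integral_im hI
    simp only [RCLike.im_eq_complex_im, Complex.im_mul_ofReal] at this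
    rw [Complex.zero_im, ← this]
    exact key _ (Complex.measurable_im.comp hF) fun ω => (Complex.abs_im_le_norm _).trans (hb ω)

end StatMarkov

/-- A variance bound for sums in terms of a bound on the correlations at each lag. -/
lemma integral_sq_sum_le {Y : ℕ → Ω → ℝ} {c : ℕ → ℝ}
    (hI : ∀ i j, Integrable (fun ω => Y i ω * Y j ω) P)
    (hc : ∀ i k, |∫ ω, Y i ω * Y (i + k) ω ∂P| ≤ c k) (n : ℕ) :
    ∫ ω, (∑ i ∈ Finset.range n, Y i ω) ^ 2 ∂P ≤ 2 * n * ∑ k ∈ Finset.range n, c k := by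
  have hc0 : ∀ k, 0 ≤ c k := fun k => (abs_nonneg _).trans (hc 0 k)
  have hS : ∀ n, Integrable (fun ω => (∑ i ∈ Finset.range n, Y i ω) ^ 2) P := by
    intro n
    simp only [sq, Finset.sum_mul_sum]
    exact integrable_finsetSum _ fun i _ => integrable_finsetSum _ fun j _ => hI i j
  induction n with
  | zero => simp
  | succ n ih =>
    have e : ∀ ω, (∑ i ∈ Finset.range (n + 1), Y i ω) ^ 2 =
        (∑ i ∈ Finset.range n, Y i ω) ^ 2 +
          (2 * ∑ i ∈ Finset.range n, Y i ω * Y n ω + Y n ω * Y n ω) := by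
      intro ω; rw [Finset.sum_range_succ, ← Finset.sum_mul]; ring
    simp only [e]
    have hI1 : Integrable (fun ω => ∑ i ∈ Finset.range n, Y i ω * Y n ω) P :=
      integrable_finsetSum _ fun i _ => hI i n
    have hI2 : Integrable (fun ω => 2 * ∑ i ∈ Finset.range n, Y i ω * Y n ω + Y n ω * Y n ω) P :=
      (hI1.const_mul 2).add (hI n n)
    rw [integral_add (hS n) hI2, integral_add (hI1.const_mul 2) (hI n n), integral_const_mul,
      integral_finsetSum _ fun i _ => hI i n]
    have h1 : ∑ i ∈ Finset.range n, ∫ ω, Y i ω * Y n ω ∂P ≤ ∑ i ∈ Finset.range n, c (n - i) := by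
      refine Finset.sum_le_sum fun i hi => ?_
      have := hc i (n - i)
      rw [Nat.add_sub_cancel' (Finset.mem_range.mp hi).le] at this
      exact (le_abs_self _).trans this
    have h2 : ∫ ω, Y n ω * Y n ω ∂P ≤ c 0 := (le_abs_self _).trans (hc n 0)
    have h3 : ∑ i ∈ Finset.range n, c (n - i) + c 0 = ∑ k ∈ Finset.range (n + 1), c k := by
      rw [← Finset.sum_range_reflect c (n + 1), Finset.sum_range_succ]
      simp
    have h4 : ∑ k ∈ Finset.range n, c k ≤ ∑ k ∈ Finset.range (n + 1), c k := by
      rw [Finset.sum_range_succ]; linarith [hc0 n]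
    have h5 : (n : ℝ) * ∑ k ∈ Finset.range n, c k ≤ n * ∑ k ∈ Finset.range (n + 1), c k := by
      gcongr
    push_cast
    linarith [hc0 0]

lemma StatMarkov.integral_lag (hX : StatMarkov P X μ K) (hu : BddMeas u C) (i k : ℕ) :
    ∫ ω, (u (X i ω) - ∫ x, u x ∂μ) * (u (X (i + k) ω) - ∫ x, u x ∂μ) ∂P
      = lagCov K μ u u k := by
  have hu0 := hu.sub (BddMeas.const (∫ x, u x ∂μ))
  have h1 := hX.integral_mul_iterate (n := i) (F := fun ω => u (X i ω) - ∫ x, u x ∂μ)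
    (hu0.meas.comp (measurable_past X le_rfl)) (fun ω => hu0.bound _) hu0 k
  rw [h1, kop_iterate_sub K hu (BddMeas.const _), kop_iterate_const]
  have hk := hu.kop_iterate K k
  have hm := hu0.mul (hk.sub (BddMeas.const (∫ x, u x ∂μ)))
  rw [hX.integral_comp_eq hm.meas.aestronglyMeasurable i]
  simp only [mul_sub ((_ : ℝ) - _)]
  rw [integral_sub ((hu0.mul hk).integrable μ) ((hu0.integrable μ).mul_const _),
    integral_mul_const, integral_sub (hu.integrable μ) (integrable_const _)]
  simp [lagCov]

lemma StatMarkov.integral_sq_sum_centered_le (hX : StatMarkov P X μ K) (hu : BddMeas u C) (n : ℕ) :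
    ∫ ω, (∑ i ∈ Finset.range n, (u (X (i + 1) ω) - ∫ x, u x ∂μ)) ^ 2 ∂P
      ≤ 2 * n * ∑ k ∈ Finset.range n, |lagCov K μ u u k| := by
  have hu0 := hu.sub (BddMeas.const (∫ x, u x ∂μ))
  refine integral_sq_sum_le (Y := fun i ω => u (X (i + 1) ω) - ∫ x, u x ∂μ)
    (fun i j => ?_) (fun i k => ?_) n
  · exact integrable_of_bdd ((hu0.meas.comp (hX.meas _)).mul (hu0.meas.comp (hX.meas _)))
      fun ω => abs_mul_le_of_le (hu0.bound _) (hu0.bound _)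
  · have := hX.integral_lag hu (i + 1) k
    rw [show i + 1 + k = i + k + 1 by ring] at this
    rw [this]

end chain

section mixing

variable {μ : Measure ℝ} [IsProbabilityMeasure μ] {K : Kernel ℝ ℝ} [IsMarkovKernel K]
  {u v : ℝ → ℝ} {C D : ℝ}

lemma bddMeas_indicator {s : Set ℝ} (hs : MeasurableSet s) :
    BddMeas (s.indicator fun _ => (1 : ℝ)) 1 :=
  ⟨measurable_const.indicator hs, fun x => by
    by_cases h : x ∈ s <;> simp [h]⟩

lemma tendsto_mixc_of_approx (hinv : μ.bind (fun x => K x) = μ) (hu : BddMeas u C)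
    (h : ∀ ε > 0, ∃ v D, BddMeas v D ∧ Tendsto (mixc K μ v) atTop (𝓝 0) ∧
      ∫ x, |u x - v x| ∂μ ≤ ε) : Tendsto (mixc K μ u) atTop (𝓝 0) := by
  rw [Metric.tendsto_atTop]
  intro ε hε
  obtain ⟨v, D, hv, hv0, huv⟩ := h (ε / 4) (by positivity)
  obtain ⟨N, hN⟩ := Metric.tendsto_atTop.mp hv0 (ε / 4) (by positivity)
  refine ⟨N, fun n hn => ?_⟩
  have h1 := hN n hn
  rw [Real.dist_eq, sub_zero, abs_of_nonneg (mixc_nonneg _ _)] at h1 ⊢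
  linarith [mixc_le_add_two_mul (K := K) hinv hu hv n]

lemma tendsto_mixc_indicator (hinv : μ.bind (fun x => K x) = μ)
    (h : ∀ t, Tendsto (mixc K μ (indic t)) atTop (𝓝 0)) {s : Set ℝ} (hs : MeasurableSet s) :
    Tendsto (mixc K μ (s.indicator fun _ => (1 : ℝ))) atTop (𝓝 0) := by
  induction s, hs using MeasurableSpace.induction_on_inter (borel_eq_generateFrom_Iic ℝ ▸
    BorelSpace.measurable_eq) isPiSystem_Iic with
  | empty => simp only [indicator_empty]; simp [funext (mixc_const (K := K) (μ := μ) (0 : ℝ))]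
  | basic s hs => obtain ⟨t, rfl⟩ := hs; exact h t
  | compl s hs ih =>
    have e : sᶜ.indicator (fun _ => (1 : ℝ)) = fun x => 1 - s.indicator (fun _ => (1 : ℝ)) x := by
      funext x; by_cases hx : x ∈ s <;> simp [hx]
    rw [e]
    refine squeeze_zero (fun _ => mixc_nonneg _ _)
      (fun n => mixc_sub_le (BddMeas.const 1) (bddMeas_indicator hs) n) ?_
    simpa [mixc_const] using ih
  | iUnion f hd hf ih =>
    refine tendsto_mixc_of_approx hinv (bddMeas_indicator (MeasurableSet.iUnion hf)) ?_
    intro ε hε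
    have hb : ∀ n : ℕ, BddMeas (fun x => ∑ i ∈ Finset.range n, (f i).indicator (fun _ => (1 : ℝ)) x)
        (∑ i ∈ Finset.range n, 1) := fun n => BddMeas.sum _ fun i _ => bddMeas_indicator (hf i)
    have hle : ∀ n x, ∑ i ∈ Finset.range n, (f i).indicator (fun _ => (1 : ℝ)) x ≤
        (⋃ i, f i).indicator (fun _ => (1 : ℝ)) x := by
      intro n x
      rw [← Finset.indicator_biUnion_apply (Finset.range n) f (fun i _ j _ hij => hd hij)]
      exact indicator_le_indicator_of_subset (iUnion₂_subset fun i _ => subset_iUnion f i)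
        (fun _ => zero_le_one) x
    have hsum : Tendsto (fun n => ∑ i ∈ Finset.range n, μ.real (f i)) atTop
        (𝓝 (μ.real (⋃ i, f i))) := by
      have e := measure_iUnion (μ := μ) hd hf
      have := (ENNReal.hasSum_toReal (e ▸ measure_ne_top μ _)).tendsto_sum_nat
      rwa [← ENNReal.tsum_toReal_eq (fun i => measure_ne_top μ _), ← e] at this
    obtain ⟨n, hn⟩ := (hsum.eventually (lt_mem_nhds (sub_lt_self _ hε))).exists
    replace hn := (sub_lt_comm.mp hn).le
    refine ⟨_, _, hb n, ?_, ?_⟩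
    · refine squeeze_zero (fun _ => mixc_nonneg _ _)
        (fun n' => mixc_sum_le _ (fun i _ => bddMeas_indicator (hf i)) n') ?_
      simpa using tendsto_finsetSum (Finset.range n) fun i _ => ih i
    · simp only [abs_of_nonneg (sub_nonneg.mpr (hle n _))]
      rw [integral_sub ((bddMeas_indicator (MeasurableSet.iUnion hf)).integrable μ)
        ((hb n).integrable μ), integral_finsetSum _
        fun i _ => (bddMeas_indicator (hf i)).integrable μ]
      simpa [integral_indicator_const, MeasurableSet.iUnion hf, hf] using hn

/-- Mixing on half-lines implies mixing of all bounded measurable functions. -/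
lemma tendsto_mixc (hinv : μ.bind (fun x => K x) = μ)
    (h : ∀ t, Tendsto (mixc K μ (indic t)) atTop (𝓝 0)) (hu : BddMeas u C) :
    Tendsto (mixc K μ u) atTop (𝓝 0) := by
  refine tendsto_mixc_of_approx hinv hu fun ε hε => ?_
  obtain ⟨N, hN⟩ := exists_nat_ge (C / ε + 1)
  let A : ℤ → Set ℝ := fun j => {x | ⌊u x / ε⌋ = j}
  have hA : ∀ j, MeasurableSet (A j) := fun j =>
    (hu.meas.div_const ε).floor (measurableSet_singleton j)
  have hb : ∀ j ∈ Finset.Icc (-(N : ℤ)) N, BddMeas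
      (fun x => ((j : ℝ) * ε) * (A j).indicator (fun _ => (1 : ℝ)) x) (|(j : ℝ) * ε| * 1) :=
    fun j _ => (bddMeas_indicator (hA j)).const_mul _
  refine ⟨_, _, BddMeas.sum (Finset.Icc (-(N : ℤ)) N) hb, ?_, ?_⟩
  · refine squeeze_zero (fun _ => mixc_nonneg _ _) (fun n => mixc_sum_le _ hb n) ?_
    simp only [mixc_const_mul]
    simpa using tendsto_finsetSum (Finset.Icc (-(N : ℤ)) N) fun j _ =>
      (tendsto_mixc_indicator hinv h (hA j)).const_mul |(j : ℝ) * ε|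
  · have hx : ∀ x, |u x - ∑ j ∈ Finset.Icc (-(N : ℤ)) N,
        ((j : ℝ) * ε) * (A j).indicator (fun _ => (1 : ℝ)) x| ≤ ε := by
      intro x
      have h1 := Int.floor_le (u x / ε)
      have h2 := Int.lt_floor_add_one (u x / ε)
      have h3 := abs_le.mp (hu.bound x)
      have h4 : u x / ε ≤ C / ε := by gcongr; exact h3.2
      have h5 : -(C / ε) ≤ u x / ε := by rw [← neg_div]; gcongr; exact h3.1
      have hmem : ⌊u x / ε⌋ ∈ Finset.Icc (-(N : ℤ)) N := by
        rw [Finset.mem_Icc]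
        constructor
        · rw [Int.le_floor]; push_cast; linarith
        · have : (⌊u x / ε⌋ : ℝ) ≤ ((N : ℤ) : ℝ) := by push_cast; linarith
          exact_mod_cast this
      rw [Finset.sum_eq_single_of_mem _ hmem]
      · have e : u x = (u x / ε) * ε := by field_simp
        rw [indicator_of_mem (show x ∈ A ⌊u x / ε⌋ from rfl), mul_one]
        nth_rw 1 [e]
        rw [← sub_mul, abs_mul, abs_of_nonneg (sub_nonneg.mpr h1), abs_of_pos hε]
        nlinarith
      · intro j _ hj
        rw [indicator_of_notMem (fun hx : x ∈ A j => hj hx.symm), mul_zero]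
    calc _ ≤ ∫ x, ε ∂μ := integral_mono
          ((hu.sub (BddMeas.sum _ hb)).integrable μ).abs (integrable_const _) hx
      _ = ε := by simp

end mixing

section analysis

lemma norm_one_add_mul_I_mul_exp_le (x : ℝ) :
    ‖(1 + x * Complex.I) * Real.exp (-(x ^ 2 / 2))‖ ≤ 1 := by
  have h1 : ‖(1 + x * Complex.I : ℂ)‖ ≤ Real.exp (x ^ 2 / 2) := by
    rw [← Complex.ofReal_one, Complex.norm_add_mul_I, Real.sqrt_le_left (Real.exp_pos _).le,
      ← Real.exp_nat_mul]
    have := Real.add_one_le_exp (x ^ 2)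
    norm_num
    ring_nf at this ⊢
    linarith
  rw [norm_mul, Complex.norm_real, Real.norm_of_nonneg (Real.exp_pos _).le]
  calc _ ≤ Real.exp (x ^ 2 / 2) * Real.exp (-(x ^ 2 / 2)) := by gcongr
    _ = 1 := by rw [← Real.exp_add]; simp

lemma norm_exp_sub_le {x : ℝ} (hx : |x| ≤ 1) :
    ‖Complex.exp (x * Complex.I) - (1 + x * Complex.I) * Real.exp (-(x ^ 2 / 2))‖
      ≤ 2 * |x| ^ 3 := by
  have h1 := Complex.exp_bound (x := x * Complex.I) (by simpa using hx) (n := 3) (by norm_num)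
  have h2 := Real.abs_exp_sub_one_sub_id_le (x := -(x ^ 2 / 2)) (by
    rw [abs_neg, abs_of_nonneg (by positivity)]; nlinarith [abs_le.mp hx])
  set r := Real.exp (-(x ^ 2 / 2)) - 1 - -(x ^ 2 / 2) with hr
  have e : Real.exp (-(x ^ 2 / 2)) = 1 - x ^ 2 / 2 + r := by rw [hr]; ring
  have e2 : Complex.exp (x * Complex.I) - (1 + x * Complex.I) * Real.exp (-(x ^ 2 / 2)) =
      (Complex.exp (x * Complex.I) - ∑ m ∈ Finset.range 3, (x * Complex.I) ^ m / (m.factorial : ℂ))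
      + (x ^ 3 / 2 : ℝ) * Complex.I - (1 + x * Complex.I) * (r : ℝ) := by
    rw [e]
    simp only [Finset.sum_range_succ, Finset.sum_range_zero]
    push_cast
    norm_num [Nat.factorial, mul_pow]
    ring
  rw [e2]
  have h3 : ‖(1 + x * Complex.I : ℂ)‖ ≤ 2 := by
    refine (norm_add_le _ _).trans ?_
    simp only [norm_one, norm_mul, Complex.norm_real, Complex.norm_I, mul_one, Real.norm_eq_abs]
    linarith
  have h4 : |r| ≤ |x| ^ 3 / 4 := by
    refine h2.trans ?_
    rw [neg_sq, div_pow, ← pow_mul, ← Even.pow_abs (by decide : Even (2 * 2))]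
    have : |x| ^ (2 * 2) ≤ |x| ^ 3 := pow_le_pow_of_le_one (abs_nonneg _) hx (by norm_num)
    have h2 : (2 : ℝ) ^ 2 = 4 := by norm_num
    rw [h2]
    exact div_le_div_of_nonneg_right this (by norm_num)
  have h5 : ‖(x * Complex.I : ℂ)‖ = |x| := by simp
  rw [h5] at h1
  have h6 : ‖((x ^ 3 / 2 : ℝ) : ℂ) * Complex.I‖ = |x| ^ 3 / 2 := by
    simp [Complex.norm_real]
  refine (norm_sub_le _ _).trans ((add_le_add (norm_add_le _ _) le_rfl).trans ?_)
  rw [h6, norm_mul, Complex.norm_real, Real.norm_eq_abs]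
  have h7 : ‖(1 + x * Complex.I : ℂ)‖ * |r| ≤ 2 * (|x| ^ 3 / 4) := by gcongr
  norm_num [Nat.factorial] at h1
  have h8 : 0 ≤ |x| ^ 3 := by positivity
  linarith

lemma norm_prod_sub_prod_le_sum (a b : ℕ → ℂ) (n : ℕ) (ha : ∀ i, ‖a i‖ ≤ 1) (hb : ∀ i, ‖b i‖ ≤ 1) :
    ‖∏ i ∈ Finset.range n, a i - ∏ i ∈ Finset.range n, b i‖
      ≤ ∑ i ∈ Finset.range n, ‖a i - b i‖ := by
  induction n with
  | zero => simp
  | succ n ih =>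
    rw [Finset.prod_range_succ, Finset.prod_range_succ, Finset.sum_range_succ]
    have e : (∏ i ∈ Finset.range n, a i) * a n - (∏ i ∈ Finset.range n, b i) * b n =
      (∏ i ∈ Finset.range n, a i - ∏ i ∈ Finset.range n, b i) * a n
        + (∏ i ∈ Finset.range n, b i) * (a n - b n) := by ring
    rw [e]
    refine (norm_add_le _ _).trans (add_le_add ?_ ?_)
    · rw [norm_mul]
      exact (mul_le_of_le_one_right (norm_nonneg _) (ha n)).trans ih
    · rw [norm_mul]
      refine mul_le_of_le_one_left (norm_nonneg _) ?_
      rw [norm_prod]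
      exact Finset.prod_le_one (fun _ _ => norm_nonneg _) fun i _ => hb i

lemma abs_exp_neg_sub_exp_neg_le {a b : ℝ} (ha : 0 ≤ a) (hb : 0 ≤ b) :
    |Real.exp (-a) - Real.exp (-b)| ≤ |a - b| := by
  wlog hab : a ≤ b generalizing a b
  · rw [abs_sub_comm, abs_sub_comm a]; exact this hb ha (le_of_not_ge hab)
  have h1 : Real.exp (-b) ≤ Real.exp (-a) := Real.exp_le_exp.mpr (by linarith)
  rw [abs_of_nonneg (by linarith), abs_of_nonpos (by linarith)]
  have h2 := Real.add_one_le_exp (-(b - a))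
  have h3 : Real.exp (-a) ≤ 1 := Real.exp_le_one_iff.mpr (by linarith)
  have h4 : Real.exp (-b) = Real.exp (-a) * Real.exp (-(b - a)) := by
    rw [← Real.exp_add]; ring_nf
  rw [h4]
  nlinarith [Real.exp_pos (-a)]

lemma integral_abs_le_sqrt {Ω : Type*} [MeasurableSpace Ω] {P : Measure Ω} [IsProbabilityMeasure P]
    {Z : Ω → ℝ} (hZ : MemLp Z 2 P) : ∫ ω, |Z ω| ∂P ≤ √(∫ ω, Z ω ^ 2 ∂P) := by
  apply Real.le_sqrt_of_sq_le
  have h1 := variance_nonneg (fun ω => |Z ω|) P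
  have hZ' : MemLp (fun ω => |Z ω|) 2 P := hZ.norm
  rw [variance_eq_sub hZ'] at h1
  simp only [Pi.pow_apply, sq_abs] at h1
  linarith

end analysis

section martingale

variable {Ω : Type*} [mΩ : MeasurableSpace Ω]
  {P : Measure Ω} [IsProbabilityMeasure P] {X : ℕ → Ω → ℝ}
  {μ : Measure ℝ} [IsProbabilityMeasure μ] {K : Kernel ℝ ℝ} [IsMarkovKernel K]
  {h : ℝ → ℝ} {H : ℝ}

/-- The martingale increment `h(X_{i+1}) - K h (X_i)`. -/
def mdiff (K : Kernel ℝ ℝ) (X : ℕ → Ω → ℝ) (h : ℝ → ℝ) (i : ℕ) (ω : Ω) : ℝ :=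
  h (X (i + 1) ω) - Kop K h (X i ω)

/-- The variance of the martingale increments. -/
def mvar (K : Kernel ℝ ℝ) (μ : Measure ℝ) (h : ℝ → ℝ) : ℝ :=
  ∫ x, (h x ^ 2 - Kop K h x ^ 2) ∂μ

lemma abs_mdiff_le (hh : BddMeas h H) (i : ℕ) (ω : Ω) : |mdiff K X h i ω| ≤ 2 * H := by
  have := (abs_sub (h (X (i + 1) ω)) (Kop K h (X i ω))).trans
    (add_le_add (hh.bound _) ((hh.kop K).bound _))
  unfold mdiff; linarith

lemma measurable_mdiff_past (hh : BddMeas h H) {i n : ℕ} (hi : i + 1 ≤ n) :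
    Measurable[past X n] (mdiff K X h i) :=
  (hh.meas.comp (measurable_past X hi)).sub
    ((hh.kop K).meas.comp (measurable_past X (Nat.le_of_succ_le hi)))

namespace StatMarkov

lemma measurable_mdiff (hX : StatMarkov P X μ K) (hh : BddMeas h H) (i : ℕ) :
    Measurable (mdiff K X h i) :=
  (measurable_mdiff_past hh le_rfl).mono (hX.past_le _) le_rfl

lemma bddMeas_condVar (K : Kernel ℝ ℝ) [IsMarkovKernel K] (hh : BddMeas h H) :
    BddMeas (fun x => Kop K (fun y => h y * h y) x - Kop K h x * Kop K h x) (H * H + H * H) :=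
  ((hh.mul hh).kop K).sub ((hh.kop K).mul (hh.kop K))

lemma mvar_eq (hinv : μ.bind (fun x => K x) = μ) (hh : BddMeas h H) :
    mvar K μ h = ∫ x, (Kop K (fun y => h y * h y) x - Kop K h x * Kop K h x) ∂μ := by
  unfold mvar
  simp only [sq]
  rw [integral_sub ((hh.mul hh).integrable μ) (((hh.kop K).mul (hh.kop K)).integrable μ),
    integral_sub (((hh.mul hh).kop K).integrable μ) (((hh.kop K).mul (hh.kop K)).integrable μ),
    integral_kop hinv ((hh.mul hh).integrable μ)]

/-- Conditional second moment of the increments. -/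
lemma integral_mul_sq_mdiff (hX : StatMarkov P X μ K) (hh : BddMeas h H) {n : ℕ} {F : Ω → ℝ} {C : ℝ}
    (hF : Measurable[past X n] F) (hb : ∀ ω, |F ω| ≤ C) :
    ∫ ω, F ω * mdiff K X h n ω ^ 2 ∂P =
      ∫ ω, F ω * (Kop K (fun y => h y * h y) (X n ω) - Kop K h (X n ω) * Kop K h (X n ω)) ∂P := by
  have hk := hh.kop K
  have hF' : Measurable F := hF.mono (hX.past_le n) le_rfl
  have m1 : Measurable fun ω => h (X (n + 1) ω) := hh.meas.comp (hX.meas _)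
  have m2 : Measurable[past X n] fun ω => Kop K h (X n ω) := hk.meas.comp (measurable_past X le_rfl)
  have m2' : Measurable fun ω => Kop K h (X n ω) := hk.meas.comp (hX.meas _)
  have m3 : Measurable fun ω => Kop K (fun y => h y * h y) (X n ω) :=
    ((hh.mul hh).kop K).meas.comp (hX.meas _)
  have i1 : Integrable (fun ω => F ω * (h (X (n + 1) ω) * h (X (n + 1) ω))) P :=
    integrable_of_bdd (hF'.mul (m1.mul m1)) fun ω => abs_mul_le_of_le (hb ω) ((hh.mul hh).bound _)
  have i2 : Integrable (fun ω => F ω * Kop K h (X n ω) * h (X (n + 1) ω)) P :=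
    integrable_of_bdd ((hF'.mul m2').mul m1)
      fun ω => abs_mul_le_of_le (abs_mul_le_of_le (hb ω) (hk.bound _)) (hh.bound _)
  have i3 : Integrable (fun ω => F ω * Kop K h (X n ω) * Kop K h (X n ω)) P :=
    integrable_of_bdd ((hF'.mul m2').mul m2')
      fun ω => abs_mul_le_of_le (abs_mul_le_of_le (hb ω) (hk.bound _)) (hk.bound _)
  have i4 : Integrable (fun ω => F ω * Kop K (fun y => h y * h y) (X n ω)) P :=
    integrable_of_bdd (hF'.mul m3) fun ω => abs_mul_le_of_le (hb ω) (((hh.mul hh).kop K).bound _)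
  have e1 := hX.integral_mul_next hF hb (hh.mul hh)
  have e2 := hX.integral_mul_next (n := n) (F := fun ω => F ω * Kop K h (X n ω)) (hF.mul m2)
    (fun ω => abs_mul_le_of_le (hb ω) (hk.bound _)) hh
  have l : ∀ ω, F ω * mdiff K X h n ω ^ 2 = F ω * (h (X (n + 1) ω) * h (X (n + 1) ω)) -
      2 * (F ω * Kop K h (X n ω) * h (X (n + 1) ω)) + F ω * Kop K h (X n ω) * Kop K h (X n ω) := by
    intro ω; unfold mdiff; ring
  have r : ∀ ω, F ω * (Kop K (fun y => h y * h y) (X n ω) - Kop K h (X n ω) * Kop K h (X n ω)) =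
      F ω * Kop K (fun y => h y * h y) (X n ω) - F ω * Kop K h (X n ω) * Kop K h (X n ω) := by
    intro ω; ring
  simp only [l, r]
  have i2' := i2.const_mul 2
  have i12 : Integrable (fun ω => F ω * (h (X (n + 1) ω) * h (X (n + 1) ω)) -
      2 * (F ω * Kop K h (X n ω) * h (X (n + 1) ω))) P := i1.sub i2'
  rw [integral_add i12 i3, integral_sub i1 i2', integral_const_mul, integral_sub i4 i3, e1, e2]
  ring

lemma integral_sq_mdiff (hX : StatMarkov P X μ K) (hh : BddMeas h H) (n : ℕ) :
    ∫ ω, mdiff K X h n ω ^ 2 ∂P = mvar K μ h := by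
  have := hX.integral_mul_sq_mdiff hh (n := n) (F := fun _ => 1) (C := 1) measurable_const (by simp)
  simp only [one_mul] at this
  rw [this, mvar_eq hX.inv hh]
  exact hX.integral_comp_eq (bddMeas_condVar K hh).meas.aestronglyMeasurable n

lemma mvar_nonneg (hX : StatMarkov P X μ K) (hh : BddMeas h H) : 0 ≤ mvar K μ h := by
  rw [← hX.integral_sq_mdiff hh 0]; exact integral_nonneg fun _ => sq_nonneg _

lemma abs_sq_mdiff_sub_le (hX : StatMarkov P X μ K) (hh : BddMeas h H) (i : ℕ) (ω : Ω) :
    |mdiff K X h i ω ^ 2 - mvar K μ h| ≤ (2 * H) ^ 2 := by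
  have h1 : ∀ j ω, mdiff K X h j ω ^ 2 ≤ (2 * H) ^ 2 := fun j ω =>
    sq_le_sq' (abs_le.mp (abs_mdiff_le hh j ω)).1 (abs_le.mp (abs_mdiff_le hh j ω)).2
  have h2 : mvar K μ h ≤ (2 * H) ^ 2 := by
    rw [← hX.integral_sq_mdiff hh 0]
    calc _ ≤ ∫ ω, (2 * H) ^ 2 ∂P := integral_mono_of_nonneg (ae_of_all _ fun _ => sq_nonneg _)
          (integrable_const _) (ae_of_all _ fun ω => h1 0 ω)
      _ = _ := by simp
  rw [abs_le]
  constructor <;> linarith [h1 i ω, sq_nonneg (mdiff K X h i ω), hX.mvar_nonneg hh]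

lemma abs_integral_sq_mdiff_mul_le (hX : StatMarkov P X μ K) (hh : BddMeas h H) (i k : ℕ) :
    |∫ ω, (mdiff K X h i ω ^ 2 - mvar K μ h) * (mdiff K X h (i + (k + 1)) ω ^ 2 - mvar K μ h) ∂P| ≤
      (2 * H) ^ 2 * mixc K μ
        (fun x => Kop K (fun y => h y * h y) x - Kop K h x * Kop K h x) k := by
  set v := fun x => Kop K (fun y => h y * h y) x - Kop K h x * Kop K h x with hv
  have hvb : BddMeas v _ := bddMeas_condVar K hh
  set F : Ω → ℝ := fun ω => mdiff K X h i ω ^ 2 - mvar K μ h with hFdef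
  have hF : Measurable[past X (i + 1)] F :=
    ((measurable_mdiff_past hh le_rfl).pow_const 2).sub_const _
  have hF' : Measurable F := hF.mono (hX.past_le _) le_rfl
  have hb : ∀ ω, |F ω| ≤ (2 * H) ^ 2 := hX.abs_sq_mdiff_sub_le hh i
  have hF2 : Measurable[past X (i + (k + 1))] F := hF.mono (past_mono X (by omega)) le_rfl
  have e0 := hX.integral_mul_sq_mdiff hh hF2 hb
  have m := hX.measurable_mdiff hh (i + (k + 1))
  have e1 : ∫ ω, F ω * (mdiff K X h (i + (k + 1)) ω ^ 2 - mvar K μ h) ∂P =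
      ∫ ω, F ω * (v (X (i + 1 + k) ω) - mvar K μ h) ∂P := by
    simp only [mul_sub (F _)]
    rw [integral_sub, integral_sub, e0, show i + (k + 1) = i + 1 + k by ring]
    · exact integrable_of_bdd (hF'.mul (hvb.meas.comp (hX.meas _)))
        fun ω => abs_mul_le_of_le (hb ω) (hvb.bound _)
    · exact (integrable_of_bdd hF' hb).mul_const _
    · refine integrable_of_bdd (C := (2 * H) ^ 2 * (2 * H) ^ 2) (hF'.mul (m.pow_const 2))
        fun ω => abs_mul_le_of_le (hb ω) ?_
      rw [abs_pow]
      exact pow_le_pow_left₀ (abs_nonneg _) (abs_mdiff_le hh _ _) 2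
    · exact (integrable_of_bdd hF' hb).mul_const _
  have hc := BddMeas.const (mvar K μ h)
  have e2 := hX.integral_mul_iterate hF hb (hvb.sub hc) k
  rw [e1, e2, kop_iterate_sub K hvb hc, kop_iterate_const, mixc, ← integral_const_mul,
    ← mvar_eq hX.inv hh]
  have hd := (hvb.kop_iterate K k).sub hc
  have hI := hX.integrable_comp ((hd.integrable μ).abs.const_mul ((2 * H) ^ 2)) (i + 1)
  rw [← hX.integral_comp_eq ((hd.integrable μ).abs.const_mul _).1 (i + 1)]
  refine abs_integral_le_integral_abs.trans (integral_mono_of_nonneg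
    (ae_of_all _ fun _ => abs_nonneg _) hI (ae_of_all _ fun ω => ?_))
  dsimp only
  rw [abs_mul]
  exact mul_le_mul_of_nonneg_right (hb ω) (abs_nonneg _)

/-- Law of large numbers for the squares of the increments. -/
lemma tendsto_average_sq_mdiff (hX : StatMarkov P X μ K)
    (hmix : ∀ u C, BddMeas u C → Tendsto (mixc K μ u) atTop (𝓝 0)) (hh : BddMeas h H) :
    Tendsto (fun n : ℕ => ∫ ω, |(n : ℝ)⁻¹ * ∑ i ∈ Finset.range n, mdiff K X h i ω ^ 2
      - mvar K μ h| ∂P) atTop (𝓝 0) := by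
  set v := fun x => Kop K (fun y => h y * h y) x - Kop K h x * Kop K h x with hv
  set B := (2 * H) ^ 2
  let c : ℕ → ℝ := fun k => Nat.casesOn k (B * B) fun k => B * mixc K μ v k
  have hc0 : Tendsto c atTop (𝓝 0) := by
    rw [← tendsto_add_atTop_iff_nat 1]
    simpa [c] using (hmix v _ (bddMeas_condVar K hh)).const_mul B
  have hces := hc0.cesaro
  let Y : ℕ → Ω → ℝ := fun i ω => mdiff K X h i ω ^ 2 - mvar K μ h
  have hYm : ∀ i, Measurable (Y i) := fun i => ((hX.measurable_mdiff hh i).pow_const 2).sub_const _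
  have hYb : ∀ i ω, |Y i ω| ≤ B := fun i ω => hX.abs_sq_mdiff_sub_le hh i ω
  have hYI : ∀ i j, Integrable (fun ω => Y i ω * Y j ω) P := fun i j =>
    integrable_of_bdd ((hYm i).mul (hYm j)) fun ω => abs_mul_le_of_le (hYb i ω) (hYb j ω)
  have hcov : ∀ i k, |∫ ω, Y i ω * Y (i + k) ω ∂P| ≤ c k := by
    intro i k
    cases k with
    | zero =>
      have := norm_integral_le_of_norm_le_const (μ := P) (f := fun ω => Y i ω * Y i ω)
        (C := B * B) (ae_of_all _ fun ω => abs_mul_le_of_le (hYb i ω) (hYb i ω))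
      simpa [c] using this
    | succ k => exact hX.abs_integral_sq_mdiff_mul_le hh i k
  have hvar := integral_sq_sum_le hYI hcov
  have hlim : Tendsto (fun n : ℕ => √(2 * ((n : ℝ)⁻¹ * ∑ k ∈ Finset.range n, c k))) atTop
      (𝓝 0) := by
    have := (hces.const_mul 2).sqrt
    simpa using this
  refine squeeze_zero' (Eventually.of_forall fun n => integral_nonneg fun _ => abs_nonneg _) ?_ hlim
  filter_upwards [eventually_gt_atTop 0] with n hn
  have hn' : (0 : ℝ) < n := Nat.cast_pos.mpr hn
  have e : ∀ ω, (n : ℝ)⁻¹ * ∑ i ∈ Finset.range n, mdiff K X h i ω ^ 2 - mvar K μ h =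
      (n : ℝ)⁻¹ * ∑ i ∈ Finset.range n, Y i ω := by
    intro ω
    simp only [Y, Finset.sum_sub_distrib, Finset.sum_const, Finset.card_range, nsmul_eq_mul]
    field_simp
  simp only [e]
  have hm : Measurable fun ω => (n : ℝ)⁻¹ * ∑ i ∈ Finset.range n, Y i ω :=
    (Finset.measurable_sum _ fun i _ => hYm i).const_mul _
  have hmem : MemLp (fun ω => (n : ℝ)⁻¹ * ∑ i ∈ Finset.range n, Y i ω) 2 P := by
    refine MemLp.of_bound hm.aestronglyMeasurable ((n : ℝ)⁻¹ * (n * B)) (ae_of_all _ fun ω => ?_)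
    rw [Real.norm_eq_abs, abs_mul, abs_of_nonneg (by positivity : 0 ≤ (n : ℝ)⁻¹)]
    gcongr
    refine (Finset.abs_sum_le_sum_abs _ _).trans ?_
    simpa using Finset.sum_le_card_nsmul (Finset.range n) _ B fun i _ => hYb i ω
  refine (integral_abs_le_sqrt hmem).trans (Real.sqrt_le_sqrt ?_)
  simp only [mul_pow]
  rw [integral_const_mul]
  calc _ ≤ ((n : ℝ)⁻¹) ^ 2 * (2 * n * ∑ k ∈ Finset.range n, c k) := by
        gcongr; exact hvar n
    _ = _ := by field_simp

end StatMarkov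
end martingale

lemma norm_one_add_mul_I_le (x : ℝ) : ‖(1 + x * Complex.I : ℂ)‖ ≤ Real.exp (x ^ 2 / 2) := by
  have h := norm_one_add_mul_I_mul_exp_le x
  rw [norm_mul, Complex.norm_real, Real.norm_of_nonneg (Real.exp_pos _).le, Real.exp_neg,
    ← div_eq_mul_inv, div_le_one (Real.exp_pos _)] at h
  exact h

section martingaleCLT

variable {Ω : Type*} [mΩ : MeasurableSpace Ω]
  {P : Measure Ω} [IsProbabilityMeasure P] {X : ℕ → Ω → ℝ}
  {μ : Measure ℝ} [IsProbabilityMeasure μ] {K : Kernel ℝ ℝ} [IsMarkovKernel K]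
  {h : ℝ → ℝ} {H : ℝ}

/-- The product `∏ (1 + i s D_j)` over the first `n` martingale increments `D_j`. -/
def mprod (K : Kernel ℝ ℝ) (X : ℕ → Ω → ℝ) (h : ℝ → ℝ) (s : ℝ) (n : ℕ) (ω : Ω) : ℂ :=
  ∏ i ∈ Finset.range n, (1 + ((s * mdiff K X h i ω : ℝ) : ℂ) * Complex.I)

lemma sq_mul_mdiff_le (hh : BddMeas h H) (s : ℝ) (i : ℕ) (ω : Ω) :
    (s * mdiff K X h i ω) ^ 2 ≤ s ^ 2 * (2 * H) ^ 2 := by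
  rw [mul_pow]
  have hb := abs_le.mp (abs_mdiff_le (K := K) (X := X) hh i ω)
  exact mul_le_mul_of_nonneg_left (sq_le_sq' hb.1 hb.2) (sq_nonneg s)

lemma norm_mprod_le (hh : BddMeas h H) (s : ℝ) (n : ℕ) (ω : Ω) :
    ‖mprod K X h s n ω‖ ≤ Real.exp (n * (s ^ 2 * (2 * H) ^ 2 / 2)) := by
  rw [mprod, norm_prod, Real.exp_nat_mul]
  calc _ ≤ ∏ i ∈ Finset.range n, Real.exp (s ^ 2 * (2 * H) ^ 2 / 2) := by
        refine Finset.prod_le_prod (fun _ _ => norm_nonneg _) fun i _ => ?_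
        refine (norm_one_add_mul_I_le _).trans (Real.exp_le_exp.mpr ?_)
        gcongr
        exact sq_mul_mdiff_le hh s i ω
    _ = _ := by simp

lemma measurable_mprod_past (hh : BddMeas h H) (s : ℝ) (n : ℕ) :
    Measurable[past X n] (mprod K X h s n) := by
  refine Finset.measurable_prod (Finset.range n) fun i hi => ?_
  exact ((Complex.measurable_ofReal.comp ((measurable_mdiff_past hh
    (Finset.mem_range.mp hi)).const_mul s)).mul_const _).const_add _

namespace StatMarkov

lemma measurable_mprod (hX : StatMarkov P X μ K) (hh : BddMeas h H) (s : ℝ) (n : ℕ) :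
    Measurable (mprod K X h s n) := (measurable_mprod_past hh s n).mono (hX.past_le n) le_rfl

lemma integrable_mprod (hX : StatMarkov P X μ K) (hh : BddMeas h H) (s : ℝ) (n : ℕ) :
    Integrable (mprod K X h s n) P :=
  Integrable.of_bound (hX.measurable_mprod hh s n).aestronglyMeasurable _
    (ae_of_all _ (norm_mprod_le hh s n))

lemma integral_mprod (hX : StatMarkov P X μ K) (hh : BddMeas h H) (s : ℝ) (n : ℕ) :
    ∫ ω, mprod K X h s n ω ∂P = 1 := by
  induction n with
  | zero => simp [mprod]
  | succ n ih =>
    have e : ∀ ω, mprod K X h s (n + 1) ω = mprod K X h s n ω +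
        (s * Complex.I) * (mprod K X h s n ω * ((mdiff K X h n ω : ℝ) : ℂ)) := by
      intro ω
      rw [mprod, Finset.prod_range_succ, ← mprod]
      push_cast
      ring
    have h0 := hX.integral_mul_increment (measurable_mprod_past (K := K) hh s n)
      (norm_mprod_le hh s n) hh
    have hI : Integrable (fun ω => mprod K X h s n ω * ((mdiff K X h n ω : ℝ) : ℂ)) P := by
      refine (hX.integrable_mprod hh s n).mul_bdd (c := 2 * H)
        (Complex.measurable_ofReal.comp (hX.measurable_mdiff hh n)).aestronglyMeasurable
        (ae_of_all _ fun ω => ?_)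
      simpa using abs_mdiff_le hh n ω
    simp only [e]
    rw [integral_add (hX.integrable_mprod hh s n) (hI.const_mul _), integral_const_mul, ih]
    unfold mdiff
    rw [h0]
    simp

/-- Quantitative form of the martingale central limit theorem. -/
lemma norm_charFun_mdiff_sub_le (hX : StatMarkov P X μ K) (hh : BddMeas h H) (t : ℝ) {n : ℕ}
    (hn : 0 < n) (hs : |t * (√n)⁻¹| * (2 * H) ≤ 1) :
    ‖∫ ω, Complex.exp (((t * (√n)⁻¹ * ∑ i ∈ Finset.range n, mdiff K X h i ω : ℝ) : ℂ) *
        Complex.I) ∂P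
      - (Real.exp (-(t ^ 2 / 2 * mvar K μ h)) : ℝ)‖ ≤
    2 * (|t| * (2 * H)) ^ 3 * (√n)⁻¹ + Real.exp (t ^ 2 * (2 * H) ^ 2 / 2) * (t ^ 2 / 2) *
      ∫ ω, |(n : ℝ)⁻¹ * ∑ i ∈ Finset.range n, mdiff K X h i ω ^ 2 - mvar K μ h| ∂P := by
  have hn' : (0 : ℝ) < n := Nat.cast_pos.mpr hn
  have hsn : √(n : ℝ) ^ 2 = n := Real.sq_sqrt hn'.le
  have hsp : 0 < √(n : ℝ) := Real.sqrt_pos.mpr hn'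
  set s := t * (√n)⁻¹ with hsdef
  have hs2 : s ^ 2 = t ^ 2 * (n : ℝ)⁻¹ := by rw [hsdef, mul_pow, inv_pow, hsn]
  set V : Ω → ℝ := fun ω => (n : ℝ)⁻¹ * ∑ i ∈ Finset.range n, mdiff K X h i ω ^ 2 with hV
  set v := mvar K μ h with hv
  have hv0 : 0 ≤ v := hX.mvar_nonneg hh
  have hV0 : ∀ ω, 0 ≤ V ω := fun ω =>
    mul_nonneg (by positivity) (Finset.sum_nonneg fun _ _ => sq_nonneg _)
  have hVm : Measurable V := (Finset.measurable_sum _ fun i _ =>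
    (hX.measurable_mdiff hh i).pow_const 2).const_mul _
  have hVI : Integrable (fun ω => |V ω - v|) P := by
    refine Integrable.abs (Integrable.sub ?_ (integrable_const _))
    refine (integrable_finsetSum _ fun i _ => ?_).const_mul _
    exact integrable_of_bdd (C := (2 * H) ^ 2) ((hX.measurable_mdiff hh i).pow_const 2) fun ω => by
      rw [abs_pow]; exact pow_le_pow_left₀ (abs_nonneg _) (abs_mdiff_le hh _ _) 2
  let a : Ω → ℕ → ℂ := fun ω i => Complex.exp ((s * mdiff K X h i ω : ℝ) * Complex.I)
  let b : Ω → ℕ → ℂ := fun ω i => (1 + ((s * mdiff K X h i ω : ℝ) : ℂ) * Complex.I) *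
    Real.exp (-((s * mdiff K X h i ω) ^ 2 / 2))
  have hprod_a : ∀ ω, Complex.exp (((s * ∑ i ∈ Finset.range n, mdiff K X h i ω : ℝ) : ℂ) *
      Complex.I) = ∏ i ∈ Finset.range n, a ω i := by
    intro ω
    rw [← Complex.exp_sum, ← Finset.sum_mul, Finset.mul_sum]
    push_cast
    rfl
  have hprod_b : ∀ ω, ∏ i ∈ Finset.range n, b ω i =
      mprod K X h s n ω * (Real.exp (-(t ^ 2 / 2 * V ω)) : ℝ) := by
    intro ω
    rw [Finset.prod_mul_distrib, mprod, ← Complex.ofReal_prod, ← Real.exp_sum]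
    congr 4
    rw [Finset.sum_neg_distrib, ← Finset.sum_div]
    simp only [mul_pow, hs2, ← Finset.mul_sum, hV]
    ring
  have hdiff : ∀ ω, ‖∏ i ∈ Finset.range n, a ω i - ∏ i ∈ Finset.range n, b ω i‖ ≤
      2 * (|t| * (2 * H)) ^ 3 * (√n)⁻¹ := by
    intro ω
    refine (norm_prod_sub_prod_le_sum _ _ n (fun i => ?_) fun i => ?_).trans ?_
    · exact (Complex.norm_exp_ofReal_mul_I _).le
    · exact norm_one_add_mul_I_mul_exp_le _
    have hx : ∀ i, |s * mdiff K X h i ω| ≤ |s| * (2 * H) := fun i => by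
      rw [abs_mul]; gcongr; exact abs_mdiff_le hh i ω
    calc _ ≤ ∑ i ∈ Finset.range n, 2 * (|s| * (2 * H)) ^ 3 := by
          refine Finset.sum_le_sum fun i _ => (norm_exp_sub_le ((hx i).trans hs)).trans ?_
          gcongr
          exact hx i
      _ = 2 * (|t| * (2 * H)) ^ 3 * (√n)⁻¹ := by
          rw [Finset.sum_const, Finset.card_range, nsmul_eq_mul, hsdef, abs_mul,
            abs_of_pos (inv_pos.mpr hsp)]
          nth_rewrite 1 [← hsn]
          field_simp
  have hma : Measurable fun ω => ∏ i ∈ Finset.range n, a ω i := by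
    refine Finset.measurable_prod _ fun i _ => ?_
    exact Complex.measurable_exp.comp ((Complex.measurable_ofReal.comp
      ((hX.measurable_mdiff hh i).const_mul s)).mul_const _)
  have hIa : Integrable (fun ω => ∏ i ∈ Finset.range n, a ω i) P := by
    refine Integrable.of_bound hma.aestronglyMeasurable 1 (ae_of_all _ fun ω => ?_)
    rw [← hprod_a]
    exact (Complex.norm_exp_ofReal_mul_I _).le
  have hTI := hX.integrable_mprod hh s n
  have hTb : ∀ ω, ‖mprod K X h s n ω‖ ≤ Real.exp (t ^ 2 * (2 * H) ^ 2 / 2) := by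
    intro ω
    refine (norm_mprod_le hh s n ω).trans_eq ?_
    rw [hs2]
    congr 1
    field_simp
  have hmE : Measurable fun ω => ((Real.exp (-(t ^ 2 / 2 * V ω)) : ℝ) : ℂ) :=
    Complex.measurable_ofReal.comp (Real.measurable_exp.comp (hVm.const_mul _).neg)
  have hIb : Integrable (fun ω => mprod K X h s n ω * (Real.exp (-(t ^ 2 / 2 * V ω)) : ℝ)) P := by
    refine hTI.mul_bdd (c := 1) hmE.aestronglyMeasurable (ae_of_all _ fun ω => ?_)
    rw [Complex.norm_real, Real.norm_of_nonneg (Real.exp_pos _).le]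
    exact Real.exp_le_one_iff.mpr (neg_nonpos.mpr (mul_nonneg (by positivity) (hV0 ω)))
  have hIc := hTI.mul_const ((Real.exp (-(t ^ 2 / 2 * v)) : ℝ) : ℂ)
  have e : ∫ ω, ∏ i ∈ Finset.range n, a ω i ∂P - (Real.exp (-(t ^ 2 / 2 * v)) : ℝ) =
      ∫ ω, (∏ i ∈ Finset.range n, a ω i - ∏ i ∈ Finset.range n, b ω i) ∂P +
      ∫ ω, (mprod K X h s n ω * (Real.exp (-(t ^ 2 / 2 * V ω)) : ℝ)
        - mprod K X h s n ω * (Real.exp (-(t ^ 2 / 2 * v)) : ℝ)) ∂P := by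
    simp only [hprod_b]
    rw [integral_sub hIa hIb, integral_sub hIb hIc, integral_mul_const, hX.integral_mprod hh]
    ring
  simp only [hprod_a]
  rw [e]
  refine (norm_add_le _ _).trans (add_le_add ?_ ?_)
  · simpa using norm_integral_le_of_norm_le_const (μ := P) (ae_of_all _ hdiff)
  · rw [← integral_const_mul]
    refine norm_integral_le_of_norm_le (hVI.const_mul _) (ae_of_all _ fun ω => ?_)
    rw [← mul_sub, norm_mul, ← Complex.ofReal_sub, Complex.norm_real, mul_assoc]
    refine mul_le_mul (hTb ω) ?_ (norm_nonneg _) (Real.exp_pos _).le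
    refine (abs_exp_neg_sub_exp_neg_le (mul_nonneg (by positivity) (hV0 ω))
      (mul_nonneg (by positivity) hv0)).trans_eq ?_
    rw [← mul_sub, abs_mul, abs_of_nonneg (by positivity : 0 ≤ t ^ 2 / 2)]

/-- Central limit theorem for the martingale increments, in terms of characteristic functions. -/
lemma tendsto_charFun_mdiff (hX : StatMarkov P X μ K)
    (hmix : ∀ u C, BddMeas u C → Tendsto (mixc K μ u) atTop (𝓝 0)) (hh : BddMeas h H) (t : ℝ) :
    Tendsto (fun n : ℕ => ∫ ω, Complex.exp
      (((t * (√n)⁻¹ * ∑ i ∈ Finset.range n, mdiff K X h i ω : ℝ) : ℂ) * Complex.I) ∂P)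
      atTop (𝓝 ((Real.exp (-(t ^ 2 / 2 * mvar K μ h)) : ℝ) : ℂ)) := by
  have hinv : Tendsto (fun n : ℕ => (√(n : ℝ))⁻¹) atTop (𝓝 0) :=
    tendsto_inv_atTop_zero.comp (Real.tendsto_sqrt_atTop.comp tendsto_natCast_atTop_atTop)
  have hs : ∀ᶠ n : ℕ in atTop, |t * (√n)⁻¹| * (2 * H) ≤ 1 := by
    have : Tendsto (fun n : ℕ => |t * (√(n : ℝ))⁻¹| * (2 * H)) atTop (𝓝 0) := by
      simpa using ((hinv.const_mul t).abs).mul_const (2 * H)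
    exact this.eventually (ge_mem_nhds zero_lt_one)
  rw [tendsto_iff_norm_sub_tendsto_zero]
  have hlim := (hinv.const_mul (2 * (|t| * (2 * H)) ^ 3)).add
    ((hX.tendsto_average_sq_mdiff hmix hh).const_mul
      (Real.exp (t ^ 2 * (2 * H) ^ 2 / 2) * (t ^ 2 / 2)))
  simp only [mul_zero, add_zero] at hlim
  refine squeeze_zero' (Eventually.of_forall fun _ => norm_nonneg _) ?_ hlim
  filter_upwards [hs, eventually_gt_atTop 0] with n h1 h2
  exact hX.norm_charFun_mdiff_sub_le hh t h2 h1

end StatMarkov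
end martingaleCLT

section approximation

lemma tendsto_of_forall_approx {E : Type*} [PseudoMetricSpace E] {a : ℕ → E} {l : E}
    {b : ℕ → ℕ → E} {l' : ℕ → E} {e : ℕ → ℝ} (hb : ∀ m, Tendsto (b m) atTop (𝓝 (l' m)))
    (hl : Tendsto l' atTop (𝓝 l)) (he : Tendsto e atTop (𝓝 0))
    (hab : ∀ m, ∀ δ > 0, ∀ᶠ n in atTop, dist (a n) (b m n) ≤ e m + δ) :
    Tendsto a atTop (𝓝 l) := by
  rw [Metric.tendsto_nhds]
  intro ε hε
  obtain ⟨m, h1, h2⟩ := ((Metric.tendsto_nhds.mp hl (ε / 4) (by positivity)).and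
    (he.eventually (gt_mem_nhds (by positivity : (0 : ℝ) < ε / 4)))).exists
  filter_upwards [Metric.tendsto_nhds.mp (hb m) (ε / 4) (by positivity),
    hab m (ε / 4) (by positivity)] with n h3 h4
  have := dist_triangle4 (a n) (b m n) (l' m) l
  linarith

lemma tendsto_tsum_min {a s : ℕ → ℝ} (ha : Summable a) (ha0 : ∀ k, 0 ≤ a k)
    (hs0 : ∀ m, 0 ≤ s m) (hs : Tendsto s atTop (𝓝 0)) :
    Tendsto (fun m => ∑' k, min (a k) (s m)) atTop (𝓝 0) := by
  have h := tendsto_tsum_of_dominated_convergence (f := fun m k => min (a k) (s m))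
    (g := fun _ => (0 : ℝ)) (𝓕 := atTop) ha (fun k => ?_) (Eventually.of_forall fun m k => ?_)
  · simpa using h
  · refine squeeze_zero (fun m => le_min (ha0 k) (hs0 m)) (fun m => min_le_right _ _) hs
  · rw [Real.norm_of_nonneg (le_min (ha0 k) (hs0 m))]; exact min_le_left _ _

lemma norm_integral_exp_sub_le {Ω : Type*} [MeasurableSpace Ω] {P : Measure Ω}
    [IsProbabilityMeasure P] {A B : Ω → ℝ} (hA : AEMeasurable A P) (hB : AEMeasurable B P)
    (hAB : Integrable (fun ω => A ω - B ω) P) :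
    ‖∫ ω, Complex.exp ((A ω : ℂ) * Complex.I) ∂P - ∫ ω, Complex.exp ((B ω : ℂ) * Complex.I) ∂P‖
      ≤ ∫ ω, |A ω - B ω| ∂P := by
  have hI : ∀ {A : Ω → ℝ}, AEMeasurable A P →
      Integrable (fun ω => Complex.exp ((A ω : ℂ) * Complex.I)) P := fun hA =>
    Integrable.of_bound (Complex.measurable_exp.comp_aemeasurable
      ((Complex.measurable_ofReal.comp_aemeasurable hA).mul_const _)).aestronglyMeasurable 1
      (ae_of_all _ fun ω => (Complex.norm_exp_ofReal_mul_I _).le)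
  rw [← integral_sub (hI hA) (hI hB)]
  refine norm_integral_le_of_norm_le hAB.abs (ae_of_all _ fun ω => ?_)
  have e : Complex.exp ((A ω : ℂ) * Complex.I) - Complex.exp ((B ω : ℂ) * Complex.I) =
      Complex.exp ((B ω : ℂ) * Complex.I) *
        (Complex.exp (Complex.I * ((A ω - B ω : ℝ) : ℂ)) - 1) := by
    rw [mul_sub, ← Complex.exp_add]
    push_cast
    ring_nf
  rw [e, norm_mul, Complex.norm_exp_ofReal_mul_I, one_mul]
  exact Real.norm_exp_I_mul_ofReal_sub_one_le

end approximation

/-- The asymptotic variance `σ²(μ, K, u)`. -/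
def asymVar (K : Kernel ℝ ℝ) (μ : Measure ℝ) (u : ℝ → ℝ) : ℝ :=
  (∫ x, (u x - ∫ y, u y ∂μ) ^ 2 ∂μ) + 2 * ∑' k : ℕ, lagCov K μ u u (k + 1)

section gordin

variable {Ω : Type*} [mΩ : MeasurableSpace Ω]
  {P : Measure Ω} [IsProbabilityMeasure P] {X : ℕ → Ω → ℝ}
  {μ : Measure ℝ} [IsProbabilityMeasure μ] {K : Kernel ℝ ℝ} [IsMarkovKernel K]
  {u : ℝ → ℝ} {C : ℝ}

/-- Truncated potential of `u`. -/
def potential (K : Kernel ℝ ℝ) (u : ℝ → ℝ) (N : ℕ) (x : ℝ) : ℝ :=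
  ∑ k ∈ Finset.range N, (Kop K)^[k] u x

lemma bddMeas_potential (K : Kernel ℝ ℝ) [IsMarkovKernel K] (hu : BddMeas u C) (N : ℕ) :
    BddMeas (potential K u N) (∑ _k ∈ Finset.range N, C) :=
  BddMeas.sum _ fun k _ => hu.kop_iterate K k

lemma kop_potential (K : Kernel ℝ ℝ) [IsMarkovKernel K] (hu : BddMeas u C) (N : ℕ) (x : ℝ) :
    Kop K (potential K u N) x = ∑ k ∈ Finset.range N, (Kop K)^[k + 1] u x := by
  have h := kop_iterate_sum K (Finset.range N) (fun k _ => hu.kop_iterate K k) 1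
  simp only [Function.iterate_one] at h
  simp only [Function.iterate_succ_apply']
  exact congrFun h x

lemma potential_sub_kop (K : Kernel ℝ ℝ) [IsMarkovKernel K] (hu : BddMeas u C) (N : ℕ) (x : ℝ) :
    potential K u N x - Kop K (potential K u N) x = u x - (Kop K)^[N] u x := by
  rw [kop_potential K hu, potential, ← Finset.sum_sub_distrib,
    Finset.sum_range_sub' (fun k => (Kop K)^[k] u x)]
  rfl

lemma sum_comp_eq (hu : BddMeas u C) (N n : ℕ) (ω : Ω) :
    ∑ i ∈ Finset.range n, u (X (i + 1) ω) =
      ∑ i ∈ Finset.range n, mdiff K X (potential K u N) i ω +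
      (Kop K (potential K u N) (X 0 ω) - Kop K (potential K u N) (X n ω)) +
      ∑ i ∈ Finset.range n, (Kop K)^[N] u (X (i + 1) ω) := by
  rw [← Finset.sum_range_sub' (fun i => Kop K (potential K u N) (X i ω)), ← Finset.sum_add_distrib,
    ← Finset.sum_add_distrib]
  refine Finset.sum_congr rfl fun i _ => ?_
  have := potential_sub_kop K hu N (X (i + 1) ω)
  unfold mdiff
  linarith

lemma mixc_of_integral_eq_zero (h0 : ∫ x, u x ∂μ = 0) (n : ℕ) :
    mixc K μ u n = ∫ x, |(Kop K)^[n] u x| ∂μ := by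
  simp [mixc, h0]

lemma abs_integral_kop_iterate_mul_le (hu : BddMeas u C) (h0 : ∫ x, u x ∂μ = 0) (j k : ℕ) :
    |∫ x, (Kop K)^[j] u x * (Kop K)^[k] u x ∂μ| ≤ C * min (mixc K μ u k) (mixc K μ u j) := by
  have key : ∀ i j, |∫ x, (Kop K)^[i] u x * (Kop K)^[j] u x ∂μ| ≤ C * mixc K μ u j := by
    intro i j
    rw [mixc_of_integral_eq_zero h0, ← integral_const_mul]
    refine abs_integral_le_integral_abs.trans (integral_mono_of_nonneg
      (ae_of_all _ fun _ => abs_nonneg _)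
      (((hu.kop_iterate K j).integrable μ).abs.const_mul C) (ae_of_all _ fun x => ?_))
    dsimp only
    rw [abs_mul]
    exact mul_le_mul_of_nonneg_right ((hu.kop_iterate K i).bound x) (abs_nonneg _)
  rw [mul_min_of_nonneg _ _ hu.nonneg]
  refine le_min (key j k) ?_
  simp only [mul_comm ((Kop K)^[j] u _)]
  exact key k j

lemma mixc_succ_le (hinv : μ.bind (fun x => K x) = μ) (hu : BddMeas u C)
    (h0 : ∫ x, u x ∂μ = 0) (k : ℕ) : mixc K μ u (k + 1) ≤ mixc K μ u k := by
  rw [mixc_of_integral_eq_zero h0, mixc_of_integral_eq_zero h0, Function.iterate_succ_apply']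
  exact integral_abs_kop_le hinv ((hu.kop_iterate K k).integrable μ)

lemma integral_mul_potential_add (hu : BddMeas u C) {v : ℝ → ℝ} {D : ℝ} (hv : BddMeas v D) (N : ℕ) :
    ∫ x, v x * (potential K u N x + Kop K (potential K u N) x) ∂μ =
      ∑ k ∈ Finset.range N, ∫ x, v x * (Kop K)^[k] u x ∂μ +
      ∑ k ∈ Finset.range N, ∫ x, v x * (Kop K)^[k + 1] u x ∂μ := by
  have hI : ∀ k, Integrable (fun x => v x * (Kop K)^[k] u x) μ := fun k =>
    (hv.mul (hu.kop_iterate K k)).integrable μ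
  rw [← integral_finsetSum _ fun k _ => hI k, ← integral_finsetSum _ fun k _ => hI (k + 1),
    ← integral_add (integrable_finsetSum _ fun k _ => hI k)
      (integrable_finsetSum _ fun k _ => hI (k + 1))]
  simp only [kop_potential K hu, potential, mul_add, Finset.mul_sum]

lemma integral_kop_iterate_mul_potential_le (hinv : μ.bind (fun x => K x) = μ) (hu : BddMeas u C)
    (h0 : ∫ x, u x ∂μ = 0) (hs : Summable (mixc K μ u)) (N : ℕ) :
    |∫ x, (Kop K)^[N] u x * (potential K u N x + Kop K (potential K u N) x) ∂μ| ≤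
      2 * C * ∑' k, min (mixc K μ u k) (mixc K μ u N) := by
  rw [integral_mul_potential_add hu (hu.kop_iterate K N)]
  have hC := hu.nonneg
  have hmin : Summable fun k => min (mixc K μ u k) (mixc K μ u N) :=
    Summable.of_nonneg_of_le (fun k => le_min (mixc_nonneg u k) (mixc_nonneg u N))
      (fun k => min_le_left _ _) hs
  have hle : ∑ k ∈ Finset.range N, C * min (mixc K μ u k) (mixc K μ u N) ≤
      C * ∑' k, min (mixc K μ u k) (mixc K μ u N) := by
    rw [← Finset.mul_sum]
    gcongr
    exact hmin.sum_le_tsum _ fun k _ => le_min (mixc_nonneg u k) (mixc_nonneg u N)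
  refine (abs_add_le _ _).trans ?_
  have h1 : |∑ k ∈ Finset.range N, ∫ x, (Kop K)^[N] u x * (Kop K)^[k] u x ∂μ| ≤
      C * ∑' k, min (mixc K μ u k) (mixc K μ u N) :=
    (Finset.abs_sum_le_sum_abs _ _).trans ((Finset.sum_le_sum fun k _ =>
      abs_integral_kop_iterate_mul_le hu h0 N k).trans hle)
  have h2 : |∑ k ∈ Finset.range N, ∫ x, (Kop K)^[N] u x * (Kop K)^[k + 1] u x ∂μ| ≤
      C * ∑' k, min (mixc K μ u k) (mixc K μ u N) := by
    refine (Finset.abs_sum_le_sum_abs _ _).trans ((Finset.sum_le_sum fun k _ =>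
      (abs_integral_kop_iterate_mul_le hu h0 N (k + 1)).trans ?_).trans hle)
    gcongr
    exact mixc_succ_le hinv hu h0 k
  linarith

lemma mvar_potential (hu : BddMeas u C)
    (h0 : ∫ x, u x ∂μ = 0) (N : ℕ) :
    mvar K μ (potential K u N) =
      ∑ k ∈ Finset.range N, lagCov K μ u u k + ∑ k ∈ Finset.range N, lagCov K μ u u (k + 1) -
      ∫ x, (Kop K)^[N] u x * (potential K u N x + Kop K (potential K u N) x) ∂μ := by
  have hh := bddMeas_potential K hu N
  have hs := hh.add (hh.kop K)
  have e : ∀ x, potential K u N x ^ 2 - Kop K (potential K u N) x ^ 2 =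
      u x * (potential K u N x + Kop K (potential K u N) x) -
      (Kop K)^[N] u x * (potential K u N x + Kop K (potential K u N) x) := by
    intro x
    rw [← sub_mul, ← potential_sub_kop K hu]
    ring
  unfold mvar
  simp only [e]
  rw [integral_sub ((hu.mul hs).integrable μ) (((hu.kop_iterate K N).mul hs).integrable μ),
    integral_mul_potential_add hu hu]
  simp only [lagCov, h0, sub_zero]

lemma summable_lagCov (hinv : μ.bind (fun x => K x) = μ) (hu : BddMeas u C)
    (hs : Summable (mixc K μ u)) : Summable (lagCov K μ u u) :=
  Summable.of_norm_bounded (hs.mul_left C) fun k => abs_lagCov_le hinv hu hu k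

lemma tendsto_mvar_potential (hinv : μ.bind (fun x => K x) = μ) (hu : BddMeas u C)
    (h0 : ∫ x, u x ∂μ = 0) (hs : Summable (mixc K μ u)) :
    Tendsto (fun N => mvar K μ (potential K u N)) atTop (𝓝 (asymVar K μ u)) := by
  have hl := summable_lagCov hinv hu hs
  have h1 := hl.hasSum.tendsto_sum_nat
  have h2 := ((summable_nat_add_iff 1).mpr hl).hasSum.tendsto_sum_nat
  have h3 : Tendsto (fun N => ∫ x, (Kop K)^[N] u x *
      (potential K u N x + Kop K (potential K u N) x) ∂μ) atTop (𝓝 0) := by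
    refine squeeze_zero_norm (integral_kop_iterate_mul_potential_le hinv hu h0 hs) ?_
    simpa using (tendsto_tsum_min hs (mixc_nonneg u) (mixc_nonneg u)
      hs.tendsto_atTop_zero).const_mul (2 * C)
  simp only [mvar_potential hu h0]
  have e : asymVar K μ u = ∑' k, lagCov K μ u u k + ∑' k, lagCov K μ u u (k + 1) - 0 := by
    rw [hl.tsum_eq_zero_add, asymVar]
    have : ∫ x, (u x - ∫ y, u y ∂μ) ^ 2 ∂μ = lagCov K μ u u 0 := by
      simp only [lagCov, h0, sub_zero, sq]; rfl
    rw [this]; ring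
  rw [e]
  exact (h1.add h2).sub h3

lemma asymVar_centered (hu : BddMeas u C) :
    asymVar K μ (fun x => u x - ∫ y, u y ∂μ) = asymVar K μ u := by
  have h0 : ∫ x, (u x - ∫ y, u y ∂μ) ∂μ = 0 := by
    rw [integral_sub (hu.integrable μ) (integrable_const _)]; simp
  have hl : ∀ k, lagCov K μ (fun x => u x - ∫ y, u y ∂μ) (fun x => u x - ∫ y, u y ∂μ) k =
      lagCov K μ u u k := by
    intro k
    have hc := hu.sub (BddMeas.const (∫ y, u y ∂μ))
    have hk := hu.kop_iterate K k
    unfold lagCov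
    rw [h0, kop_iterate_sub K hu (BddMeas.const _), kop_iterate_const]
    simp only [sub_zero, mul_sub ((_ : ℝ) - _)]
    rw [integral_sub ((hc.mul hk).integrable μ) ((hc.integrable μ).mul_const _),
      integral_mul_const, h0]
    simp
  unfold asymVar
  simp only [hl, h0, sub_zero]

namespace StatMarkov

lemma integral_abs_sum_kop_iterate_le (hX : StatMarkov P X μ K) (hu : BddMeas u C)
    (h0 : ∫ x, u x ∂μ = 0) (hs : Summable (mixc K μ u)) (N n : ℕ) :
    ∫ ω, |∑ i ∈ Finset.range n, (Kop K)^[N] u (X (i + 1) ω)| ∂P ≤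
      √n * √(2 * C * ∑' k, mixc K μ u (k + N)) := by
  have hw := hu.kop_iterate K N
  have hw0 : ∫ x, (Kop K)^[N] u x ∂μ = 0 := by
    rw [integral_kop_iterate hX.inv (hu.integrable μ), h0]
  have hm : Measurable fun ω => ∑ i ∈ Finset.range n, (Kop K)^[N] u (X (i + 1) ω) :=
    Finset.measurable_sum _ fun i _ => hw.meas.comp (hX.meas _)
  have hmem : MemLp (fun ω => ∑ i ∈ Finset.range n, (Kop K)^[N] u (X (i + 1) ω)) 2 P := by
    refine MemLp.of_bound hm.aestronglyMeasurable (∑ _i ∈ Finset.range n, C)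
      (ae_of_all _ fun ω => ?_)
    exact (Finset.abs_sum_le_sum_abs _ _).trans (Finset.sum_le_sum fun i _ => hw.bound _)
  refine (integral_abs_le_sqrt hmem).trans ?_
  rw [← Real.sqrt_mul (Nat.cast_nonneg n)]
  apply Real.sqrt_le_sqrt
  have h1 := hX.integral_sq_sum_centered_le hw n
  simp only [hw0, sub_zero] at h1
  refine h1.trans ?_
  have hmix : ∀ k, mixc K μ ((Kop K)^[N] u) k = mixc K μ u (k + N) := fun k => by
    rw [mixc_of_integral_eq_zero hw0, mixc_of_integral_eq_zero h0, Function.iterate_add_apply]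
  have h2 : ∑ k ∈ Finset.range n, |lagCov K μ ((Kop K)^[N] u) ((Kop K)^[N] u) k| ≤
      C * ∑' k, mixc K μ u (k + N) := by
    calc _ ≤ ∑ k ∈ Finset.range n, C * mixc K μ u (k + N) :=
          Finset.sum_le_sum fun k _ => (abs_lagCov_le hX.inv hw hw k).trans_eq (by rw [hmix])
      _ ≤ _ := by
          rw [← Finset.mul_sum]
          have := hu.nonneg
          gcongr
          exact ((summable_nat_add_iff N).mpr hs).sum_le_tsum _ fun k _ => mixc_nonneg u _
  calc _ ≤ 2 * n * (C * ∑' k, mixc K μ u (k + N)) := by gcongr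
    _ = _ := by ring

lemma tendsto_charFun_of_bddMeas_centered (hX : StatMarkov P X μ K)
    (hmix : ∀ u C, BddMeas u C → Tendsto (mixc K μ u) atTop (𝓝 0)) (hu : BddMeas u C)
    (h0 : ∫ x, u x ∂μ = 0) (hs : Summable (mixc K μ u)) (t : ℝ) :
    Tendsto (fun n : ℕ => ∫ ω, Complex.exp
      (((t * (√n)⁻¹ * ∑ i ∈ Finset.range n, u (X (i + 1) ω) : ℝ) : ℂ) * Complex.I) ∂P)
      atTop (𝓝 ((Real.exp (-(t ^ 2 / 2 * asymVar K μ u)) : ℝ) : ℂ)) := by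
  have hh := bddMeas_potential K hu
  refine tendsto_of_forall_approx (e := fun N => |t| * √(2 * C * ∑' k, mixc K μ u (k + N)))
    (fun N => hX.tendsto_charFun_mdiff hmix (hh N) t) ?_ ?_ fun N δ hδ => ?_
  · have := (tendsto_mvar_potential hX.inv hu h0 hs).const_mul (t ^ 2 / 2)
    exact (Complex.continuous_ofReal.comp Real.continuous_exp).tendsto _ |>.comp this.neg
  · have := (((tendsto_sum_nat_add (mixc K μ u)).const_mul (2 * C)).sqrt).const_mul |t|
    simpa using this
  · have hinv : Tendsto (fun n : ℕ => |t| * (√(n : ℝ))⁻¹ *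
        (2 * ∑ _k ∈ Finset.range N, C)) atTop (𝓝 0) := by
      have := ((tendsto_inv_atTop_zero.comp (Real.tendsto_sqrt_atTop.comp
        tendsto_natCast_atTop_atTop)).const_mul |t|).mul_const (2 * ∑ _k ∈ Finset.range N, C)
      simpa using this
    filter_upwards [hinv.eventually (gt_mem_nhds hδ), eventually_gt_atTop 0] with n hn hn0
    have hn' : (0 : ℝ) < n := Nat.cast_pos.mpr hn0
    have hsp : 0 < √(n : ℝ) := Real.sqrt_pos.mpr hn'
    have hw := hu.kop_iterate K N
    have hk := (hh N).kop K
    have m1 : Measurable fun ω => ∑ i ∈ Finset.range n, u (X (i + 1) ω) :=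
      Finset.measurable_sum _ fun i _ => hu.meas.comp (hX.meas _)
    have m2 : Measurable fun ω => ∑ i ∈ Finset.range n, mdiff K X (potential K u N) i ω :=
      Finset.measurable_sum _ fun i _ => hX.measurable_mdiff (hh N) i
    have m3 : Measurable fun ω => ∑ i ∈ Finset.range n, (Kop K)^[N] u (X (i + 1) ω) :=
      Finset.measurable_sum _ fun i _ => hw.meas.comp (hX.meas _)
    have i3 : Integrable (fun ω => ∑ i ∈ Finset.range n, (Kop K)^[N] u (X (i + 1) ω)) P :=
      integrable_finsetSum _ fun i _ => hX.integrable_comp (hw.integrable μ) _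
    have e : ∀ ω, t * (√n)⁻¹ * ∑ i ∈ Finset.range n, u (X (i + 1) ω) -
        t * (√n)⁻¹ * ∑ i ∈ Finset.range n, mdiff K X (potential K u N) i ω =
        t * (√n)⁻¹ * ((Kop K (potential K u N) (X 0 ω) - Kop K (potential K u N) (X n ω)) +
          ∑ i ∈ Finset.range n, (Kop K)^[N] u (X (i + 1) ω)) := by
      intro ω
      rw [sum_comp_eq (K := K) hu N n ω]
      ring
    have iR : Integrable (fun ω => (Kop K (potential K u N) (X 0 ω) -
        Kop K (potential K u N) (X n ω)) +
          ∑ i ∈ Finset.range n, (Kop K)^[N] u (X (i + 1) ω)) P :=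
      ((hX.integrable_comp (hk.integrable μ) 0).sub (hX.integrable_comp (hk.integrable μ) n)).add i3
    have key := norm_integral_exp_sub_le (P := P) (m1.const_mul (t * (√n)⁻¹)).aemeasurable
      (m2.const_mul (t * (√n)⁻¹)).aemeasurable (by simp only [e]; exact iR.const_mul _)
    rw [dist_eq_norm]
    refine key.trans ?_
    simp only [e, abs_mul, abs_of_pos (inv_pos.mpr hsp)]
    rw [integral_const_mul]
    have hb : ∫ ω, |(Kop K (potential K u N) (X 0 ω) - Kop K (potential K u N) (X n ω)) +
          ∑ i ∈ Finset.range n, (Kop K)^[N] u (X (i + 1) ω)| ∂P ≤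
        2 * (∑ _k ∈ Finset.range N, C) + √n * √(2 * C * ∑' k, mixc K μ u (k + N)) := by
      calc _ ≤ ∫ ω, (2 * (∑ _k ∈ Finset.range N, C) +
            |∑ i ∈ Finset.range n, (Kop K)^[N] u (X (i + 1) ω)|) ∂P := by
            refine integral_mono iR.abs ((integrable_const _).add i3.abs) fun ω => ?_
            refine (abs_add_le _ _).trans (add_le_add ?_ le_rfl)
            refine (abs_sub _ _).trans ((add_le_add (hk.bound _) (hk.bound _)).trans_eq ?_)
            ring
        _ ≤ _ := by
            rw [integral_add (integrable_const _) i3.abs]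
            simp only [integral_const, probReal_univ, one_smul]
            gcongr
            exact hX.integral_abs_sum_kop_iterate_le hu h0 hs N n
    calc _ ≤ |t| * (√n)⁻¹ * (2 * (∑ _k ∈ Finset.range N, C) +
          √n * √(2 * C * ∑' k, mixc K μ u (k + N))) := by gcongr
      _ = |t| * (√n)⁻¹ * (2 * (∑ _k ∈ Finset.range N, C)) +
          |t| * √(2 * C * ∑' k, mixc K μ u (k + N)) := by
          rw [mul_add]; congr 1; field_simp
      _ ≤ _ := by linarith

lemma asymVar_nonneg_of_bddMeas_centered (hX : StatMarkov P X μ K) (hu : BddMeas u C)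
    (h0 : ∫ x, u x ∂μ = 0) (hs : Summable (mixc K μ u)) : 0 ≤ asymVar K μ u :=
  ge_of_tendsto' (tendsto_mvar_potential hX.inv hu h0 hs)
    fun N => hX.mvar_nonneg (bddMeas_potential K hu N)

end StatMarkov

lemma summable_mixc_centered (hu : BddMeas u C) (hs : Summable (mixc K μ u)) :
    Summable (mixc K μ fun x => u x - ∫ y, u y ∂μ) := by
  refine Summable.of_nonneg_of_le (mixc_nonneg _) (fun k => ?_) hs
  refine (mixc_sub_le hu (BddMeas.const _) k).trans_eq ?_
  rw [mixc_const, add_zero]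

lemma integral_centered_eq_zero (hu : BddMeas u C) : ∫ x, (u x - ∫ y, u y ∂μ) ∂μ = 0 := by
  rw [integral_sub (hu.integrable μ) (integrable_const _)]; simp

namespace StatMarkov

/-- Central limit theorem for bounded observables with summable mixing rates. -/
lemma tendsto_charFun_of_bddMeas (hX : StatMarkov P X μ K)
    (hmix : ∀ u C, BddMeas u C → Tendsto (mixc K μ u) atTop (𝓝 0)) (hu : BddMeas u C)
    (hs : Summable (mixc K μ u)) (t : ℝ) :
    Tendsto (fun n : ℕ => ∫ ω, Complex.exp
      (((t * (√n)⁻¹ * ∑ i ∈ Finset.range n, (u (X (i + 1) ω) - ∫ y, u y ∂μ) : ℝ) : ℂ)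
        * Complex.I) ∂P)
      atTop (𝓝 ((Real.exp (-(t ^ 2 / 2 * asymVar K μ u)) : ℝ) : ℂ)) := by
  rw [← asymVar_centered hu]
  exact hX.tendsto_charFun_of_bddMeas_centered hmix (hu.sub (BddMeas.const _))
    (integral_centered_eq_zero hu) (summable_mixc_centered hu hs) t

lemma asymVar_nonneg_of_bddMeas (hX : StatMarkov P X μ K) (hu : BddMeas u C)
    (hs : Summable (mixc K μ u)) : 0 ≤ asymVar K μ u := by
  rw [← asymVar_centered hu]
  exact hX.asymVar_nonneg_of_bddMeas_centered (hu.sub (BddMeas.const _))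
    (integral_centered_eq_zero hu) (summable_mixc_centered hu hs)

end StatMarkov

end gordin

section level

variable {μ : Measure ℝ} [IsProbabilityMeasure μ] {K : Kernel ℝ ℝ} [IsMarkovKernel K]
  {u v : ℝ → ℝ} {C D : ℝ} {k : ℕ} {α : ℝ}

lemma bddMeas_indic (t : ℝ) : BddMeas (indic t) 1 := bddMeas_indicator measurableSet_Iic

lemma mixc_indicator_le_of_tendsto (hinv : μ.bind (fun x => K x) = μ)
    (hα : ∀ t, mixc K μ (indic t) k ≤ α) {s : Set ℝ} (hs : MeasurableSet s) (t : ℕ → ℝ)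
    (ht : ∀ x, ∀ᶠ n in atTop, x ∈ s ↔ x ≤ t n) :
    mixc K μ (s.indicator fun _ => (1 : ℝ)) k ≤ α := by
  have hb := bddMeas_indicator hs
  have h1 : Tendsto (fun n => ∫ x, |s.indicator (fun _ => (1 : ℝ)) x - indic (t n) x| ∂μ)
      atTop (𝓝 (∫ _x, (0 : ℝ) ∂μ)) := by
    refine tendsto_integral_of_dominated_convergence (fun _ => 1 + 1)
      (fun n => ((hb.sub (bddMeas_indic _)).meas.abs).aestronglyMeasurable) (integrable_const _)
      (fun n => ae_of_all _ fun x => ?_) (ae_of_all _ fun x => ?_)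
    · rw [Real.norm_eq_abs, abs_abs]; exact (hb.sub (bddMeas_indic _)).bound x
    · refine tendsto_const_nhds.congr' ?_
      filter_upwards [ht x] with n hn
      by_cases hx : x ∈ s
      · simp [indic, hx, hn.mp hx]
      · simp [indic, hx, mt hn.mpr hx]
  rw [integral_zero] at h1
  have h2 := (h1.const_mul 2).const_add α
  simp only [mul_zero, add_zero] at h2
  refine ge_of_tendsto' h2 fun n => ?_
  exact (mixc_le_add_two_mul hinv hb (bddMeas_indic (t n)) k).trans
    (by gcongr; exact hα _)

lemma mixc_indicator_le_of_isLowerSet (hinv : μ.bind (fun x => K x) = μ)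
    (hα : ∀ t, mixc K μ (indic t) k ≤ α) {s : Set ℝ} (hs : IsLowerSet s) :
    mixc K μ (s.indicator fun _ => (1 : ℝ)) k ≤ α := by
  have hsm : MeasurableSet s := hs.ordConnected.measurableSet
  rcases s.eq_empty_or_nonempty with rfl | hne
  · have : mixc K μ ((∅ : Set ℝ).indicator fun _ => (1 : ℝ)) k = 0 := by
      simp only [indicator_empty]; exact mixc_const 0 k
    rw [this]; exact (mixc_nonneg _ _).trans (hα 0)
  by_cases hbd : BddAbove s
  · by_cases hm : sSup s ∈ s
    · refine mixc_indicator_le_of_tendsto hinv hα hsm (fun _ => sSup s) fun x => ?_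
      exact Eventually.of_forall fun n => ⟨fun hx => le_csSup hbd hx, fun hx => hs hx hm⟩
    · refine mixc_indicator_le_of_tendsto hinv hα hsm (fun n => sSup s - 1 / ((n : ℝ) + 1))
        fun x => ?_
      by_cases hx : x < sSup s
      · have hxs : x ∈ s := by
          obtain ⟨y, hy, hxy⟩ := exists_lt_of_lt_csSup hne hx
          exact hs hxy.le hy
        filter_upwards [tendsto_one_div_add_atTop_nhds_zero_nat.eventually
          (gt_mem_nhds (sub_pos.mpr hx))] with n hn
        simp only [hxs, true_iff]
        linarith
      · have hxs : x ∉ s := fun h => hx (lt_of_le_of_ne (le_csSup hbd h)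
          fun e => hm (e ▸ h))
        refine Eventually.of_forall fun n => ?_
        have : (0 : ℝ) < 1 / ((n : ℝ) + 1) := by positivity
        simp only [hxs, false_iff, not_le]
        linarith [not_lt.mp hx]
  · refine mixc_indicator_le_of_tendsto hinv hα hsm (fun n => (n : ℝ)) fun x => ?_
    have hxs : x ∈ s := by
      obtain ⟨y, hy, hxy⟩ := not_bddAbove_iff.mp hbd x
      exact hs hxy.le hy
    filter_upwards [tendsto_natCast_atTop_atTop.eventually_ge_atTop x] with n hn
    simp [hxs, hn]

lemma mixc_indicator_le_of_ordConnected (hinv : μ.bind (fun x => K x) = μ)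
    (hα : ∀ t, mixc K μ (indic t) k ≤ α) {s : Set ℝ} (hs : s.OrdConnected) :
    mixc K μ (s.indicator fun _ => (1 : ℝ)) k ≤ 2 * α := by
  rcases s.eq_empty_or_nonempty with rfl | ⟨z, hz⟩
  · have : mixc K μ ((∅ : Set ℝ).indicator fun _ => (1 : ℝ)) k = 0 := by
      simp only [indicator_empty]; exact mixc_const 0 k
    rw [this]; linarith [(mixc_nonneg _ _).trans (hα 0)]
  set A : Set ℝ := {x | ∃ y ∈ s, x ≤ y}
  set B : Set ℝ := {x | ∀ y ∈ s, x < y}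
  have hA : IsLowerSet A := fun x y hyx ⟨w, hw, hxw⟩ => ⟨w, hw, hyx.trans hxw⟩
  have hB : IsLowerSet B := fun x y hyx h w hw => hyx.trans_lt (h w hw)
  have hAm : MeasurableSet A := hA.ordConnected.measurableSet
  have hBm : MeasurableSet B := hB.ordConnected.measurableSet
  have e : (s.indicator fun _ => (1 : ℝ)) =
      fun x => A.indicator (fun _ => (1 : ℝ)) x - B.indicator (fun _ => (1 : ℝ)) x := by
    funext x
    by_cases hx : x ∈ s
    · have h1 : x ∈ A := ⟨x, hx, le_rfl⟩
      have h2 : x ∉ B := fun h => lt_irrefl x (h x hx)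
      simp [hx, h1, h2]
    · by_cases h1 : x ∈ A
      · have h2 : x ∈ B := by
          obtain ⟨y, hy, hxy⟩ := h1
          intro w hw
          by_contra hwx
          exact hx (hs.out hw hy ⟨not_lt.mp hwx, hxy⟩)
        simp [hx, h1, h2]
      · have h2 : x ∉ B := fun h => h1 ⟨z, hz, (h z hz).le⟩
        simp [hx, h1, h2]
  rw [e]
  have h1 := mixc_indicator_le_of_isLowerSet hinv hα hA
  have h2 := mixc_indicator_le_of_isLowerSet hinv hα hB
  have h3 := mixc_sub_le (K := K) (μ := μ) (bddMeas_indicator hAm) (bddMeas_indicator hBm) k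
  linarith

/-- All upper level sets at positive height are intervals. -/
def LevelConnected (w : ℝ → ℝ) : Prop := ∀ s > 0, OrdConnected {x | s ≤ w x}

lemma LevelConnected.measurable_posPart (hu : LevelConnected u) :
    Measurable fun x => max (u x) 0 := by
  refine measurable_of_Ici fun s => ?_
  rcases le_or_gt s 0 with hs | hs
  · convert MeasurableSet.univ
    ext x; simp [hs]
  · convert (hu s hs).measurableSet using 1
    ext x; simp [hs.not_ge]

lemma LevelConnected.measurable (h : LevelConnected u) (h' : LevelConnected fun x => -u x) :
    Measurable u := by
  convert h.measurable_posPart.sub h'.measurable_posPart using 1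
  funext x
  simp only [Pi.sub_apply]
  rcases le_total 0 (u x) with h | h
  · rw [max_eq_left h, max_eq_right (by linarith), sub_zero]
  · rw [max_eq_right h, max_eq_left (by linarith)]; ring

lemma abs_sub_step_le (δ : ℝ) (hδ : 0 < δ) (N : ℕ) (y : ℝ) (hy0 : 0 ≤ y) (hy : y ≤ N * δ) :
    |y - δ * ∑ j ∈ Finset.range N, if ((j : ℝ) + 1) * δ ≤ y then (1 : ℝ) else 0| ≤ δ := by
  have key : ∀ n : ℕ, (∑ j ∈ Finset.range n, if ((j : ℝ) + 1) * δ ≤ y then (1 : ℝ) else 0) =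
      min (n : ℝ) ⌊y / δ⌋₊ := by
    intro n
    induction n with
    | zero => simp
    | succ n ih =>
      rw [Finset.sum_range_succ, ih]
      have h1 : ((n : ℝ) + 1) * δ ≤ y ↔ n + 1 ≤ ⌊y / δ⌋₊ := by
        rw [Nat.le_floor_iff (by positivity), le_div_iff₀ hδ]; push_cast; rfl
      simp only [h1]
      split_ifs with h
      · rw [min_eq_left (by exact_mod_cast (by omega : n ≤ ⌊y / δ⌋₊)),
          min_eq_left (by exact_mod_cast h)]
        push_cast; rfl
      · rw [min_eq_right (by exact_mod_cast (by omega : ⌊y / δ⌋₊ ≤ n)),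
          min_eq_right (by exact_mod_cast (by omega : ⌊y / δ⌋₊ ≤ n + 1)), add_zero]
  have h2 : (⌊y / δ⌋₊ : ℝ) ≤ N :=
    (Nat.floor_le (by positivity)).trans ((div_le_iff₀ hδ).mpr hy)
  rw [key, min_eq_right h2]
  have h3 := Nat.floor_le (by positivity : 0 ≤ y / δ)
  have h4 := Nat.lt_floor_add_one (y / δ)
  rw [le_div_iff₀ hδ] at h3
  rw [div_lt_iff₀ hδ] at h4
  rw [abs_le]
  constructor <;> nlinarith

lemma mixc_le_of_levelConnected (hinv : μ.bind (fun x => K x) = μ)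
    (hα : ∀ t, mixc K μ (indic t) k ≤ α) (hu : LevelConnected u) {τ : ℝ} (hτ : 0 < τ) :
    mixc K μ (fun x => min (max (u x) 0) τ) k ≤ 2 * τ * α := by
  set w : ℝ → ℝ := fun x => min (max (u x) 0) τ with hw
  have hw0 : ∀ x, 0 ≤ w x := fun x => le_min (le_max_right _ _) hτ.le
  have hwτ : ∀ x, w x ≤ τ := fun x => min_le_right _ _
  have hwm : Measurable w := hu.measurable_posPart.min measurable_const
  have hwb : BddMeas w τ := ⟨hwm, fun x => by rw [abs_of_nonneg (hw0 x)]; exact hwτ x⟩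
  have hlev : ∀ s > 0, OrdConnected {x | s ≤ w x} := by
    intro s hs
    rcases le_or_gt s τ with h | h
    · convert hu s hs using 2
      ext x; simp [hw, h, hs.not_ge]
    · convert ordConnected_empty using 1
      ext x; simp [hw, h]
  have hbound : ∀ N : ℕ, mixc K μ w k ≤ 2 * τ * α + 2 * (τ * (1 / ((N : ℝ) + 1))) := by
    intro N
    set δ := τ * (1 / ((N : ℝ) + 1)) with hδdef
    have hδ : 0 < δ := by positivity
    have hNδ : ((N + 1 : ℕ) : ℝ) * δ = τ := by rw [hδdef]; push_cast; field_simp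
    let J : ℕ → Set ℝ := fun j => {x | ((j : ℝ) + 1) * δ ≤ w x}
    have hJ : ∀ j, OrdConnected (J j) := fun j => hlev _ (by positivity)
    have hJb : ∀ j, BddMeas ((J j).indicator fun _ => (1 : ℝ)) 1 := fun j =>
      bddMeas_indicator (hJ j).measurableSet
    have hsum := BddMeas.sum (Finset.range (N + 1)) fun j _ => hJb j
    have hstep : ∀ x, |w x - δ * ∑ j ∈ Finset.range (N + 1), (J j).indicator (fun _ => (1 : ℝ)) x|
        ≤ δ := by
      intro x
      have := abs_sub_step_le δ hδ (N + 1) (w x) (hw0 x) (hNδ ▸ hwτ x)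
      simpa only [indicator_apply, J, mem_ofPred_eq] using this
    refine (mixc_le_add_two_mul hinv hwb (hsum.const_mul δ) k).trans (add_le_add ?_ ?_)
    · rw [mixc_const_mul, abs_of_pos hδ]
      calc _ ≤ δ * ∑ j ∈ Finset.range (N + 1), 2 * α := by
            gcongr
            exact (mixc_sum_le _ (fun j _ => hJb j) k).trans (Finset.sum_le_sum fun j _ =>
              mixc_indicator_le_of_ordConnected hinv hα (hJ j))
        _ = 2 * τ * α := by
            rw [Finset.sum_const, Finset.card_range, nsmul_eq_mul, ← hNδ]; ring
    · gcongr
      refine (integral_mono_of_nonneg (ae_of_all _ fun _ => abs_nonneg _)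
        (integrable_const δ) (ae_of_all _ hstep)).trans_eq (by simp)
  have hlim : Tendsto (fun N : ℕ => 2 * τ * α + 2 * (τ * (1 / ((N : ℝ) + 1)))) atTop
      (𝓝 (2 * τ * α)) := by
    simpa using ((tendsto_one_div_add_atTop_nhds_zero_nat (𝕜 := ℝ)).const_mul τ |>.const_mul 2
      |>.const_add (2 * τ * α))
  exact ge_of_tendsto' hlim hbound

end level

section secondMoment

variable {μ : Measure ℝ} [IsProbabilityMeasure μ] {K : Kernel ℝ ℝ} [IsMarkovKernel K]
  {u v w : ℝ → ℝ} {C D E : ℝ} {k : ℕ}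

lemma sq_integral_le_integral_sq {ν : Measure ℝ} [IsProbabilityMeasure ν] (hu : MemLp u 2 ν) :
    (∫ x, u x ∂ν) ^ 2 ≤ ∫ x, u x ^ 2 ∂ν := by
  have h := variance_nonneg u ν
  rw [variance_eq_sub hu] at h
  simpa using h

lemma BddMeas.memLp (hu : BddMeas u C) (ν : Measure ℝ) [IsFiniteMeasure ν] (p : ℝ≥0∞) :
    MemLp u p ν :=
  MemLp.of_bound hu.meas.aestronglyMeasurable C (ae_of_all _ hu.bound)

lemma BddMeas.sq (hu : BddMeas u C) : BddMeas (fun x => u x ^ 2) (C * C) := by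
  simpa only [_root_.sq] using hu.mul hu

lemma integral_sq_kop_iterate_le (hinv : μ.bind (fun x => K x) = μ) (hu : BddMeas u C) (k : ℕ) :
    ∫ x, (Kop K)^[k] u x ^ 2 ∂μ ≤ ∫ x, u x ^ 2 ∂μ := by
  induction k with
  | zero => exact le_rfl
  | succ k ih =>
    refine le_trans ?_ ih
    have hk := hu.kop_iterate K k
    rw [← integral_kop hinv (hk.sq.integrable μ)]
    simp only [Function.iterate_succ_apply']
    exact integral_mono ((hk.kop K).sq.integrable μ) ((hk.sq.kop K).integrable μ)
      fun x => sq_integral_le_integral_sq (hk.memLp (K x) 2)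

lemma integral_sq_sub_integral_le (hu : BddMeas u C) :
    ∫ x, (u x - ∫ y, u y ∂μ) ^ 2 ∂μ ≤ ∫ x, u x ^ 2 ∂μ := by
  have h := variance_le_expectation_sq (X := u) (μ := μ) hu.meas.aestronglyMeasurable
  rw [variance_eq_integral hu.meas.aemeasurable] at h
  simpa using h

lemma abs_lagCov_le_sq (hinv : μ.bind (fun x => K x) = μ) (hu : BddMeas u C) (hv : BddMeas v D)
    (k : ℕ) : |lagCov K μ u v k| ≤ (∫ x, u x ^ 2 ∂μ + ∫ x, v x ^ 2 ∂μ) / 2 := by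
  have hk := hv.kop_iterate K k
  have hc := hu.sub (BddMeas.const (∫ y, u y ∂μ))
  have h1 := integral_sq_kop_iterate_le hinv hv k
  have h2 := integral_sq_sub_integral_le (μ := μ) hu
  have h3 : |lagCov K μ u v k| ≤ ∫ x, ((u x - ∫ y, u y ∂μ) ^ 2 + (Kop K)^[k] v x ^ 2) / 2 ∂μ := by
    refine abs_integral_le_integral_abs.trans (integral_mono_of_nonneg
      (ae_of_all _ fun _ => abs_nonneg _)
      (((hc.sq.integrable μ).add (hk.sq.integrable μ)).div_const 2)
      (ae_of_all _ fun x => ?_))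
    dsimp only
    rw [abs_le]
    constructor
    · nlinarith [sq_nonneg ((u x - ∫ y, u y ∂μ) + (Kop K)^[k] v x)]
    · nlinarith [sq_nonneg ((u x - ∫ y, u y ∂μ) - (Kop K)^[k] v x)]
  rw [integral_div, integral_add (hc.sq.integrable μ) (hk.sq.integrable μ)] at h3
  linarith

lemma lagCov_add_left (hu : BddMeas u C) (hv : BddMeas v D) (hw : BddMeas w E) (k : ℕ) :
    lagCov K μ (fun x => u x + v x) w k = lagCov K μ u w k + lagCov K μ v w k := by
  have hk := hw.kop_iterate K k
  unfold lagCov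
  rw [integral_add (hu.integrable μ) (hv.integrable μ), ← integral_add
    (((hu.sub (BddMeas.const _)).mul hk).integrable μ)
    (((hv.sub (BddMeas.const _)).mul hk).integrable μ)]
  congr 1; funext x; ring

lemma lagCov_add_right (hu : BddMeas u C) (hv : BddMeas v D) (hw : BddMeas w E) (k : ℕ) :
    lagCov K μ w (fun x => u x + v x) k = lagCov K μ w u k + lagCov K μ w v k := by
  have hc := hw.sub (BddMeas.const (∫ y, w y ∂μ))
  unfold lagCov
  rw [kop_iterate_add K hu hv, ← integral_add
    ((hc.mul (hu.kop_iterate K k)).integrable μ) ((hc.mul (hv.kop_iterate K k)).integrable μ)]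
  simp only [mul_add]

lemma lagCov_const_mul_left (u w : ℝ → ℝ) (c : ℝ) (k : ℕ) :
    lagCov K μ (fun x => c * u x) w k = c * lagCov K μ u w k := by
  have h : ∫ x, c * u x ∂μ = c * ∫ x, u x ∂μ := integral_const_mul c u
  unfold lagCov
  simp only [h]
  rw [← integral_const_mul c fun x => (u x - ∫ y, u y ∂μ) * (Kop K)^[k] w x]
  congr 1; funext x; ring

lemma lagCov_const_mul_right (u w : ℝ → ℝ) (c : ℝ) (k : ℕ) :
    lagCov K μ w (fun x => c * u x) k = c * lagCov K μ w u k := by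
  unfold lagCov
  rw [kop_iterate_const_mul, ← integral_const_mul c]
  congr 1; funext x; ring

lemma abs_lagCov_sum_left_le {ι : Type*} (s : Finset ι) {a : ι → ℝ} {u : ι → ℝ → ℝ} {C : ι → ℝ}
    (hu : ∀ i, BddMeas (u i) (C i)) (hw : BddMeas w E) {r : ℝ}
    (hr : ∀ i, |lagCov K μ (u i) w k| ≤ r) :
    |lagCov K μ (fun x => ∑ i ∈ s, a i * u i x) w k| ≤ (∑ i ∈ s, |a i|) * r := by
  classical
  induction s using Finset.induction_on with
  | empty => simp [lagCov]
  | insert j s hj ih =>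
    simp only [Finset.sum_insert hj]
    rw [lagCov_add_left ((hu j).const_mul (a j))
      (BddMeas.sum s fun i _ => (hu i).const_mul (a i)) hw,
      lagCov_const_mul_left, add_mul]
    refine (abs_add_le _ _).trans (add_le_add ?_ ih)
    rw [abs_mul]
    exact mul_le_mul_of_nonneg_left (hr j) (abs_nonneg _)

lemma abs_lagCov_sum_right_le {ι : Type*} (s : Finset ι) {a : ι → ℝ} {u : ι → ℝ → ℝ} {C : ι → ℝ}
    (hu : ∀ i, BddMeas (u i) (C i)) (hw : BddMeas w E) {r : ℝ}
    (hr : ∀ i, |lagCov K μ w (u i) k| ≤ r) :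
    |lagCov K μ w (fun x => ∑ i ∈ s, a i * u i x) k| ≤ (∑ i ∈ s, |a i|) * r := by
  classical
  induction s using Finset.induction_on with
  | empty =>
    have : (Kop K)^[k] (fun _ => (0 : ℝ)) = fun _ => 0 := kop_iterate_const K 0 k
    simp [lagCov, this]
  | insert j s hj ih =>
    simp only [Finset.sum_insert hj]
    rw [lagCov_add_right ((hu j).const_mul (a j))
      (BddMeas.sum s fun i _ => (hu i).const_mul (a i)) hw,
      lagCov_const_mul_right, add_mul]
    refine (abs_add_le _ _).trans (add_le_add ?_ ih)
    rw [abs_mul]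
    exact mul_le_mul_of_nonneg_left (hr j) (abs_nonneg _)

end secondMoment

section clip

/-- Truncation of a real number at level `τ`. -/
def clip (τ y : ℝ) : ℝ := min (max y 0) τ - min (max (-y) 0) τ

/-- Excess of `|y|` over the level `τ`. -/
def excess (τ y : ℝ) : ℝ := max (|y| - τ) 0

lemma clip_of_nonneg {τ y : ℝ} (hτ : 0 ≤ τ) (hy : 0 ≤ y) : clip τ y = min y τ := by
  rw [clip, max_eq_left hy, max_eq_right (by linarith), min_eq_left hτ, sub_zero]

lemma clip_neg (τ y : ℝ) : clip τ (-y) = -clip τ y := by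
  simp [clip]

lemma excess_neg (τ y : ℝ) : excess τ (-y) = excess τ y := by simp [excess]

lemma excess_nonneg (τ y : ℝ) : 0 ≤ excess τ y := le_max_right _ _

lemma abs_clip_le {τ : ℝ} (hτ : 0 ≤ τ) (y : ℝ) : |clip τ y| ≤ τ := by
  wlog hy : 0 ≤ y generalizing y
  · have := this (-y) (by linarith)
    rwa [clip_neg, abs_neg] at this
  rw [clip_of_nonneg hτ hy, abs_of_nonneg (le_min hy hτ)]
  exact min_le_right _ _

lemma abs_clip_sub_clip_le {a τ : ℝ} (ha : 0 ≤ a) (hτ : 0 ≤ τ) (y : ℝ) :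
    |clip a y - clip (min a τ) y| ≤ excess τ y := by
  wlog hy : 0 ≤ y generalizing y
  · have := this (-y) (by linarith)
    rwa [clip_neg, clip_neg, excess_neg, ← neg_sub', abs_neg] at this
  rw [clip_of_nonneg ha hy, clip_of_nonneg (le_min ha hτ) hy, excess, abs_of_nonneg hy]
  rcases le_total a τ with h | h
  · rw [min_eq_left h]; simp
  · rw [min_eq_right h, abs_of_nonneg (sub_nonneg.mpr (min_le_min_left _ h))]
    rcases le_total y τ with h1 | h1
    · rw [min_eq_left h1, min_eq_left (h1.trans h)]; simp
    · rw [min_eq_right h1]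
      exact le_max_of_le_left (sub_le_sub_right (min_le_left _ _) _)

lemma abs_sub_clip_le {τ : ℝ} (hτ : 0 ≤ τ) (y : ℝ) : |y - clip τ y| ≤ excess τ y := by
  wlog hy : 0 ≤ y generalizing y
  · have := this (-y) (by linarith)
    rwa [clip_neg, excess_neg, ← neg_sub', abs_neg] at this
  rw [clip_of_nonneg hτ hy, excess, abs_of_nonneg hy,
    abs_of_nonneg (sub_nonneg.mpr (min_le_left _ _))]
  rcases le_total y τ with h1 | h1
  · rw [min_eq_left h1]; simp
  · rw [min_eq_right h1]; exact le_max_left _ _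

lemma excess_le_sq {τ : ℝ} (hτ : 0 < τ) (y : ℝ) :
    excess τ y ≤ 2 / τ * excess (τ / 2) y ^ 2 := by
  have h0 : 0 ≤ 2 / τ * excess (τ / 2) y ^ 2 := by positivity
  refine max_le ?_ h0
  rcases le_total |y| τ with h | h
  · linarith
  · have h1 : excess (τ / 2) y = |y| - τ / 2 := max_eq_left (by linarith)
    rw [h1, div_mul_eq_mul_div, le_div_iff₀ hτ]
    nlinarith

end clip

section tail

variable {μ : Measure ℝ} [IsProbabilityMeasure μ] {K : Kernel ℝ ℝ} [IsMarkovKernel K]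
  {g g' : ℝ → ℝ} {θ : ℝ → ℝ} {k : ℕ} {α : ℝ}

/-- Functions whose positive and negative parts have intervals as level sets and whose tails
in `L²(μ)` are controlled by `θ`. -/
structure TailMon (μ : Measure ℝ) (θ : ℝ → ℝ) (g : ℝ → ℝ) : Prop where
  pos : LevelConnected g
  neg : LevelConnected fun x => -g x
  tail : ∀ τ > 0, ∫⁻ x, ENNReal.ofReal (excess τ (g x) ^ 2) ∂μ ≤ ENNReal.ofReal (θ τ)
  nonneg : ∀ τ, 0 ≤ θ τ

namespace TailMon

lemma measurable (hg : TailMon μ θ g) : Measurable g := hg.pos.measurable hg.neg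

lemma measurable_excess (hg : TailMon μ θ g) (τ : ℝ) : Measurable fun x => excess τ (g x) :=
  (hg.measurable.abs.sub_const τ).max measurable_const

lemma integrable_sq_excess (hg : TailMon μ θ g) {τ : ℝ} (hτ : 0 < τ) :
    Integrable (fun x => excess τ (g x) ^ 2) μ := by
  refine ⟨((hg.measurable_excess τ).pow_const 2).aestronglyMeasurable, ?_⟩
  rw [hasFiniteIntegral_iff_ofReal (ae_of_all _ fun _ => sq_nonneg _)]
  exact (hg.tail τ hτ).trans_lt ENNReal.ofReal_lt_top

lemma integral_sq_excess_le (hg : TailMon μ θ g) {τ : ℝ} (hτ : 0 < τ) :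
    ∫ x, excess τ (g x) ^ 2 ∂μ ≤ θ τ := by
  rw [integral_eq_lintegral_of_nonneg_ae (ae_of_all _ fun _ => sq_nonneg _)
    ((hg.measurable_excess τ).pow_const 2).aestronglyMeasurable]
  exact ENNReal.toReal_le_of_le_ofReal (hg.nonneg τ) (hg.tail τ hτ)

lemma integrable_excess (hg : TailMon μ θ g) {τ : ℝ} (hτ : 0 < τ) :
    Integrable (fun x => excess τ (g x)) μ := by
  refine ((hg.integrable_sq_excess (half_pos hτ)).const_mul (2 / τ)).mono'
    (hg.measurable_excess τ).aestronglyMeasurable (ae_of_all _ fun x => ?_)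
  rw [Real.norm_of_nonneg (excess_nonneg _ _)]
  exact excess_le_sq hτ _

lemma integral_excess_le (hg : TailMon μ θ g) {τ : ℝ} (hτ : 0 < τ) :
    ∫ x, excess τ (g x) ∂μ ≤ 2 / τ * θ (τ / 2) := by
  calc _ ≤ ∫ x, 2 / τ * excess (τ / 2) (g x) ^ 2 ∂μ :=
        integral_mono (hg.integrable_excess hτ)
          ((hg.integrable_sq_excess (half_pos hτ)).const_mul _) fun x => excess_le_sq hτ _
    _ ≤ _ := by
        rw [integral_const_mul]
        gcongr
        exact hg.integral_sq_excess_le (half_pos hτ)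

lemma bddMeas_clip (hg : TailMon μ θ g) {τ : ℝ} (hτ : 0 < τ) :
    BddMeas (fun x => clip τ (g x)) τ :=
  ⟨(hg.pos.measurable_posPart.min measurable_const).sub
    (hg.neg.measurable_posPart.min measurable_const), fun _ => abs_clip_le hτ.le _⟩

lemma mixc_clip_le (hinv : μ.bind (fun x => K x) = μ) (hα : ∀ t, mixc K μ (indic t) k ≤ α)
    (hg : TailMon μ θ g) {τ : ℝ} (hτ : 0 < τ) :
    mixc K μ (fun x => clip τ (g x)) k ≤ 4 * τ * α := by
  have hb : ∀ {w : ℝ → ℝ}, LevelConnected w → BddMeas (fun x => min (max (w x) 0) τ) τ := fun hw =>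
    ⟨hw.measurable_posPart.min measurable_const, fun x => by
      rw [abs_of_nonneg (le_min (le_max_right _ _) hτ.le)]; exact min_le_right _ _⟩
  have h1 := mixc_le_of_levelConnected hinv hα hg.pos hτ
  have h2 := mixc_le_of_levelConnected hinv hα hg.neg hτ
  have h3 := mixc_sub_le (K := K) (μ := μ) (hb hg.pos) (hb hg.neg) k
  refine h3.trans ?_
  linarith

/-- Covariance inequality for truncations of functions in the class. -/
lemma abs_lagCov_clip_le (hinv : μ.bind (fun x => K x) = μ) (hα : ∀ t, mixc K μ (indic t) k ≤ α)
    (hg : TailMon μ θ g) (hg' : TailMon μ θ g') {a b τ : ℝ} (ha : 0 < a) (hb : 0 < b) (hτ : 0 < τ) :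
    |lagCov K μ (fun x => clip a (g x)) (fun x => clip b (g' x)) k| ≤
      4 * τ ^ 2 * α + 8 * θ (τ / 2) + θ τ := by
  have hα0 : 0 ≤ α := (mixc_nonneg _ _).trans (hα 0)
  set u := fun x => clip a (g x)
  set v := fun x => clip b (g' x)
  set u₁ := fun x => clip (min a τ) (g x)
  set v₁ := fun x => clip (min b τ) (g' x)
  have haτ : 0 < min a τ := lt_min ha hτ
  have hbτ : 0 < min b τ := lt_min hb hτ
  have hu : BddMeas u a := hg.bddMeas_clip ha
  have hv : BddMeas v b := hg'.bddMeas_clip hb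
  have hu₁ : BddMeas u₁ (min a τ) := hg.bddMeas_clip haτ
  have hv₁ : BddMeas v₁ (min b τ) := hg'.bddMeas_clip hbτ
  have hu₂ := hu.sub hu₁
  have hv₂ := hv.sub hv₁
  set u₂ := fun x => u x - u₁ x
  set v₂ := fun x => v x - v₁ x
  have eu : u = fun x => u₁ x + u₂ x := by funext x; simp [u₂]
  have ev : v = fun x => v₁ x + v₂ x := by funext x; simp [v₂]
  have bu : ∀ x, |u₂ x| ≤ excess τ (g x) := fun x => abs_clip_sub_clip_le ha.le hτ.le _
  have bv : ∀ x, |v₂ x| ≤ excess τ (g' x) := fun x => abs_clip_sub_clip_le hb.le hτ.le _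
  have iu : ∫ x, |u₂ x| ∂μ ≤ 2 / τ * θ (τ / 2) :=
    (integral_mono (hu₂.integrable μ).abs (hg.integrable_excess hτ) bu).trans
      (hg.integral_excess_le hτ)
  have iv : ∫ x, |v₂ x| ∂μ ≤ 2 / τ * θ (τ / 2) :=
    (integral_mono (hv₂.integrable μ).abs (hg'.integrable_excess hτ) bv).trans
      (hg'.integral_excess_le hτ)
  have su : ∫ x, u₂ x ^ 2 ∂μ ≤ θ τ :=
    (integral_mono (hu₂.sq.integrable μ) (hg.integrable_sq_excess hτ)
      fun x => sq_le_sq' (by linarith [neg_abs_le (u₂ x), bu x])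
        ((le_abs_self _).trans (bu x))).trans (hg.integral_sq_excess_le hτ)
  have sv : ∫ x, v₂ x ^ 2 ∂μ ≤ θ τ :=
    (integral_mono (hv₂.sq.integrable μ) (hg'.integrable_sq_excess hτ)
      fun x => sq_le_sq' (by linarith [neg_abs_le (v₂ x), bv x])
        ((le_abs_self _).trans (bv x))).trans (hg'.integral_sq_excess_le hτ)
  have c11 : |lagCov K μ u₁ v₁ k| ≤ 4 * τ ^ 2 * α := by
    refine (abs_lagCov_le hinv hu₁ hv₁ k).trans ?_
    calc _ ≤ τ * (4 * τ * α) := by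
          refine mul_le_mul (min_le_right _ _) ((mixc_clip_le hinv hα hg' hbτ).trans ?_)
            (mixc_nonneg _ _) hτ.le
          gcongr
          exact min_le_right _ _
      _ = _ := by ring
  have c12 : |lagCov K μ u₁ v₂ k| ≤ 4 * θ (τ / 2) := by
    refine (abs_lagCov_le hinv hu₁ hv₂ k).trans ?_
    calc _ ≤ τ * (2 * (2 / τ * θ (τ / 2))) := by
          refine mul_le_mul (min_le_right _ _)
            ((mixc_le_two_mul hinv (hv₂.integrable μ) k).trans ?_)
            (mixc_nonneg _ _) hτ.le
          gcongr
      _ = _ := by field_simp; ring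
  have c21 : |lagCov K μ u₂ v₁ k| ≤ 4 * θ (τ / 2) := by
    have hm : |∫ y, u₂ y ∂μ| ≤ ∫ y, |u₂ y| ∂μ := abs_integral_le_integral_abs
    have hI : Integrable (fun x => (|u₂ x| + ∫ y, |u₂ y| ∂μ) * τ) μ :=
      ((hu₂.integrable μ).abs.add (integrable_const _)).mul_const _
    calc _ ≤ ∫ x, (|u₂ x| + ∫ y, |u₂ y| ∂μ) * τ ∂μ := by
          refine abs_integral_le_integral_abs.trans (integral_mono_of_nonneg
            (ae_of_all _ fun _ => abs_nonneg _) hI (ae_of_all _ fun x => ?_))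
          dsimp only
          rw [abs_mul]
          refine mul_le_mul ((abs_sub _ _).trans (by gcongr))
            (((hv₁.kop_iterate K k).bound x).trans (min_le_right _ _)) (abs_nonneg _) ?_
          exact add_nonneg (abs_nonneg _) (integral_nonneg fun _ => abs_nonneg _)
      _ = (2 * ∫ y, |u₂ y| ∂μ) * τ := by
          rw [integral_mul_const, integral_add (hu₂.integrable μ).abs (integrable_const _)]
          simp only [integral_const, probReal_univ, one_smul]; ring
      _ ≤ (2 * (2 / τ * θ (τ / 2))) * τ := by gcongr
      _ = _ := by field_simp; ring
  have c22 : |lagCov K μ u₂ v₂ k| ≤ θ τ := by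
    refine (abs_lagCov_le_sq hinv hu₂ hv₂ k).trans ?_
    linarith
  have e : lagCov K μ u v k = lagCov K μ u₁ v₁ k + lagCov K μ u₁ v₂ k +
      (lagCov K μ u₂ v₁ k + lagCov K μ u₂ v₂ k) := by
    rw [← lagCov_add_right hv₁ hv₂ hu₁, ← lagCov_add_right hv₁ hv₂ hu₂, ← ev,
      ← lagCov_add_left hu₁ hu₂ hv, ← eu]
  rw [e]
  refine (abs_add_le _ _).trans ?_
  have := abs_add_le (lagCov K μ u₁ v₁ k) (lagCov K μ u₁ v₂ k)
  have := abs_add_le (lagCov K μ u₂ v₁ k) (lagCov K μ u₂ v₂ k)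
  linarith

end TailMon
end tail

section square_integrable

variable {μ : Measure ℝ} [IsProbabilityMeasure μ] {K : Kernel ℝ ℝ} [IsMarkovKernel K]
  {u v : ℝ → ℝ}

lemma abs_integral_mul_le_sqrt (hu : MemLp u 2 μ) (hv : MemLp v 2 μ) :
    |∫ x, u x * v x ∂μ| ≤ √(∫ x, u x ^ 2 ∂μ) * √(∫ x, v x ^ 2 ∂μ) := by
  have h := integral_mul_le_Lp_mul_Lq_of_nonneg (μ := μ) Real.HolderConjugate.two_two
    (f := fun x => |u x|) (g := fun x => |v x|)
    (ae_of_all _ fun _ => abs_nonneg _) (ae_of_all _ fun _ => abs_nonneg _)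
    (by rw [ENNReal.ofReal_ofNat]; exact hu.abs) (by rw [ENNReal.ofReal_ofNat]; exact hv.abs)
  refine abs_integral_le_integral_abs.trans ?_
  simp only [abs_mul]
  refine h.trans_eq ?_
  simp only [Real.rpow_two, sq_abs, ← Real.sqrt_eq_rpow]

lemma tendsto_integral_mul {U V : ℕ → ℝ → ℝ} (hu : MemLp u 2 μ) (hv : MemLp v 2 μ)
    (hU : ∀ m, MemLp (U m) 2 μ) (hV : ∀ m, MemLp (V m) 2 μ)
    (hUu : Tendsto (fun m => ∫ x, (u x - U m x) ^ 2 ∂μ) atTop (𝓝 0))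
    (hVv : Tendsto (fun m => ∫ x, (v x - V m x) ^ 2 ∂μ) atTop (𝓝 0)) :
    Tendsto (fun m => ∫ x, U m x * V m x ∂μ) atTop (𝓝 (∫ x, u x * v x ∂μ)) := by
  have hdu : ∀ m, MemLp (fun x => u x - U m x) 2 μ := fun m => hu.sub (hU m)
  have hdv : ∀ m, MemLp (fun x => v x - V m x) 2 μ := fun m => hv.sub (hV m)
  have hsu := (Real.continuous_sqrt.tendsto 0).comp hUu
  have hsv := (Real.continuous_sqrt.tendsto 0).comp hVv
  simp only [Real.sqrt_zero] at hsu hsv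
  have h1 : Tendsto (fun m => ∫ x, u x * (v x - V m x) ∂μ) atTop (𝓝 0) := by
    refine squeeze_zero_norm (fun m => abs_integral_mul_le_sqrt hu (hdv m)) ?_
    simpa using hsv.const_mul (√(∫ x, u x ^ 2 ∂μ))
  have h2 : Tendsto (fun m => ∫ x, (u x - U m x) * v x ∂μ) atTop (𝓝 0) := by
    refine squeeze_zero_norm (fun m => abs_integral_mul_le_sqrt (hdu m) hv) ?_
    simpa using hsu.mul_const (√(∫ x, v x ^ 2 ∂μ))
  have h3 : Tendsto (fun m => ∫ x, (u x - U m x) * (v x - V m x) ∂μ) atTop (𝓝 0) := by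
    refine squeeze_zero_norm (fun m => abs_integral_mul_le_sqrt (hdu m) (hdv m)) ?_
    simpa using hsu.mul hsv
  have h4 := (((tendsto_const_nhds (x := ∫ x, u x * v x ∂μ)).sub h1).sub h2).add h3
  simp only [sub_zero, add_zero] at h4
  refine h4.congr fun m => ?_
  have i0 : Integrable (fun x => u x * v x) μ := hu.integrable_mul hv
  have i1 : Integrable (fun x => u x * (v x - V m x)) μ := hu.integrable_mul (hdv m)
  have i2 : Integrable (fun x => (u x - U m x) * v x) μ := (hdu m).integrable_mul hv
  have i3 : Integrable (fun x => (u x - U m x) * (v x - V m x)) μ := (hdu m).integrable_mul (hdv m)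
  have i01 : Integrable (fun x => u x * v x - u x * (v x - V m x)) μ := i0.sub i1
  have i012 : Integrable (fun x => u x * v x - u x * (v x - V m x) - (u x - U m x) * v x) μ :=
    i01.sub i2
  rw [← integral_sub i0 i1, ← integral_sub i01 i2, ← integral_add i012 i3]
  congr 1; funext x; ring

lemma kop_congr_ae (hinv : μ.bind (fun x => K x) = μ) (h : u =ᵐ[μ] v) :
    Kop K u =ᵐ[μ] Kop K v := by
  have h' : ∀ᵐ x ∂(μ.bind K), u x = v x := by rwa [show μ.bind K = μ from hinv]
  filter_upwards [Measure.ae_ae_of_ae_comp h'] with x hx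
  exact integral_congr_ae hx

lemma kop_iterate_sub_ae (hinv : μ.bind (fun x => K x) = μ) (hu : Integrable u μ)
    (hv : Integrable v μ) (k : ℕ) :
    (Kop K)^[k] (fun x => u x - v x) =ᵐ[μ] fun x => (Kop K)^[k] u x - (Kop K)^[k] v x := by
  induction k with
  | zero => exact ae_of_all _ fun _ => rfl
  | succ k ih =>
    simp only [Function.iterate_succ_apply']
    refine (kop_congr_ae hinv ih).trans ?_
    filter_upwards [ae_integrable_kernel hinv (integrable_kop_iterate (K := K) hinv hu k),
      ae_integrable_kernel hinv (integrable_kop_iterate (K := K) hinv hv k)] with x h1 h2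
    exact integral_sub h1 h2

lemma memLp_kop (hinv : μ.bind (fun x => K x) = μ) (hu : MemLp u 2 μ) :
    MemLp (Kop K u) 2 μ ∧ ∫ x, Kop K u x ^ 2 ∂μ ≤ ∫ x, u x ^ 2 ∂μ := by
  have hi := integrable_kop (K := K) hinv (hu.integrable one_le_two)
  have hle : ∀ᵐ x ∂μ, Kop K u x ^ 2 ≤ Kop K (fun y => u y ^ 2) x := by
    filter_upwards [ae_integrable_kernel hinv (hu.integrable one_le_two),
      ae_integrable_kernel hinv hu.integrable_sq] with x h1 h2
    exact sq_integral_le_integral_sq ((memLp_two_iff_integrable_sq h1.1).mpr h2)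
  have hi2 := integrable_kop (K := K) hinv hu.integrable_sq
  refine ⟨(memLp_two_iff_integrable_sq hi.1).mpr (hi2.mono' (hi.1.pow 2) ?_), ?_⟩
  · filter_upwards [hle] with x hx
    rwa [Real.norm_of_nonneg (sq_nonneg _)]
  · rw [← integral_kop hinv hu.integrable_sq]
    exact integral_mono_of_nonneg (ae_of_all _ fun _ => sq_nonneg _) hi2 hle

lemma memLp_kop_iterate (hinv : μ.bind (fun x => K x) = μ) (hu : MemLp u 2 μ) (k : ℕ) :
    MemLp ((Kop K)^[k] u) 2 μ ∧ ∫ x, (Kop K)^[k] u x ^ 2 ∂μ ≤ ∫ x, u x ^ 2 ∂μ := by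
  induction k with
  | zero => exact ⟨hu, le_rfl⟩
  | succ k ih =>
    rw [Function.iterate_succ_apply']
    have := memLp_kop (K := K) hinv ih.1
    exact ⟨this.1, this.2.trans ih.2⟩

lemma integral_sq_centered_sub_le (hu : MemLp u 2 μ) (hv : MemLp v 2 μ) :
    ∫ x, ((u x - ∫ y, u y ∂μ) - (v x - ∫ y, v y ∂μ)) ^ 2 ∂μ ≤ ∫ x, (u x - v x) ^ 2 ∂μ := by
  have hd : MemLp (fun x => u x - v x) 2 μ := hu.sub hv
  have h := variance_le_expectation_sq (μ := μ) (X := fun x => u x - v x) hd.1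
  rw [variance_eq_integral hd.1.aemeasurable] at h
  refine (le_of_eq ?_).trans h
  rw [integral_sub (hu.integrable one_le_two) (hv.integrable one_le_two)]
  congr 1; funext x; ring

lemma tendsto_lagCov {U : ℕ → ℝ → ℝ} (hinv : μ.bind (fun x => K x) = μ) (hu : MemLp u 2 μ)
    (hU : ∀ m, MemLp (U m) 2 μ)
    (hUu : Tendsto (fun m => ∫ x, (u x - U m x) ^ 2 ∂μ) atTop (𝓝 0)) (k : ℕ) :
    Tendsto (fun m => lagCov K μ (U m) (U m) k) atTop (𝓝 (lagCov K μ u u k)) := by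
  refine tendsto_integral_mul (hu.sub (memLp_const _)) (memLp_kop_iterate hinv hu k).1
    (fun m => (hU m).sub (memLp_const _)) (fun m => (memLp_kop_iterate hinv (hU m) k).1) ?_ ?_
  · exact squeeze_zero (fun m => integral_nonneg fun _ => sq_nonneg _)
      (fun m => integral_sq_centered_sub_le hu (hU m)) hUu
  · refine squeeze_zero (fun m => integral_nonneg fun _ => sq_nonneg _) (fun m => ?_) hUu
    refine le_trans (le_of_eq (integral_congr_ae ?_))
      (memLp_kop_iterate (K := K) hinv (hu.sub (hU m)) k).2
    filter_upwards [kop_iterate_sub_ae (K := K) hinv (hu.integrable one_le_two)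
      ((hU m).integrable one_le_two) k] with x hx
    rw [← hx]; rfl

lemma lintegral_sq_le_of_tendsto {U : ℕ → ℝ → ℝ} {C : ℕ → ℝ} (hu : Integrable u μ)
    (hU : ∀ m, BddMeas (U m) (C m))
    (hUu : Tendsto (fun m => ∫ x, |u x - U m x| ∂μ) atTop (𝓝 0)) {w : ℝ → ℝ} {D : ℝ}
    (hw : BddMeas w D) {s : ℝ} (hs : ∀ᶠ l in atTop, ∫ x, (U l x - w x) ^ 2 ∂μ ≤ s) :
    ∫⁻ x, ENNReal.ofReal ((u x - w x) ^ 2) ∂μ ≤ ENNReal.ofReal s := by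
  have hm : TendstoInMeasure μ U atTop u := by
    refine tendstoInMeasure_of_tendsto_eLpNorm one_ne_zero
      (fun m => (hU m).meas.aestronglyMeasurable) hu.1 ?_
    have h0 := ENNReal.tendsto_ofReal hUu
    rw [ENNReal.ofReal_zero] at h0
    refine h0.congr fun m => ?_
    have hi : Integrable (fun x => |u x - U m x|) μ := (hu.sub ((hU m).integrable μ)).abs
    rw [eLpNorm_one_eq_lintegral_enorm,
      ofReal_integral_eq_lintegral_ofReal hi (ae_of_all _ fun _ => abs_nonneg _)]
    congr 1; funext x
    rw [← Real.enorm_eq_ofReal_abs, Pi.sub_apply, ← enorm_neg, neg_sub]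
  obtain ⟨ns, hns, hae⟩ := hm.exists_seq_tendsto_ae
  calc _ = ∫⁻ x, liminf (fun j => ENNReal.ofReal ((U (ns j) x - w x) ^ 2)) atTop ∂μ := by
        refine lintegral_congr_ae ?_
        filter_upwards [hae] with x hx
        exact (ENNReal.tendsto_ofReal ((hx.sub_const _).pow 2)).liminf_eq.symm
    _ ≤ liminf (fun j => ∫⁻ x, ENNReal.ofReal ((U (ns j) x - w x) ^ 2) ∂μ) atTop :=
        lintegral_liminf_le fun j =>
          (((hU _).meas.sub hw.meas).pow_const 2).ennreal_ofReal
    _ ≤ _ := by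
        refine liminf_le_of_frequently_le' (Eventually.frequently ?_)
        filter_upwards [hns.tendsto_atTop.eventually hs] with j hj
        rw [← ofReal_integral_eq_lintegral_ofReal (((hU _).sub hw).sq.integrable μ)
          (ae_of_all _ fun _ => sq_nonneg _)]
        exact ENNReal.ofReal_le_ofReal hj

end square_integrable

section approximation

variable {Ω : Type*} [mΩ : MeasurableSpace Ω]
  {P : Measure Ω} [IsProbabilityMeasure P] {X : ℕ → Ω → ℝ}
  {μ : Measure ℝ} [IsProbabilityMeasure μ] {K : Kernel ℝ ℝ} [IsMarkovKernel K]
  {u v f : ℝ → ℝ} {C : ℝ}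

/-- The centered partial sums `∑_{i=1}^n (u(X_i) - μ(u))`. -/
def centeredSum (X : ℕ → Ω → ℝ) (μ : Measure ℝ) (u : ℝ → ℝ) (n : ℕ) (ω : Ω) : ℝ :=
  ∑ i ∈ Finset.range n, (u (X (i + 1) ω) - ∫ y, u y ∂μ)

lemma centeredSum_sub (hu : Integrable u μ) (hv : Integrable v μ) (n : ℕ) (ω : Ω) :
    centeredSum X μ (fun x => u x - v x) n ω = centeredSum X μ u n ω - centeredSum X μ v n ω := by
  unfold centeredSum
  rw [← Finset.sum_sub_distrib, integral_sub hu hv]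
  exact Finset.sum_congr rfl fun i _ => by ring

namespace StatMarkov

lemma integrable_centeredSum (hX : StatMarkov P X μ K) (hu : Integrable u μ) (n : ℕ) :
    Integrable (centeredSum X μ u n) P :=
  integrable_finsetSum _ fun i _ => (hX.integrable_comp hu (i + 1)).sub (integrable_const _)

lemma integral_abs_centeredSum_le (hX : StatMarkov P X μ K) (hu : Integrable u μ) (n : ℕ) :
    ∫ ω, |centeredSum X μ u n ω| ∂P ≤ n * (2 * ∫ x, |u x| ∂μ) := by
  have hi : ∀ i, Integrable (fun ω => |u (X (i + 1) ω)| + |∫ y, u y ∂μ|) P := fun i =>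
    (hX.integrable_comp hu (i + 1)).abs.add (integrable_const _)
  calc _ ≤ ∫ ω, ∑ i ∈ Finset.range n, (|u (X (i + 1) ω)| + |∫ y, u y ∂μ|) ∂P := by
        refine integral_mono (hX.integrable_centeredSum hu n).abs
          (integrable_finsetSum _ fun i _ => hi i) fun ω => ?_
        exact (Finset.abs_sum_le_sum_abs _ _).trans (Finset.sum_le_sum fun i _ => abs_sub _ _)
    _ = ∑ i ∈ Finset.range n, (∫ x, |u x| ∂μ + |∫ y, u y ∂μ|) := by
        rw [integral_finsetSum _ fun i _ => hi i]
        refine Finset.sum_congr rfl fun i _ => ?_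
        rw [integral_add (hX.integrable_comp hu (i + 1)).abs (integrable_const _),
          hX.integral_comp_eq (u := fun x => |u x|) hu.abs.1 (i + 1)]
        simp
    _ ≤ _ := by
        rw [Finset.sum_const, Finset.card_range, nsmul_eq_mul]
        have : |∫ y, u y ∂μ| ≤ ∫ y, |u y| ∂μ := abs_integral_le_integral_abs
        gcongr
        linarith

lemma integral_abs_centeredSum_le_sqrt (hX : StatMarkov P X μ K) (hu : BddMeas u C) (n : ℕ) :
    ∫ ω, |centeredSum X μ u n ω| ∂P ≤ √(2 * n * ∑ k ∈ Finset.range n, |lagCov K μ u u k|) := by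
  have hu0 := hu.sub (BddMeas.const (∫ y, u y ∂μ))
  have hmem : MemLp (centeredSum X μ u n) 2 P :=
    memLp_finsetSum _ fun i _ => MemLp.of_bound
      (hu0.meas.comp (hX.meas (i + 1))).aestronglyMeasurable _ (ae_of_all _ fun ω => hu0.bound _)
  exact (integral_abs_le_sqrt hmem).trans (Real.sqrt_le_sqrt (hX.integral_sq_sum_centered_le hu n))

variable {F : ℕ → ℝ → ℝ} {B : ℕ → ℝ} {r s : ℕ → ℝ}

lemma integral_abs_centeredSum_sub_le (hX : StatMarkov P X μ K) (hf : Integrable f μ)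
    (hF : ∀ m, BddMeas (F m) (B m)) (hr : Summable r)
    (hFf : Tendsto (fun m => ∫ x, |f x - F m x| ∂μ) atTop (𝓝 0))
    (hs0 : ∀ m, 0 ≤ s m) (hs : ∀ m l, m ≤ l → ∫ x, (F l x - F m x) ^ 2 ∂μ ≤ s m)
    (hd : ∀ m l k, |lagCov K μ (fun x => F l x - F m x) (fun x => F l x - F m x) k| ≤ r k)
    (m n : ℕ) :
    ∫ ω, |centeredSum X μ f n ω - centeredSum X μ (F m) n ω| ∂P ≤
      √(2 * n * ∑' k, min (r k) (s m)) := by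
  have hr0 : ∀ k, 0 ≤ r k := fun k => (abs_nonneg _).trans (hd 0 0 k)
  have hFi : ∀ m, Integrable (F m) μ := fun m => (hF m).integrable μ
  have hsum : Summable fun k => min (r k) (s m) :=
    Summable.of_nonneg_of_le (fun k => le_min (hr0 k) (hs0 m)) (fun k => min_le_left _ _) hr
  have key : ∀ᶠ l in atTop, ∫ ω, |centeredSum X μ f n ω - centeredSum X μ (F m) n ω| ∂P ≤
      n * (2 * ∫ x, |f x - F l x| ∂μ) + √(2 * n * ∑' k, min (r k) (s m)) := by
    filter_upwards [eventually_ge_atTop m] with l hl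
    have h1 := hX.integral_abs_centeredSum_le (hf.sub (hFi l)) n
    have h2 := hX.integral_abs_centeredSum_le_sqrt ((hF l).sub (hF m)) n
    have h3 : ∑ k ∈ Finset.range n,
        |lagCov K μ (fun x => F l x - F m x) (fun x => F l x - F m x) k| ≤
        ∑' k, min (r k) (s m) := by
      refine (Finset.sum_le_sum fun k _ => le_min (hd m l k) ?_).trans
        (hsum.sum_le_tsum _ fun k _ => le_min (hr0 k) (hs0 m))
      refine (abs_lagCov_le_sq hX.inv ((hF l).sub (hF m)) ((hF l).sub (hF m)) k).trans ?_
      linarith [hs m l hl]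
    have i1 := (hX.integrable_centeredSum (hf.sub (hFi l)) n).abs
    have i2 := (hX.integrable_centeredSum ((hFi l).sub (hFi m)) n).abs
    calc _ ≤ ∫ ω, (|centeredSum X μ (f - F l) n ω| + |centeredSum X μ (F l - F m) n ω|) ∂P := by
          refine integral_mono ((hX.integrable_centeredSum hf n).sub
            (hX.integrable_centeredSum (hFi m) n)).abs (i1.add i2) fun ω => ?_
          have e1 := centeredSum_sub (X := X) hf (hFi l) n ω
          have e2 := centeredSum_sub (X := X) (hFi l) (hFi m) n ω
          refine le_of_eq_of_le ?_ (abs_add_le _ _)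
          congr 1
          exact (sub_add_sub_cancel _ _ _).symm.trans (congrArg₂ _ e1.symm e2.symm)
      _ = ∫ ω, |centeredSum X μ (f - F l) n ω| ∂P + ∫ ω, |centeredSum X μ (F l - F m) n ω| ∂P :=
          integral_add i1 i2
      _ ≤ _ := add_le_add h1 (h2.trans (Real.sqrt_le_sqrt (by gcongr)))
  have hlim : Tendsto (fun l => n * (2 * ∫ x, |f x - F l x| ∂μ) + √(2 * n * ∑' k, min (r k) (s m)))
      atTop (𝓝 (√(2 * n * ∑' k, min (r k) (s m)))) := by
    have := ((hFf.const_mul 2).const_mul (n : ℝ)).add_const (√(2 * n * ∑' k, min (r k) (s m)))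
    simpa using this
  exact ge_of_tendsto hlim key

/-- Central limit theorem for limits of bounded observables with uniformly summable covariances. -/
lemma tendsto_charFun_of_approx (hX : StatMarkov P X μ K)
    (hmix : ∀ u C, BddMeas u C → Tendsto (mixc K μ u) atTop (𝓝 0)) (hf : Integrable f μ)
    (hF : ∀ m, BddMeas (F m) (B m)) (hFs : ∀ m, Summable (mixc K μ (F m))) (hr : Summable r)
    (hFf : Tendsto (fun m => ∫ x, |f x - F m x| ∂μ) atTop (𝓝 0))
    (hs : ∀ m l, m ≤ l → ∫ x, (F l x - F m x) ^ 2 ∂μ ≤ s m) (hs0 : Tendsto s atTop (𝓝 0))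
    (hc : ∀ m k, |lagCov K μ (F m) (F m) k| ≤ r k)
    (hd : ∀ m l k, |lagCov K μ (fun x => F l x - F m x) (fun x => F l x - F m x) k| ≤ r k) :
    0 ≤ asymVar K μ f ∧ ∀ t : ℝ, Tendsto (fun n : ℕ => ∫ ω, Complex.exp
      (((t * (√n)⁻¹ * centeredSum X μ f n ω : ℝ) : ℂ) * Complex.I) ∂P)
      atTop (𝓝 ((Real.exp (-(t ^ 2 / 2 * asymVar K μ f)) : ℝ) : ℂ)) := by
  have hr0 : ∀ k, 0 ≤ r k := fun k => (abs_nonneg _).trans (hc 0 k)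
  have hsn : ∀ m, 0 ≤ s m := fun m => (integral_nonneg fun _ => sq_nonneg _).trans (hs m m le_rfl)
  have hfF : ∀ m, ∫⁻ x, ENNReal.ofReal ((f x - F m x) ^ 2) ∂μ ≤ ENNReal.ofReal (s m) := fun m =>
    lintegral_sq_le_of_tendsto hf hF hFf (hF m)
      ((eventually_ge_atTop m).mono fun l hl => hs m l hl)
  have hdm : ∀ m, AEStronglyMeasurable (fun x => f x - F m x) μ := fun m =>
    (hf.sub ((hF m).integrable μ)).1
  have hmem : ∀ m, MemLp (fun x => f x - F m x) 2 μ := fun m => by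
    refine (memLp_two_iff_integrable_sq (hdm m)).mpr ⟨(hdm m).pow 2, ?_⟩
    rw [hasFiniteIntegral_iff_ofReal (ae_of_all _ fun _ => sq_nonneg _)]
    exact (hfF m).trans_lt ENNReal.ofReal_lt_top
  have hf2 : MemLp f 2 μ := by
    have := (hmem 0).add ((hF 0).memLp μ 2)
    convert this using 1
    funext x; simp
  have hL2 : Tendsto (fun m => ∫ x, (f x - F m x) ^ 2 ∂μ) atTop (𝓝 0) := by
    refine squeeze_zero (fun m => integral_nonneg fun _ => sq_nonneg _) (fun m => ?_) hs0
    rw [integral_eq_lintegral_of_nonneg_ae (ae_of_all _ fun _ => sq_nonneg _) ((hdm m).pow 2)]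
    exact ENNReal.toReal_le_of_le_ofReal (hsn m) (hfF m)
  have hlag := fun k => tendsto_lagCov (K := K) hX.inv hf2 (fun m => (hF m).memLp μ 2) hL2 k
  have hvar : Tendsto (fun m => asymVar K μ (F m)) atTop (𝓝 (asymVar K μ f)) := by
    refine Tendsto.add ?_ (Tendsto.const_mul 2 (tendsto_tsum_of_dominated_convergence
      ((summable_nat_add_iff 1).mpr hr) (fun k => hlag (k + 1))
      (Eventually.of_forall fun m k => hc m (k + 1))))
    have h := tendsto_integral_mul (hf2.sub (memLp_const (∫ y, f y ∂μ)))
      (hf2.sub (memLp_const (∫ y, f y ∂μ)))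
      (fun m => ((hF m).memLp μ 2).sub (memLp_const (∫ y, F m y ∂μ)))
      (fun m => ((hF m).memLp μ 2).sub (memLp_const (∫ y, F m y ∂μ))) ?_ ?_
    · simpa only [Pi.sub_apply, ← sq] using h
    all_goals
      exact squeeze_zero (fun m => integral_nonneg fun _ => sq_nonneg _)
        (fun m => integral_sq_centered_sub_le hf2 ((hF m).memLp μ 2)) hL2
  refine ⟨ge_of_tendsto' hvar fun m => hX.asymVar_nonneg_of_bddMeas (hF m) (hFs m), fun t => ?_⟩
  refine tendsto_of_forall_approx (fun m => hX.tendsto_charFun_of_bddMeas hmix (hF m) (hFs m) t)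
    (e := fun m => |t| * √(2 * ∑' k, min (r k) (s m))) ?_ ?_ fun m δ hδ => ?_
  · refine (Complex.continuous_ofReal.tendsto _).comp ?_
    exact (Real.continuous_exp.tendsto _).comp (hvar.const_mul (t ^ 2 / 2)).neg
  · have h := (tendsto_tsum_min hr hr0 hsn hs0).const_mul 2
    have h' := ((Real.continuous_sqrt.tendsto _).comp h).const_mul |t|
    simpa using h'
  · filter_upwards [eventually_gt_atTop 0] with n hn
    have hfi := hX.integrable_centeredSum hf n
    have hFi := hX.integrable_centeredSum ((hF m).integrable μ) n
    have h := norm_integral_exp_sub_le (hfi.const_mul (t * (√n)⁻¹)).1.aemeasurable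
      (hFi.const_mul (t * (√n)⁻¹)).1.aemeasurable ((hfi.const_mul _).sub (hFi.const_mul _))
    rw [dist_eq_norm]
    refine h.trans (le_trans ?_ (le_add_of_nonneg_right hδ.le))
    simp only [← mul_sub, abs_mul]
    rw [integral_const_mul, mul_assoc]
    gcongr
    have hn' : 0 < √(n : ℝ) := Real.sqrt_pos.mpr (by exact_mod_cast hn)
    rw [abs_of_nonneg (inv_nonneg.mpr hn'.le), inv_mul_le_iff₀ hn',
      ← Real.sqrt_mul (Nat.cast_nonneg n)]
    refine (hX.integral_abs_centeredSum_sub_le hf hF hr hFf hsn hs hd m n).trans_eq ?_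
    congr 1; ring

end StatMarkov

end approximation

section monotone

variable {μ : Measure ℝ} [IsProbabilityMeasure μ] {g : ℝ → ℝ} {M : ℝ} {p : ℝ≥0∞}

lemma levelConnected_of_monotoneOn_or_antitoneOn {I : Set ℝ} (hI : I.OrdConnected)
    (hg : MonotoneOn g I ∨ AntitoneOn g I) (h0 : ∀ x ∉ I, g x = 0) : LevelConnected g := by
  intro s hs
  have hsub : ∀ x, s ≤ g x → x ∈ I := fun x hx => by
    by_contra h
    rw [h0 x h] at hx
    linarith
  refine ⟨fun x hx y hy z hz => ?_⟩
  have hzI := hI.out (hsub x hx) (hsub y hy) hz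
  rcases hg with hg | hg
  · exact le_trans hx (hg (hsub x hx) hzI hz.1)
  · exact le_trans hy (hg hzI (hsub y hy) hz.2)

lemma Mon.levelConnected (hg : Mon M p μ g) :
    LevelConnected g ∧ LevelConnected fun x => -g x := by
  obtain ⟨⟨I, -, hI, hm, h0⟩, -⟩ := hg
  refine ⟨levelConnected_of_monotoneOn_or_antitoneOn hI hm h0,
    levelConnected_of_monotoneOn_or_antitoneOn hI ?_ fun x hx => by simp [h0 x hx]⟩
  rcases hm with hm | hm
  · exact Or.inr hm.neg
  · exact Or.inl hm.neg

lemma Mon.tailMon_top (hM : 0 < M) (hg : Mon M ∞ μ g) :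
    TailMon μ (fun τ => if M ≤ τ then 0 else M ^ 2) g := by
  obtain ⟨h1, h2⟩ := hg.levelConnected
  refine ⟨h1, h2, fun τ hτ => ?_, fun τ => by split_ifs <;> positivity⟩
  have hle : ∀ᵐ x ∂μ, |g x| ≤ M := by
    have := hg.2
    rw [if_pos rfl] at this
    rw [ae_iff]
    simpa using this
  calc _ ≤ ∫⁻ _, ENNReal.ofReal (if M ≤ τ then 0 else M ^ 2) ∂μ := by
        refine lintegral_mono_ae ?_
        filter_upwards [hle] with x hx
        refine ENNReal.ofReal_le_ofReal ?_
        split_ifs with h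
        · rw [excess, max_eq_right (by linarith)]; simp
        · refine pow_le_pow_left₀ (excess_nonneg _ _) (max_le (by linarith) hM.le) 2
    _ = _ := by simp

lemma lintegral_Ioi_add_rpow {q τ : ℝ} (hq : 2 < q) (hτ : 0 < τ) :
    ∫⁻ t in Ioi (0 : ℝ), ENNReal.ofReal ((t + τ) ^ (1 - q)) =
      ENNReal.ofReal (τ ^ (2 - q) / (q - 2)) := by
  have hInt : IntegrableOn (fun t : ℝ => (t + τ) ^ (1 - q)) (Ioi 0) :=
    integrableOn_add_rpow_Ioi_of_lt (by linarith) (by linarith)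
  have h := (measurePreserving_add_right (volume : Measure ℝ) τ).setIntegral_preimage_emb
    (measurableEmbedding_addRight τ) (fun t : ℝ => t ^ (1 - q)) (Ioi τ)
  rw [preimage_add_const_Ioi, sub_self, integral_Ioi_rpow_of_lt (by linarith) hτ] at h
  rw [← ofReal_integral_eq_lintegral_ofReal hInt, h]
  · congr 1
    rw [show 1 - q + 1 = 2 - q by ring, neg_div, ← div_neg, neg_sub]
  · refine (ae_restrict_iff' measurableSet_Ioi).mpr (ae_of_all _ fun t ht => ?_)
    have : 0 < t := ht
    positivity

lemma Mon.tailMon_of_ne_top (hM : 0 < M) (hp : 2 < p) (hp' : p ≠ ∞) (hg : Mon M p μ g) :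
    TailMon μ (fun τ => 2 * M ^ p.toReal / (p.toReal - 2) * |τ| ^ (2 - p.toReal)) g := by
  obtain ⟨h1, h2⟩ := hg.levelConnected
  have hgm : Measurable g := h1.measurable h2
  have ht := hg.2
  rw [if_neg hp'] at ht
  set q := p.toReal with hqdef
  have hq : 2 < q := by
    have := (ENNReal.toReal_lt_toReal (by simp) hp').mpr hp
    simpa using this
  have hq0 : 0 < q - 2 := by linarith
  refine ⟨h1, h2, fun τ hτ => ?_, fun τ => by positivity⟩
  have hm : Measurable fun x => excess τ (g x) := (hgm.abs.sub_const τ).max measurable_const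
  have hl := lintegral_rpow_eq_lintegral_meas_lt_mul μ
    (f := fun x => excess τ (g x)) (ae_of_all _ fun _ => excess_nonneg _ _) hm.aemeasurable
    two_pos
  simp only [Real.rpow_two] at hl
  rw [hl]
  calc _ ≤ ENNReal.ofReal 2 * ∫⁻ t in Ioi (0 : ℝ),
        ENNReal.ofReal (M ^ q) * ENNReal.ofReal ((t + τ) ^ (1 - q)) := by
        gcongr ENNReal.ofReal 2 * ?_
        refine setLIntegral_mono' measurableSet_Ioi fun t (h0 : 0 < t) => ?_
        have hsub : {x | t < excess τ (g x)} ⊆ {x | t + τ < |g x|} := fun x hx => by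
          have hx' : t < max (|g x| - τ) 0 := hx
          rcases lt_max_iff.mp hx' with h | h
          · exact lt_sub_iff_add_lt.mp h
          · exact absurd h h0.not_gt
        calc _ ≤ ENNReal.ofReal (M ^ q * (t + τ) ^ (-q)) * ENNReal.ofReal (t + τ) := by
              gcongr
              · exact (measure_mono hsub).trans (ht _ (by positivity))
              · norm_num
                exact hτ.le
          _ = _ := by
              rw [← ENNReal.ofReal_mul (by positivity), ← ENNReal.ofReal_mul (by positivity),
                mul_assoc, ← Real.rpow_add_one (by positivity), neg_add_eq_sub]
    _ = ENNReal.ofReal (2 * (M ^ q * (τ ^ (2 - q) / (q - 2)))) := by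
        rw [lintegral_const_mul' _ _ ENNReal.ofReal_ne_top, lintegral_Ioi_add_rpow hq hτ,
          ← ENNReal.ofReal_mul (by positivity), ← ENNReal.ofReal_mul (by positivity)]
    _ = _ := by
        rw [abs_of_pos hτ]; congr 1; ring

/-- Uniform control of the tails over `Mon(M,p,μ)`, together with the optimal truncation level at
mixing rate `x`. -/
lemma exists_tail_control (μ : Measure ℝ) [IsProbabilityMeasure μ] (hM : 0 < M) (hp : 2 < p) :
    ∃ (θ : ℝ → ℝ) (D : ℝ), (∀ g, Mon M p μ g → TailMon μ θ g) ∧ Tendsto θ atTop (𝓝 0) ∧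
      ∀ x ≥ 0, ∀ δ > 0, ∃ τ > 0, 4 * τ ^ 2 * x + 8 * θ (τ / 2) + θ τ ≤
        D * x ^ (((1 : ℝ≥0∞) - 2 / p).toReal) + δ := by
  by_cases hp' : p = ∞
  · subst hp'
    refine ⟨fun τ => if M ≤ τ then 0 else M ^ 2, 16 * M ^ 2, fun g hg => hg.tailMon_top hM, ?_,
      fun x hx δ hδ => ⟨2 * M, by positivity, ?_⟩⟩
    · refine tendsto_const_nhds.congr' ?_
      filter_upwards [eventually_ge_atTop M] with τ hτ
      rw [if_pos hτ]
    · have h1 : M ≤ 2 * M / 2 := by linarith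
      have h2 : M ≤ 2 * M := by linarith
      simp only [if_pos h1, if_pos h2]
      simp only [ENNReal.div_top, tsub_zero, ENNReal.toReal_one, Real.rpow_one]
      linarith
  · set q := p.toReal with hqdef
    have hq : 2 < q := by
      have := (ENNReal.toReal_lt_toReal (by simp) hp').mpr hp
      simpa using this
    have hq0 : 0 < q - 2 := by linarith
    have he : ((1 : ℝ≥0∞) - 2 / p).toReal = 1 - 2 / q := by
      rw [ENNReal.toReal_sub_of_le _ ENNReal.one_ne_top, ENNReal.toReal_div]
      · simp [hqdef]
      · exact ENNReal.div_le_of_le_mul (by rw [one_mul]; exact hp.le)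
    set c := 2 * M ^ q / (q - 2) with hc
    have hc0 : 0 ≤ c := by positivity
    have hθ : Tendsto (fun τ : ℝ => c * |τ| ^ (2 - q)) atTop (𝓝 0) := by
      have h := (tendsto_rpow_neg_atTop hq0).comp tendsto_abs_atTop_atTop
      simpa [Function.comp_def] using h.const_mul c
    refine ⟨_, 4 + 8 * c * 2 ^ (q - 2) + c, fun g hg => hg.tailMon_of_ne_top hM hp hp', hθ,
      fun x hx δ hδ => ?_⟩
    rw [he]
    rcases hx.eq_or_lt with rfl | hx
    · have h2 : Tendsto (fun τ : ℝ => 8 * (c * |τ / 2| ^ (2 - q)) + c * |τ| ^ (2 - q)) atTop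
          (𝓝 0) := by
        simpa using ((hθ.comp (tendsto_id.atTop_div_const two_pos)).const_mul 8).add hθ
      obtain ⟨τ, hτ, hτ0⟩ := ((h2.eventually_lt_const hδ).and (eventually_gt_atTop 0)).exists
      refine ⟨τ, hτ0, ?_⟩
      rw [Real.zero_rpow (by
        have : 2 / q < 1 := (div_lt_one (by linarith)).mpr hq
        linarith)]
      linarith
    · refine ⟨x ^ (-(1 / q)), by positivity, ?_⟩
      have e1 : (x ^ (-(1 / q))) ^ 2 * x = x ^ (1 - 2 / q) := by
        rw [← Real.rpow_natCast, ← Real.rpow_mul hx.le, ← Real.rpow_add_one hx.ne']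
        congr 1; push_cast; ring
      have e2 : (x ^ (-(1 / q))) ^ (2 - q) = x ^ (1 - 2 / q) := by
        rw [← Real.rpow_mul hx.le]
        congr 1; field_simp; ring
      have e3 : (x ^ (-(1 / q)) / 2) ^ (2 - q) = 2 ^ (q - 2) * x ^ (1 - 2 / q) := by
        rw [Real.div_rpow (by positivity) (by positivity), e2, ← neg_sub q 2,
          Real.rpow_neg (by positivity), div_inv_eq_mul, mul_comm]
      rw [abs_of_pos (by positivity), abs_of_pos (by positivity), e2, e3, mul_assoc, e1]
      linarith

end monotone

section combinations

variable {μ : Measure ℝ} [IsProbabilityMeasure μ] {K : Kernel ℝ ℝ} [IsMarkovKernel K]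
  {U V : ℝ → ℝ} {θ : ℝ → ℝ} {k : ℕ} {α C D : ℝ}

lemma sq_sum_mul_le {ι : Type*} (s : Finset ι) (a e : ι → ℝ) (ha : ∑ i ∈ s, |a i| ≤ 1) :
    (∑ i ∈ s, |a i| * e i) ^ 2 ≤ ∑ i ∈ s, |a i| * e i ^ 2 := by
  have h0 : ∀ i ∈ s, 0 ≤ |a i| * e i ^ 2 := fun i _ => by positivity
  have h := Finset.sum_sq_le_sum_mul_sum_of_sq_le_mul s (r := fun i => |a i| * e i)
    (f := fun i => |a i|) (g := fun i => |a i| * e i ^ 2) (fun i _ => abs_nonneg _) h0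
    (fun i _ => le_of_eq (by ring))
  exact h.trans (mul_le_of_le_one_left (Finset.sum_nonneg h0) ha)

/-- Subconvex combinations of truncations, at a common level, of functions with intervals as level
sets and tails controlled by `θ`. -/
def ClippedCombo (μ : Measure ℝ) (θ : ℝ → ℝ) (U : ℝ → ℝ) : Prop :=
  ∃ (n : ℕ) (a : Fin n → ℝ) (g : Fin n → ℝ → ℝ) (σ : ℝ), ∑ i, |a i| ≤ 1 ∧
    (∀ i, TailMon μ θ (g i)) ∧ 0 < σ ∧ U = fun x => ∑ i, a i * clip σ (g i x)

lemma bddMeas_clippedCombo {n : ℕ} {a : Fin n → ℝ} {g : Fin n → ℝ → ℝ} {σ : ℝ}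
    (ha : ∑ i, |a i| ≤ 1) (hg : ∀ i, TailMon μ θ (g i)) (hσ : 0 < σ) :
    BddMeas (fun x => ∑ i, a i * clip σ (g i x)) σ := by
  have h := BddMeas.sum Finset.univ fun i _ => ((hg i).bddMeas_clip hσ).const_mul (a i)
  refine ⟨h.meas, fun x => (h.bound x).trans ?_⟩
  rw [← Finset.sum_mul]
  exact mul_le_of_le_one_left hσ.le ha

lemma integral_sum_excess_le {n : ℕ} {a : Fin n → ℝ} {g : Fin n → ℝ → ℝ} {τ : ℝ}
    (ha : ∑ i, |a i| ≤ 1) (hg : ∀ i, TailMon μ θ (g i)) (h0 : 0 ≤ θ (τ / 2)) (hτ : 0 < τ) :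
    Integrable (fun x => ∑ i, |a i| * excess τ (g i x)) μ ∧
      ∫ x, ∑ i, |a i| * excess τ (g i x) ∂μ ≤ 2 / τ * θ (τ / 2) := by
  have hi : ∀ i, Integrable (fun x => |a i| * excess τ (g i x)) μ := fun i =>
    ((hg i).integrable_excess hτ).const_mul _
  refine ⟨integrable_finsetSum _ fun i _ => hi i, ?_⟩
  rw [integral_finsetSum _ fun i _ => hi i]
  calc _ ≤ ∑ i, |a i| * (2 / τ * θ (τ / 2)) := by
        refine Finset.sum_le_sum fun i _ => ?_
        rw [integral_const_mul]
        exact mul_le_mul_of_nonneg_left ((hg i).integral_excess_le hτ) (abs_nonneg _)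
    _ ≤ _ := by
        rw [← Finset.sum_mul]
        exact mul_le_of_le_one_left (by positivity) ha

lemma integral_sq_sum_excess_le {n : ℕ} {a : Fin n → ℝ} {g : Fin n → ℝ → ℝ} {τ : ℝ}
    (ha : ∑ i, |a i| ≤ 1) (hg : ∀ i, TailMon μ θ (g i)) (h0 : 0 ≤ θ τ) (hτ : 0 < τ) :
    Integrable (fun x => ∑ i, |a i| * excess τ (g i x) ^ 2) μ ∧
      ∫ x, ∑ i, |a i| * excess τ (g i x) ^ 2 ∂μ ≤ θ τ := by
  have hi : ∀ i, Integrable (fun x => |a i| * excess τ (g i x) ^ 2) μ := fun i =>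
    ((hg i).integrable_sq_excess hτ).const_mul _
  refine ⟨integrable_finsetSum _ fun i _ => hi i, ?_⟩
  rw [integral_finsetSum _ fun i _ => hi i]
  calc _ ≤ ∑ i, |a i| * θ τ := by
        refine Finset.sum_le_sum fun i _ => ?_
        rw [integral_const_mul]
        exact mul_le_mul_of_nonneg_left ((hg i).integral_sq_excess_le hτ) (abs_nonneg _)
    _ ≤ _ := by
        rw [← Finset.sum_mul]
        exact mul_le_of_le_one_left h0 ha

namespace ClippedCombo

lemma exists_bddMeas (hU : ClippedCombo μ θ U) : ∃ C, BddMeas U C := by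
  obtain ⟨n, a, g, σ, ha, hg, hσ, rfl⟩ := hU
  exact ⟨σ, bddMeas_clippedCombo ha hg hσ⟩

lemma exists_bddMeas_near (hU : ClippedCombo μ θ U) (h0 : ∀ τ, 0 ≤ θ τ) {τ : ℝ} (hτ : 0 < τ) :
    ∃ V, BddMeas V τ ∧ ∫ x, |U x - V x| ∂μ ≤ 2 / τ * θ (τ / 2) ∧
      ∫ x, (U x - V x) ^ 2 ∂μ ≤ θ τ := by
  obtain ⟨n, a, g, σ, ha, hg, hσ, rfl⟩ := hU
  have hm : 0 < min σ τ := lt_min hσ hτ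
  have hV := bddMeas_clippedCombo ha hg hm
  have hle : ∀ x, |∑ i, a i * clip σ (g i x) - ∑ i, a i * clip (min σ τ) (g i x)| ≤
      ∑ i, |a i| * excess τ (g i x) := fun x => by
    rw [← Finset.sum_sub_distrib]
    refine (Finset.abs_sum_le_sum_abs _ _).trans (Finset.sum_le_sum fun i _ => ?_)
    rw [← mul_sub, abs_mul]
    exact mul_le_mul_of_nonneg_left (abs_clip_sub_clip_le hσ.le hτ.le _) (abs_nonneg _)
  refine ⟨_, ⟨hV.meas, fun x => (hV.bound x).trans (min_le_right _ _)⟩, ?_, ?_⟩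
  · obtain ⟨hi, h⟩ := integral_sum_excess_le ha hg (h0 (τ / 2)) hτ
    exact (integral_mono_of_nonneg (ae_of_all _ fun _ => abs_nonneg _) hi
      (ae_of_all _ hle)).trans h
  · obtain ⟨hi, h⟩ := integral_sq_sum_excess_le ha hg (h0 τ) hτ
    refine (integral_mono_of_nonneg (ae_of_all _ fun _ => sq_nonneg _) hi
      (ae_of_all _ fun x => ?_)).trans h
    dsimp only
    rw [← sq_abs]
    exact (pow_le_pow_left₀ (abs_nonneg _) (hle x) 2).trans (sq_sum_mul_le _ _ _ ha)

lemma integral_sq_sub_le (hU : ClippedCombo μ θ U) (hV : ClippedCombo μ θ V)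
    (h0 : ∀ τ, 0 ≤ θ τ) {τ : ℝ} (hτ : 0 < τ) :
    ∫ x, (U x - V x) ^ 2 ∂μ ≤ 4 * τ * ∫ x, |U x - V x| ∂μ + 16 * θ (τ / 2) + 8 * θ τ := by
  obtain ⟨C, hUb⟩ := hU.exists_bddMeas
  obtain ⟨D, hVb⟩ := hV.exists_bddMeas
  obtain ⟨U', hU', hU1, hU2⟩ := hU.exists_bddMeas_near h0 hτ
  obtain ⟨V', hV', hV1, hV2⟩ := hV.exists_bddMeas_near h0 hτ
  have hu := hUb.sub hU'
  have hv := hVb.sub hV'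
  have i1 : Integrable (fun x => 4 * (U x - U' x) ^ 2) μ := (hu.sq.integrable μ).const_mul 4
  have i2 : Integrable (fun x => 4 * (V x - V' x) ^ 2) μ := (hv.sq.integrable μ).const_mul 4
  have j0 : Integrable (fun x => |U x - V x|) μ := ((hUb.sub hVb).integrable μ).abs
  have j1 : Integrable (fun x => |U x - U' x|) μ := (hu.integrable μ).abs
  have j2 : Integrable (fun x => |V x - V' x|) μ := (hv.integrable μ).abs
  have j01 : Integrable (fun x => |U x - V x| + |U x - U' x|) μ := j0.add j1
  have j012 : Integrable (fun x => |U x - V x| + |U x - U' x| + |V x - V' x|) μ := j01.add j2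
  have i3 : Integrable (fun x => 4 * τ * (|U x - V x| + |U x - U' x| + |V x - V' x|)) μ :=
    j012.const_mul _
  have i12 : Integrable (fun x => 4 * (U x - U' x) ^ 2 + 4 * (V x - V' x) ^ 2) μ := i1.add i2
  calc _ ≤ ∫ x, (4 * (U x - U' x) ^ 2 + 4 * (V x - V' x) ^ 2 +
        4 * τ * (|U x - V x| + |U x - U' x| + |V x - V' x|)) ∂μ := by
        refine integral_mono ((hUb.sub hVb).sq.integrable μ) (i12.add i3) fun x => ?_
        dsimp only
        have h1 := (abs_sub (U' x) (V' x)).trans (add_le_add (hU'.bound x) (hV'.bound x))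
        have h2 : |U' x - V' x| ≤ |U x - V x| + |U x - U' x| + |V x - V' x| := by
          have := abs_add_le (U x - V x) (V x - V' x - (U x - U' x))
          have := abs_sub (V x - V' x) (U x - U' x)
          have e : U' x - V' x = U x - V x + (V x - V' x - (U x - U' x)) := by ring
          rw [e]; linarith
        have h3 : (U' x - V' x) ^ 2 ≤
            2 * τ * (|U x - V x| + |U x - U' x| + |V x - V' x|) := by
          rw [← sq_abs, sq]
          refine mul_le_mul (by linarith) h2 (abs_nonneg _) (by positivity)
        nlinarith [sq_nonneg ((U x - U' x) - (V x - V' x) - (U' x - V' x)),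
          sq_nonneg ((U x - U' x) + (V x - V' x))]
    _ = 4 * ∫ x, (U x - U' x) ^ 2 ∂μ + 4 * ∫ x, (V x - V' x) ^ 2 ∂μ +
        4 * τ * (∫ x, |U x - V x| ∂μ + ∫ x, |U x - U' x| ∂μ + ∫ x, |V x - V' x| ∂μ) := by
        rw [integral_add i12 i3, integral_add i1 i2, integral_const_mul, integral_const_mul,
          integral_const_mul, integral_add j01 j2, integral_add j0 j1]
    _ ≤ 4 * θ τ + 4 * θ τ + 4 * τ * (∫ x, |U x - V x| ∂μ + 2 / τ * θ (τ / 2) +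
        2 / τ * θ (τ / 2)) := by gcongr
    _ = _ := by field_simp; ring

lemma mixc_le (hinv : μ.bind (fun x => K x) = μ) (hU : ClippedCombo μ θ U) :
    ∃ C, ∀ k α, (∀ t, mixc K μ (indic t) k ≤ α) → mixc K μ U k ≤ C * α := by
  obtain ⟨n, a, g, σ, ha, hg, hσ, rfl⟩ := hU
  refine ⟨4 * σ, fun k α hα => ?_⟩
  have hα0 : 0 ≤ α := (mixc_nonneg _ _).trans (hα 0)
  refine (mixc_sum_le Finset.univ (fun i _ => ((hg i).bddMeas_clip hσ).const_mul (a i)) k).trans ?_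
  calc _ ≤ ∑ i, |a i| * (4 * σ * α) := by
        refine Finset.sum_le_sum fun i _ => ?_
        rw [mixc_const_mul]
        exact mul_le_mul_of_nonneg_left ((hg i).mixc_clip_le hinv hα hσ) (abs_nonneg _)
    _ ≤ _ := by
        rw [← Finset.sum_mul]
        exact mul_le_of_le_one_left (by positivity) ha

lemma abs_lagCov_le (hinv : μ.bind (fun x => K x) = μ) (hα : ∀ t, mixc K μ (indic t) k ≤ α)
    (h0 : ∀ τ, 0 ≤ θ τ) (hU : ClippedCombo μ θ U) (hV : ClippedCombo μ θ V)
    {τ : ℝ} (hτ : 0 < τ) :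
    |lagCov K μ U V k| ≤ 4 * τ ^ 2 * α + 8 * θ (τ / 2) + θ τ := by
  have hα0 : 0 ≤ α := (mixc_nonneg _ _).trans (hα 0)
  have := h0 τ
  have := h0 (τ / 2)
  have hr : 0 ≤ 4 * τ ^ 2 * α + 8 * θ (τ / 2) + θ τ := by positivity
  obtain ⟨D, hVb⟩ := hV.exists_bddMeas
  obtain ⟨n, a, g, σ, ha, hg, hσ, rfl⟩ := hU
  refine (abs_lagCov_sum_left_le Finset.univ (fun i => (hg i).bddMeas_clip hσ) hVb
    fun i => ?_).trans (mul_le_of_le_one_left hr ha)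
  obtain ⟨n', a', g', σ', ha', hg', hσ', rfl⟩ := hV
  refine (abs_lagCov_sum_right_le Finset.univ (fun i => (hg' i).bddMeas_clip hσ')
    ((hg i).bddMeas_clip hσ) fun j => ?_).trans (mul_le_of_le_one_left hr ha')
  exact (hg i).abs_lagCov_clip_le hinv hα (hg' j) hσ hσ' hτ

end ClippedCombo

lemma abs_lagCov_sub_le {r : ℝ} (hU : BddMeas U C) (hV : BddMeas V D)
    (h1 : |lagCov K μ U U k| ≤ r) (h2 : |lagCov K μ U V k| ≤ r) (h3 : |lagCov K μ V U k| ≤ r)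
    (h4 : |lagCov K μ V V k| ≤ r) :
    |lagCov K μ (fun x => U x - V x) (fun x => U x - V x) k| ≤ 4 * r := by
  have hV' := hV.const_mul (-1)
  have hd := hU.add hV'
  have e : (fun x => U x - V x) = fun x => U x + -1 * V x := by funext x; ring
  rw [e, lagCov_add_left hU hV' hd, lagCov_add_right hU hV' hU, lagCov_add_right hU hV' hV',
    lagCov_const_mul_left, lagCov_const_mul_left, lagCov_const_mul_right, lagCov_const_mul_right]
  rw [abs_le] at *
  constructor <;> linarith

end combinations

section mixing

variable {μ : Measure ℝ} [IsProbabilityMeasure μ] {K : Kernel ℝ ℝ} [IsMarkovKernel K]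

lemma mixc_indic_le_two (hinv : μ.bind (fun x => K x) = μ) (t : ℝ) (k : ℕ) :
    mixc K μ (indic t) k ≤ 2 := by
  have hb := bddMeas_indic t
  refine (mixc_le_two_mul hinv (hb.integrable μ) k).trans ?_
  have : ∫ x, |indic t x| ∂μ ≤ ∫ _, (1 : ℝ) ∂μ :=
    integral_mono (hb.integrable μ).abs (integrable_const _) hb.bound
  simp only [integral_const, probReal_univ, smul_eq_mul, mul_one] at this
  linarith

lemma mixc_indic_le_alpha1 (hinv : μ.bind (fun x => K x) = μ) (k : ℕ) (t : ℝ) :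
    mixc K μ (indic t) k ≤ alpha1 (Kop K) μ k :=
  le_ciSup (f := fun t => mixc K μ (indic t) k)
    ⟨2, by rintro _ ⟨t, rfl⟩; exact mixc_indic_le_two hinv t k⟩ t

lemma alpha1_nonneg (hinv : μ.bind (fun x => K x) = μ) (k : ℕ) : 0 ≤ alpha1 (Kop K) μ k :=
  (mixc_nonneg _ _).trans (mixc_indic_le_alpha1 hinv k 0)

lemma alpha1_le_two (hinv : μ.bind (fun x => K x) = μ) (k : ℕ) : alpha1 (Kop K) μ k ≤ 2 :=
  ciSup_le fun t => mixc_indic_le_two hinv t k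

lemma le_two_mul_rpow {x e : ℝ} (h0 : 0 ≤ x) (h2 : x ≤ 2) (he0 : 0 ≤ e) (he : e ≤ 1) :
    x ≤ 2 * x ^ e := by
  rcases le_total x 1 with h1 | h1
  · have h := Real.rpow_le_rpow_of_exponent_ge' h0 h1 he0 he
    rw [Real.rpow_one] at h
    have := Real.rpow_nonneg h0 e
    linarith
  · have := Real.one_le_rpow h1 he0
    linarith

lemma summable_alpha1 (hinv : μ.bind (fun x => K x) = μ) {e : ℝ} (he0 : 0 ≤ e) (he : e ≤ 1)
    (hsum : Summable fun k : ℕ => alpha1 (Kop K) μ (k + 1) ^ e) :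
    Summable fun k => alpha1 (Kop K) μ k :=
  (summable_nat_add_iff 1).mp <| (hsum.mul_left 2).of_nonneg_of_le (fun _ => alpha1_nonneg hinv _)
    fun _ => le_two_mul_rpow (alpha1_nonneg hinv _) (alpha1_le_two hinv _) he0 he

lemma tendsto_mixc_of_tendsto_alpha1 (hinv : μ.bind (fun x => K x) = μ)
    (h : Tendsto (fun k => alpha1 (Kop K) μ k) atTop (𝓝 0)) {u : ℝ → ℝ} {C : ℝ}
    (hu : BddMeas u C) : Tendsto (mixc K μ u) atTop (𝓝 0) :=
  tendsto_mixc hinv (fun t => squeeze_zero (fun _ => mixc_nonneg _ _)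
    (fun k => mixc_indic_le_alpha1 hinv k t) h) hu

end mixing

section approximants

variable {μ : Measure ℝ} [IsProbabilityMeasure μ] {θ : ℝ → ℝ} {f : ℝ → ℝ} {M : ℝ} {p : ℝ≥0∞}

lemma TailMon.integrable_sub_clip {g : ℝ → ℝ} (hg : TailMon μ θ g) {τ : ℝ} (hτ : 0 < τ) :
    Integrable (fun x => g x - clip τ (g x)) μ :=
  (hg.integrable_excess hτ).mono'
    (hg.measurable.sub (hg.bddMeas_clip hτ).meas).aestronglyMeasurable
    (ae_of_all _ fun _ => abs_sub_clip_le hτ.le _)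

lemma TailMon.integrable {g : ℝ → ℝ} (hg : TailMon μ θ g) : Integrable g μ := by
  have h := (hg.integrable_sub_clip one_pos).add ((hg.bddMeas_clip one_pos).integrable μ)
  refine h.congr (ae_of_all _ fun x => ?_)
  simp

lemma Mon.zero (hM : 0 < M) : Mon M p μ fun _ => 0 := by
  refine ⟨⟨∅, isOpen_empty, ordConnected_empty, Or.inl fun x hx => hx.elim, fun _ _ => rfl⟩, ?_⟩
  split_ifs
  · simp [hM.le.not_gt]
  · intro t ht
    simp [ht.le.not_gt]

lemma ClassC.exists_clippedCombo (hf : ClassC M p μ f) (hθ : ∀ g, Mon M p μ g → TailMon μ θ g)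
    (h0 : ∀ τ, 0 ≤ θ τ) (hlim : Tendsto θ atTop (𝓝 0)) {ε : ℝ} (hε : 0 < ε) :
    ∃ U, ClippedCombo μ θ U ∧ ∫ x, |f x - U x| ∂μ ≤ ε := by
  obtain ⟨n, a, g, ha, hg, hfg⟩ := hf.2 (ε / 2) (half_pos hε)
  have hg' := fun i => hθ _ (hg i)
  have hl : Tendsto (fun σ : ℝ => 2 / σ * θ (σ / 2)) atTop (𝓝 0) := by
    simpa using (tendsto_const_nhds.div_atTop tendsto_id).mul
      (hlim.comp (tendsto_id.atTop_div_const two_pos))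
  obtain ⟨σ, hσ, hσ0⟩ := ((hl.eventually_lt_const (half_pos hε)).and
    (eventually_gt_atTop 0)).exists
  refine ⟨_, ⟨n, a, g, σ, ha, hg', hσ0, rfl⟩, ?_⟩
  obtain ⟨hi, hle⟩ := integral_sum_excess_le ha hg' (h0 (σ / 2)) hσ0
  have hc : Integrable (fun x => ∑ i, a i * g i x) μ :=
    integrable_finsetSum _ fun i _ => (hg' i).integrable.const_mul _
  have hfc : Integrable (fun x => |f x - ∑ i, a i * g i x|) μ := (hf.1.sub hc).abs
  calc _ ≤ ∫ x, (|f x - ∑ i, a i * g i x| + ∑ i, |a i| * excess σ (g i x)) ∂μ := by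
        refine integral_mono_of_nonneg (ae_of_all _ fun _ => abs_nonneg _) (hfc.add hi)
          (ae_of_all _ fun x => ?_)
        refine (abs_sub_le _ (∑ i, a i * g i x) _).trans (add_le_add le_rfl ?_)
        rw [← Finset.sum_sub_distrib]
        refine (Finset.abs_sum_le_sum_abs _ _).trans (Finset.sum_le_sum fun i _ => ?_)
        rw [← mul_sub, abs_mul]
        exact mul_le_mul_of_nonneg_left (abs_sub_clip_le hσ0.le _) (abs_nonneg _)
    _ ≤ ε := by rw [integral_add hfc hi]; linarith

lemma tendsto_sqrt_mul_add_tail (hlim : Tendsto θ atTop (𝓝 0)) :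
    Tendsto (fun m : ℕ => 4 * √((m : ℝ) + 1) * (2 / ((m : ℝ) + 1)) +
      16 * θ (√((m : ℝ) + 1) / 2) + 8 * θ (√((m : ℝ) + 1))) atTop (𝓝 0) := by
  have hs : Tendsto (fun m : ℕ => √((m : ℝ) + 1)) atTop atTop :=
    Real.tendsto_sqrt_atTop.comp (tendsto_atTop_add_const_right _ _ tendsto_natCast_atTop_atTop)
  have h1 : Tendsto (fun m : ℕ => 8 * (√((m : ℝ) + 1))⁻¹) atTop (𝓝 0) := by
    simpa using (tendsto_inv_atTop_zero.comp hs).const_mul 8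
  have h2 := ((hlim.comp (hs.atTop_div_const two_pos)).const_mul 16)
  have h3 := (hlim.comp hs).const_mul 8
  have h := (h1.add h2).add h3
  simp only [mul_zero, add_zero] at h
  refine h.congr fun m => ?_
  have hp : 0 < √((m : ℝ) + 1) := by positivity
  have hq := Real.sq_sqrt (show (0 : ℝ) ≤ (m : ℝ) + 1 by positivity)
  have e : 8 * (√((m : ℝ) + 1))⁻¹ = 4 * √((m : ℝ) + 1) * (2 / ((m : ℝ) + 1)) := by
    rw [← hq, Real.sqrt_sq hp.le]
    field_simp
    norm_num
  rw [e]; rfl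

lemma integral_abs_sub_le_of_approx {U V : ℝ → ℝ} {C D a b : ℝ} (hf : Integrable f μ)
    (hU : BddMeas U C) (hV : BddMeas V D) (ha : ∫ x, |f x - U x| ∂μ ≤ a)
    (hb : ∫ x, |f x - V x| ∂μ ≤ b) : ∫ x, |U x - V x| ∂μ ≤ a + b := by
  have i1 : Integrable (fun x => |f x - U x|) μ := (hf.sub (hU.integrable μ)).abs
  have i2 : Integrable (fun x => |f x - V x|) μ := (hf.sub (hV.integrable μ)).abs
  calc _ ≤ ∫ x, (|f x - U x| + |f x - V x|) ∂μ := by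
        refine integral_mono ((hU.sub hV).integrable μ).abs (i1.add i2) fun x => ?_
        dsimp only
        rw [abs_sub_comm (f x) (U x)]
        exact abs_sub_le _ _ _
    _ ≤ _ := by rw [integral_add i1 i2]; gcongr

end approximants

section main

variable {Ω : Type*} [mΩ : MeasurableSpace Ω]
  {P : Measure Ω} [IsProbabilityMeasure P] {X : ℕ → Ω → ℝ}
  {μ : Measure ℝ} [IsProbabilityMeasure μ] {K : Kernel ℝ ℝ} [IsMarkovKernel K]
  {f : ℝ → ℝ} {M : ℝ} {p : ℝ≥0∞}

lemma StatMarkov.tendsto_charFun_of_classC (hX : StatMarkov P X μ K) (hM : 0 < M) (hp : 2 < p)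
    (hf : ClassC M p μ f) (hsum : Summable fun k : ℕ =>
      (alpha1 (Kop K) μ (k + 1)) ^ (((1:ℝ≥0∞) - 2 / p).toReal)) :
    0 ≤ asymVar K μ f ∧ ∀ t : ℝ, Tendsto (fun n : ℕ => ∫ ω, Complex.exp
      (((t * (√n)⁻¹ * centeredSum X μ f n ω : ℝ) : ℂ) * Complex.I) ∂P)
      atTop (𝓝 ((Real.exp (-(t ^ 2 / 2 * asymVar K μ f)) : ℝ) : ℂ)) := by
  have hinv := hX.inv
  have hmix := mixc_indic_le_alpha1 (K := K) hinv
  have he : ((1 : ℝ≥0∞) - 2 / p).toReal ≤ 1 :=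
    ENNReal.toReal_le_of_le_ofReal zero_le_one (by simp)
  have hα := summable_alpha1 hinv ENNReal.toReal_nonneg he hsum
  obtain ⟨θ, D, hθ, hlim, hτ⟩ := exists_tail_control μ hM hp
  have h0 : ∀ τ, 0 ≤ θ τ := (hθ _ (Mon.zero hM)).nonneg
  choose τ hτ0 hτ1 using fun k : ℕ => hτ _ (alpha1_nonneg (K := K) hinv k) ((1 / 2 : ℝ) ^ k)
    (by positivity)
  have hr : Summable fun k =>
      4 * τ k ^ 2 * alpha1 (Kop K) μ k + 8 * θ (τ k / 2) + θ (τ k) := by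
    refine (summable_nat_add_iff 1).mp (((hsum.mul_left D).add
      ((summable_nat_add_iff 1).mpr summable_geometric_two)).of_nonneg_of_le (fun k => ?_)
      fun k => hτ1 (k + 1))
    have := alpha1_nonneg (K := K) hinv (k + 1)
    have := h0 (τ (k + 1))
    have := h0 (τ (k + 1) / 2)
    positivity
  choose F hF hFf using fun m : ℕ => hf.exists_clippedCombo hθ h0 hlim
    (show 0 < 1 / ((m : ℝ) + 1) by positivity)
  choose B hB using fun m => (hF m).exists_bddMeas
  have hcov : ∀ m l k, |lagCov K μ (F m) (F l) k| ≤
      4 * τ k ^ 2 * alpha1 (Kop K) μ k + 8 * θ (τ k / 2) + θ (τ k) := fun m l k =>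
    (hF m).abs_lagCov_le hinv (hmix k) h0 (hF l) (hτ0 k)
  refine hX.tendsto_charFun_of_approx (F := F) (B := B)
    (s := fun m : ℕ => 4 * √((m : ℝ) + 1) * (2 / ((m : ℝ) + 1)) +
      16 * θ (√((m : ℝ) + 1) / 2) + 8 * θ (√((m : ℝ) + 1)))
    (fun u C hu => tendsto_mixc_of_tendsto_alpha1 hinv hα.tendsto_atTop_zero hu) hf.1 hB
    (fun m => ?_) (hr.mul_left 4)
    (squeeze_zero (fun m => integral_nonneg fun _ => abs_nonneg _) hFf
      tendsto_one_div_add_atTop_nhds_zero_nat) (fun m l hml => ?_)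
    (tendsto_sqrt_mul_add_tail hlim) (fun m k => ?_)
    fun m l k => abs_lagCov_sub_le (hB l) (hB m) (hcov l l k) (hcov l m k) (hcov m l k)
      (hcov m m k)
  · obtain ⟨C, hC⟩ := (hF m).mixc_le (K := K) hinv
    exact (hα.mul_left C).of_nonneg_of_le (fun _ => mixc_nonneg _ _) fun k => hC k _ (hmix k)
  · refine ((hF l).integral_sq_sub_le (hF m) h0
      (show 0 < √((m : ℝ) + 1) by positivity)).trans ?_
    have h := integral_abs_sub_le_of_approx hf.1 (hB l) (hB m) (hFf l) (hFf m)
    have hlm : 1 / ((l : ℝ) + 1) ≤ 1 / ((m : ℝ) + 1) := by gcongr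
    have h2 : ∫ x, |F l x - F m x| ∂μ ≤ 2 / ((m : ℝ) + 1) := by
      rw [show (2 : ℝ) / ((m : ℝ) + 1) = 1 / ((m : ℝ) + 1) + 1 / ((m : ℝ) + 1) by ring]
      linarith
    gcongr
  · have h := hcov m m k
    have := abs_nonneg (lagCov K μ (F m) (F m) k)
    linarith

lemma tendsto_integral_of_tendsto_charFun_gaussian {S : ℕ → Ω → ℝ} {v : ℝ} (hv : 0 ≤ v)
    (hS : ∀ n, AEMeasurable (S n) P)
    (h : ∀ t : ℝ, Tendsto (fun n => ∫ ω, Complex.exp (((t * S n ω : ℝ) : ℂ) * Complex.I) ∂P) atTop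
      (𝓝 ((Real.exp (-(t ^ 2 / 2 * v)) : ℝ) : ℂ))) (g : BoundedContinuousFunction ℝ ℝ) :
    Tendsto (fun n => ∫ ω, g (S n ω) ∂P) atTop
      (𝓝 (∫ y, g y ∂(gaussianReal 0 (Real.toNNReal v)))) := by
  let ν : ℕ → ProbabilityMeasure ℝ := fun n =>
    ⟨P.map (S n), Measure.isProbabilityMeasure_map (hS n)⟩
  let ν₀ : ProbabilityMeasure ℝ := ⟨gaussianReal 0 (Real.toNNReal v), inferInstance⟩
  have hν : Tendsto ν atTop (𝓝 ν₀) := by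
    refine ProbabilityMeasure.tendsto_of_tendsto_charFun fun t => ?_
    have e : charFun (ν₀ : Measure ℝ) t = ((Real.exp (-(t ^ 2 / 2 * v)) : ℝ) : ℂ) := by
      change charFun (gaussianReal 0 (Real.toNNReal v)) t = _
      rw [charFun_gaussianReal, Complex.ofReal_exp]
      have hv' : (((Real.toNNReal v : ℝ≥0) : ℝ) : ℂ) = (v : ℂ) := by rw [Real.coe_toNNReal v hv]
      congr 1
      push_cast
      rw [hv']
      ring
    rw [e]
    refine (h t).congr fun n => ?_
    change _ = charFun (P.map (S n)) t
    rw [charFun_apply_real, integral_map (hS n) (by fun_prop)]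
    simp only [Complex.ofReal_mul]
  have := ProbabilityMeasure.tendsto_iff_forall_integral_tendsto.mp hν g
  refine this.congr fun n => ?_
  exact integral_map (hS n) g.continuous.aestronglyMeasurable

lemma map_eq_of_map_pi_eq (hXm : ∀ i, Measurable (X i)) {i : ℕ}
    (h : Measure.map (fun ω => fun j : Fin 1 => X (j.1 + i) ω) P =
      Measure.map (fun ω => fun j : Fin 1 => X j.1 ω) P) :
    Measure.map (X i) P = Measure.map (X 0) P := by
  have h' := congrArg (Measure.map fun x : Fin 1 → ℝ => x 0) h
  rw [Measure.map_map (by fun_prop) (measurable_pi_lambda _ fun j => hXm _),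
    Measure.map_map (by fun_prop) (measurable_pi_lambda _ fun j => hXm _)] at h'
  simpa [Function.comp_def] using h'

end main

/-- Theorem 3(2), CLT: under the assumptions of Statement 5,
`n^{-1/2} Σ_{i=1}^n (f(X_i) − μ(f))` converges in distribution to the centered
Gaussian law with variance `σ²(μ,K,f)` (convergence in distribution is
expressed by testing against bounded continuous functions). -/
theorem statement6 {Ω : Type*} [MeasurableSpace Ω] (P : Measure Ω)
    [IsProbabilityMeasure P] (X : ℕ → Ω → ℝ) (hXm : ∀ i, Measurable (X i))
    (μ : Measure ℝ) [IsProbabilityMeasure μ]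
    (K : Kernel ℝ ℝ) [IsMarkovKernel K] (hinv : μ.bind (fun x => K x) = μ)
    (hX0 : Measure.map (X 0) P = μ)
    (hMarkov : ∀ n : ℕ, ∀ g : ℝ → ℝ, Measurable g → (∃ C, ∀ x, |g x| ≤ C) →
      P[fun ω => g (X (n + 1) ω)
          | MeasurableSpace.comap (fun ω => fun i : Fin (n + 1) => X i.1 ω) inferInstance]
        =ᵐ[P] fun ω => Kop K g (X n ω))
    (hstat : ∀ k n : ℕ,
      Measure.map (fun ω => fun i : Fin n => X (i.1 + k) ω) P
        = Measure.map (fun ω => fun i : Fin n => X i.1 ω) P)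
    (hErg : Ergodic (fun x : ℕ → ℝ => fun i => x (i + 1))
      (Measure.map (fun ω => fun i => X i ω) P))
    (M : ℝ) (hM : 0 < M) (p : ℝ≥0∞) (hp : 2 < p)
    (f : ℝ → ℝ) (hf : ClassC M p μ f)
    (hsum : Summable fun k : ℕ =>
      (alpha1 (Kop K) μ (k + 1)) ^ (((1:ℝ≥0∞) - 2 / p).toReal)) :
    ∀ g : BoundedContinuousFunction ℝ ℝ,
      Tendsto (fun n : ℕ => ∫ ω, g ((n : ℝ) ^ (-(1:ℝ)/2) *
          ∑ i ∈ Finset.range n, (f (X (i + 1) ω) - ∫ y, f y ∂μ)) ∂P)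
        atTop (𝓝 (∫ y, g y ∂(gaussianReal 0 (Real.toNNReal
          ((∫ x, (f x - ∫ y, f y ∂μ) ^ 2 ∂μ) +
            2 * ∑' k : ℕ, ∫ x, (f x - ∫ y, f y ∂μ) * (Kop K)^[k + 1] f x ∂μ))))) := by
  have hX : StatMarkov P X μ K :=
    ⟨hXm, fun i => (map_eq_of_map_pi_eq hXm (hstat i 1)).trans hX0, hinv, hMarkov⟩
  obtain ⟨hv, h⟩ := hX.tendsto_charFun_of_classC hM hp hf hsum
  have hsqrt : ∀ n : ℕ, (n : ℝ) ^ (-(1:ℝ)/2) = (√n)⁻¹ := fun n => by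
    rw [neg_div, Real.rpow_neg n.cast_nonneg, Real.sqrt_eq_rpow]
  refine tendsto_integral_of_tendsto_charFun_gaussian
    (S := fun n ω => (n : ℝ) ^ (-(1:ℝ)/2) * centeredSum X μ f n ω) hv
    (fun n => (hX.integrable_centeredSum hf.1 n).1.aemeasurable.const_mul _) fun t => ?_
  simp only [hsqrt, ← mul_assoc]
  exact h t

end
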